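/- Let E ⊂ ℝ² be a compact Ahlfors regular set with constant A. For 0 < δ < diam(E) define ℓ(E,δ) = sup_Γ ℋ¹_∞(Γ(δ) ∩ E), where the supremum is over all rectifiable curves Γ (images of continuous maps from [0,1] to ℝ²) with ℋ¹(Γ) = diam(E). Then for every 0 < ε < 1 and every 0 < δ < diam(E), Fav(E(δ)) ≤ C·diam(E)/(log log log(C_ε·diam(E)·ℓ(E,18δ)⁻¹))^{1/(3+ε)}, where C depends only on A and C_ε depends only on A and ε. -/

import Mathlib

open MeasureTheory Metric Set
open scoped ENNReal NNReal

noncomputable section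

abbrev R2 := EuclideanSpace ℝ (Fin 2)

/-- The unit vector in direction `2πθ`. -/
def dir (θ : ℝ) : R2 :=
  (EuclideanSpace.equiv (Fin 2) ℝ).symm ![Real.cos (2 * Real.pi * θ), Real.sin (2 * Real.pi * θ)]

/-- Orthogonal projection `π_θ`. -/
def proj (θ : ℝ) (x : R2) : ℝ :=
  x 0 * Real.cos (2 * Real.pi * θ) + x 1 * Real.sin (2 * Real.pi * θ)

/-- `π_θ^⊥ = π_{θ+1/4}`. -/
def projPerp (θ : ℝ) (x : R2) : ℝ := proj (θ + 1/4) x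

/-- Favard length. -/
def Fav (E : Set R2) : ℝ≥0∞ := ∫⁻ θ in Set.Icc (0:ℝ) 1, μH[1] (proj θ '' E)

/-- Ahlfors regularity with constant `A`. -/
def AhlforsRegular (A : ℝ) (E : Set R2) : Prop :=
  IsClosed E ∧ ∀ x ∈ E, ∀ r : ℝ, 0 < r → ENNReal.ofReal r < EMetric.diam E →
    ENNReal.ofReal (A⁻¹ * r) ≤ μH[1] (E ∩ ball x r) ∧
      μH[1] (E ∩ ball x r) ≤ ENNReal.ofReal (A * r)

/-- A Lipschitz graph with constant `L`: rotated graph of an `L`-Lipschitz function. -/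
def IsLipschitzGraph (L : ℝ) (Γ : Set R2) : Prop :=
  ∃ (R : R2 ≃ₗᵢ[ℝ] R2) (f : ℝ → ℝ), LipschitzWith (Real.toNNReal L) f ∧
    Γ = R '' {x : R2 | x 1 = f (x 0)}

/-- The (untruncated) cone `X(x,G)`. -/
def cone (x : R2) (G : Set ℝ) : Set R2 := ⋃ θ ∈ G, {y | ∃ t : ℝ, y = x + t • dir θ}

/-- The truncated cone `X(x,G,r)`. -/
def coneT (x : R2) (G : Set ℝ) (r : ℝ) : Set R2 := cone x G ∩ ball x r

/-- The doubly truncated cone `X(x,G,r,R)`. -/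
def coneA (x : R2) (G : Set ℝ) (r R : ℝ) : Set R2 := coneT x G R \ ball x r

/-- Hardy–Littlewood maximal function of a measure on `ℝ`. -/
def maximalFn (ν : Measure ℝ) (t : ℝ) : ℝ≥0∞ :=
  ⨆ (r : ℝ) (_ : 0 < r), ν (Set.Ioo (t - r) (t + r)) / ENNReal.ofReal (2 * r)

/-- `μ_θ(x) = M(π_θ μ)(π_θ x)`. -/
def projMax (μ : Measure R2) (θ : ℝ) (x : R2) : ℝ≥0∞ :=
  maximalFn (μ.map (proj θ)) (proj θ x)

/-- `μ_θ^⊥(x) = M(π_θ^⊥ μ)(π_θ^⊥ x)`. -/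
def projMaxPerp (μ : Measure R2) (θ : ℝ) (x : R2) : ℝ≥0∞ :=
  maximalFn (μ.map (projPerp θ)) (projPerp θ x)

/-- The interval with center `c` and length `ℓ`. -/
def itv (c ℓ : ℝ) : Set ℝ := Set.Icc (c - ℓ/2) (c + ℓ/2)

/-- The metric `d_I` associated to the interval with center `c` and length `ℓ`. -/
def dmet (c ℓ : ℝ) (x y : R2) : ℝ :=
  Real.sqrt ((ℓ^2)⁻¹ * (projPerp c x - projPerp c y)^2 + (proj c x - proj c y)^2)

/-- The open `d_I`-ball `B_I(x,r)`. -/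
def bmet (c ℓ : ℝ) (x : R2) (r : ℝ) : Set R2 := {y | dmet c ℓ x y < r}

/-- Triadic intervals of `[0,1)`. -/
def IsTriadic (I : Set ℝ) : Prop :=
  ∃ (j k : ℕ), k < 3^j ∧ I = Set.Ico ((k : ℝ)/3^j) ((k+1 : ℝ)/3^j)

/-- 1-dimensional Hausdorff content. -/
def hContent {X : Type*} [EMetricSpace X] (s : Set X) : ℝ≥0∞ :=
  ⨅ (t : ℕ → Set X) (_ : s ⊆ ⋃ n, t n), ∑' n, EMetric.diam (t n)

/-- `E` is a finite union of parallel segments. -/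
def FinUnionParallelSegments (E : Set R2) : Prop :=
  ∃ (n : ℕ) (d : R2) (p q : Fin n → R2), d ≠ 0 ∧
    (∀ i, ∃ t : ℝ, q i - p i = t • d) ∧ E = ⋃ i, segment ℝ (p i) (q i)


/-- `ℓ(E,δ)`: sup over rectifiable curves `Γ` of length `diam E` of `ℋ¹_∞(Γ(δ) ∩ E)`. -/
def curveSup (E : Set R2) (δ : ℝ) : ℝ≥0∞ :=
  ⨆ (γ : ℝ → R2) (_ : ContinuousOn γ (Set.Icc 0 1))
    (_ : μH[1] (γ '' Set.Icc 0 1) = ENNReal.ofReal (Metric.diam E)),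
    hContent (Metric.cthickening δ (γ '' Set.Icc 0 1) ∩ E)

/-- Iterated difference operator `∏ (1 - τ_u)`, where `τ_u f = f (· + u)`. -/
def iterDiff : List ℝ → (ℝ → ℝ) → ℝ → ℝ
  | [], f => f
  | u :: l, f => iterDiff l (fun t => f t - f (t + u))

lemma iterDiff_sub (l : List ℝ) (f g : ℝ → ℝ) (t : ℝ) :
    iterDiff l (fun t => f t - g t) t = iterDiff l f t - iterDiff l g t := by
  induction l generalizing f g with
  | nil => rfl
  | cons u l ih =>
    simp only [iterDiff]
    rw [← ih]
    congr 1
    funext s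
    ring

lemma iterDiff_shift (l : List ℝ) (f : ℝ → ℝ) (c t : ℝ) :
    iterDiff l (fun t => f (t + c)) t = iterDiff l f (t + c) := by
  induction l generalizing f with
  | nil => rfl
  | cons u l ih =>
    simp only [iterDiff]
    rw [← ih]
    congr 1
    funext s
    rw [add_right_comm]

lemma iterDiff_append (l₁ l₂ : List ℝ) (f : ℝ → ℝ) :
    iterDiff (l₁ ++ l₂) f = iterDiff l₂ (iterDiff l₁ f) := by
  induction l₁ generalizing f with
  | nil => rfl
  | cons u l ih => simp only [List.cons_append, iterDiff, ih]

lemma iterDiff_diff (l : List ℝ) (f : ℝ → ℝ) (u : ℝ) :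
    iterDiff l (fun t => f t - f (t + u)) = fun t => iterDiff l f t - iterDiff l f (t + u) := by
  funext t
  rw [iterDiff_sub, iterDiff_shift]

lemma iterDiff_comm (l₁ l₂ : List ℝ) (f : ℝ → ℝ) :
    iterDiff l₁ (iterDiff l₂ f) = iterDiff l₂ (iterDiff l₁ f) := by
  induction l₁ generalizing f with
  | nil => rfl
  | cons u l ih =>
    simp only [iterDiff]
    rw [← ih, iterDiff_diff l₂]

lemma abs_iterDiff_le {ub x₀ e : ℝ} (l : List ℝ) (f : ℝ → ℝ) (x₁ : ℝ)
    (hl : ∀ u ∈ l, 0 ≤ u ∧ u ≤ ub) (hf : ∀ t, x₀ ≤ t → t ≤ x₁ → |f t| ≤ e) :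
    ∀ t, x₀ ≤ t → t ≤ x₁ - l.length * ub → |iterDiff l f t| ≤ 2 ^ l.length * e := by
  induction l generalizing f x₁ e with
  | nil => simpa [iterDiff] using hf
  | cons u l ih =>
    intro t h0 h1
    obtain ⟨hu0, hu1⟩ := hl u (by simp)
    have := ih (e := 2 * e) (fun t => f t - f (t + u)) (x₁ - ub)
      (fun v hv => hl v (by simp [hv])) (fun t h0 h1 => by
        have a := hf t h0 (by linarith)
        have b := hf (t + u) (by linarith) (by linarith)
        rw [abs_le] at *
        constructor <;> linarith) t h0 (by simp at h1; linarith)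
    simp only [iterDiff, List.length_cons, pow_succ]
    linarith

lemma iterDiff_eq_self {lam : ℝ} (hlam : 0 ≤ lam) (l : List ℝ) (f : ℝ → ℝ) (t : ℝ)
    (hl : ∀ u ∈ l, lam ≤ u) (hf : ∀ s, t + lam ≤ s → f s = 0) :
    iterDiff l f t = f t := by
  induction l generalizing f with
  | nil => rfl
  | cons u l ih =>
    have hu := hl u (by simp)
    simp only [iterDiff]
    rw [ih _ (fun v hv => hl v (by simp [hv])) (fun s hs => by
      rw [hf s hs, hf (s + u) (by linarith), sub_zero]), hf (t + u) (by linarith), sub_zero]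

lemma exists_popular_shift {h g : ℕ} {V : Finset ℕ} (hV : V ⊆ Finset.range h)
    (hd : h ≤ 2 ^ g * V.card) (hh : 2 ^ (g + 3) ≤ h) :
    ∃ w, w < h ∧ h ≤ 2 ^ (g + 3) * w ∧
      h ≤ 2 ^ (2 * g + 2) * (V.filter (fun v => v + w ∈ V)).card := by
  classical
  by_contra! hcon
  set r : ℕ → ℕ := fun w => (V.filter (fun v => v + w ∈ V)).card with hr
  have hsum : ∑ w ∈ Finset.range h, r w = ((V ×ˢ V).filter (fun p => p.1 ≤ p.2)).card := by
    rw [Finset.card_eq_sum_card_fiberwise (f := fun p : ℕ × ℕ => p.2 - p.1)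
      (t := Finset.range h)]
    · refine Finset.sum_congr rfl fun w _ => ?_
      refine Finset.card_bij (fun v _ => (v, v + w)) ?_ ?_ ?_
      · intro v hv
        simp only [Finset.mem_filter] at hv
        simp [hv.1, hv.2]
      · intro v _ v' _ hvv
        simpa using congrArg Prod.fst hvv
      · rintro ⟨a, b⟩ hab
        simp only [Finset.mem_filter, Finset.mem_product] at hab
        obtain ⟨⟨⟨ha, hb⟩, hle⟩, hw⟩ := hab
        have : a + w = b := by omega
        exact ⟨a, by simp [ha, this, hb], by simp [this]⟩
    · intro p hp
      simp only [Finset.coe_filter, Finset.mem_product, mem_ofPred_eq] at hp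
      have := Finset.mem_range.1 (hV hp.1.2)
      simp only [Finset.coe_range, mem_Iio]
      omega
  have hhalf : V.card * V.card ≤ 2 * ((V ×ˢ V).filter (fun p => p.1 ≤ p.2)).card := by
    have h1 : ((V ×ˢ V).filter (fun p => p.1 ≤ p.2)).card
        + ((V ×ˢ V).filter (fun p => ¬ p.1 ≤ p.2)).card = V.card * V.card := by
      rw [Finset.card_filter_add_card_filter_not, Finset.card_product]
    have h2 : ((V ×ˢ V).filter (fun p => ¬ p.1 ≤ p.2)).card
        ≤ ((V ×ˢ V).filter (fun p => p.1 ≤ p.2)).card := by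
      refine Finset.card_le_card_of_injOn Prod.swap ?_ Prod.swap_injective.injOn
      rintro ⟨a, b⟩ hab
      simp only [Finset.coe_filter, Finset.mem_product, mem_ofPred_eq, Prod.swap_prod_mk] at hab ⊢
      exact ⟨⟨hab.1.2, hab.1.1⟩, by omega⟩
    omega
  have hbound : ∀ w ∈ Finset.range h,
      2 ^ (2 * g + 2) * r w ≤ (if 2 ^ (g + 3) * w < h then 2 ^ (2 * g + 2) * V.card else 0)
        + (h - 1) := by
    intro w hw
    split_ifs with hlt
    · exact le_add_right (Nat.mul_le_mul_left _ (Finset.card_filter_le _ _))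
    · have := hcon w (Finset.mem_range.1 hw) (not_lt.1 hlt)
      simp only [hr]; omega
  have h3 := Finset.sum_le_sum hbound
  rw [← Finset.mul_sum, hsum, Finset.sum_add_distrib, ← Finset.sum_filter, Finset.sum_const,
    Finset.sum_const, Finset.card_range, smul_eq_mul, smul_eq_mul] at h3
  have h4 : 2 ^ (g + 3) * ((Finset.range h).filter (fun w => 2 ^ (g + 3) * w < h)).card ≤ 2 * h := by
    have : ((Finset.range h).filter (fun w => 2 ^ (g + 3) * w < h)).card ≤ h / 2 ^ (g + 3) + 1 := by
      rw [← Finset.card_range (h / 2 ^ (g + 3) + 1)]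
      refine Finset.card_le_card fun w hw => ?_
      simp only [Finset.mem_filter, Finset.mem_range] at hw ⊢
      have : w ≤ h / 2 ^ (g + 3) := by
        rw [Nat.le_div_iff_mul_le (by positivity)]; nlinarith
      omega
    have h5 := Nat.mul_div_le h (2 ^ (g + 3))
    calc _ ≤ 2 ^ (g + 3) * (h / 2 ^ (g + 3) + 1) := Nat.mul_le_mul_left _ this
      _ ≤ 2 * h := by rw [mul_add]; omega
  set a := ((Finset.range h).filter (fun w => 2 ^ (g + 3) * w < h)).card
  set T := ((V ×ˢ V).filter (fun p => p.1 ≤ p.2)).card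
  set c := V.card
  set G := 2 ^ g with hG
  have e1 : 2 ^ (2 * g + 2) = 4 * G * G := by rw [hG]; ring
  have e2 : 2 ^ (g + 3) = 8 * G := by rw [hG]; ring
  rw [e1] at h3
  rw [e2] at h4 hh
  have hG1 : 1 ≤ G := Nat.one_le_two_pow
  have hh1 : 1 ≤ h := by omega
  have h6 : h * (h - 1) + h = h * h := by
    obtain ⟨k, rfl⟩ : ∃ k, h = k + 1 := ⟨h - 1, by omega⟩
    simp; ring
  -- `2 G² c² ≤ 4 G² T ≤ a 4 G² c + h (h-1)`
  have h7 : 2 * (G * G) * (c * c) ≤ 4 * G * G * T := by nlinarith [Nat.mul_le_mul_left (2 * (G * G)) hhalf]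
  have h8 : a * (4 * G * G * c) ≤ h * (G * c) := by
    have := Nat.mul_le_mul_right (G * c) h4
    nlinarith
  have h9 : h * (G * c) ≤ (G * c) * (G * c) := Nat.mul_le_mul_right _ hd
  have h10 : h * h ≤ (G * c) * (G * c) := Nat.mul_le_mul hd hd
  nlinarith

lemma list_sum_map_sub {α : Type*} (L : List α) (f g : α → ℝ) :
    (L.map fun x => f x - g x).sum = (L.map f).sum - (L.map g).sum := by
  induction L with
  | nil => simp
  | cons a L ih => simp only [List.map_cons, List.sum_cons, ih]; ring

/-- If a fixed profile `N` superposed with `L.length` drifting profiles is annihilated, up to a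
small error and for many drift parameters `v`, by short products of differences, then so is `N`. -/
lemma exists_annihilator_of_drifting {h γ : ℕ} {lam ub x₀ : ℝ} (hlam : 0 ≤ lam) (hub : 0 ≤ ub)
    (hh : 2 ^ γ ≤ h) :
    ∀ (J : ℕ) (L : List (ℝ × (ℝ → ℝ))) (g q : ℕ) (V : Finset ℕ) (u : ℕ → List ℝ) (N : ℝ → ℝ) (e Y : ℝ),
      L.length = J → (g + 3) * 2 ^ J ≤ γ → V ⊆ Finset.range h → h ≤ 2 ^ g * V.card → 0 ≤ e →
      (∀ p ∈ L, lam * 2 ^ γ ≤ h * |p.1| ∧ h * |p.1| ≤ ub) →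
      (∀ v ∈ V, (u v).length ≤ q ∧ (∀ x ∈ u v, lam ≤ x ∧ x ≤ ub) ∧ ∀ t, x₀ ≤ t → t ≤ Y →
        |iterDiff (u v) (fun t => N t + (L.map fun p => p.2 (t - v * p.1)).sum) t| ≤ e) →
      ∃ l : List ℝ, l.length ≤ J + 2 ^ J * q ∧ (∀ x ∈ l, lam ≤ x ∧ x ≤ ub) ∧
        ∀ t, x₀ ≤ t → t ≤ Y - (J + 2 ^ J * q - q) * ub →
          2 ^ q * |iterDiff l N t| ≤ 2 ^ (J + 2 ^ J * q) * e := by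
  intro J
  induction J with
  | zero =>
    intro L g q V u N e Y hL hg hV hd he _ hu
    obtain rfl := List.length_eq_zero_iff.1 hL
    have hne : V.Nonempty := by
      rw [← Finset.card_pos]
      by_contra hc
      have : V.card = 0 := by omega
      rw [this] at hd
      have := Nat.one_le_two_pow (n := γ)
      omega
    obtain ⟨v, hv⟩ := hne
    obtain ⟨h1, h2, h3⟩ := hu v hv
    refine ⟨u v, by simpa using h1, h2, fun t ht0 ht1 => ?_⟩
    have := h3 t ht0 (by simpa using ht1)
    simp only [List.map_nil, List.sum_nil, add_zero] at this
    simp only [pow_zero, one_mul, zero_add]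
    gcongr
  | succ J ih =>
    intro L g q V u N e Y hL hg hV hd he hp hu
    obtain ⟨⟨p, S⟩, L, rfl⟩ : ∃ a L', L = a :: L' := by
      cases L with
      | nil => simp at hL
      | cons a L' => exact ⟨a, L', rfl⟩
    simp only [List.length_cons, add_left_inj] at hL
    have hJ : 1 ≤ 2 ^ J := Nat.one_le_two_pow
    have hg' : (g + 3) * (2 * 2 ^ J) ≤ γ := by
      simpa [pow_succ, mul_comm, mul_left_comm] using hg
    have hgγ : g + 3 ≤ γ := by nlinarith
    obtain ⟨w, hwh, hw, hV1⟩ := exists_popular_shift hV hd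
      (le_trans (Nat.pow_le_pow_right (by norm_num) hgγ) hh)
    obtain ⟨hp1, hp2⟩ := hp (p, S) (by simp)
    simp only at hp1 hp2
    set τ := w * |p| with hτ
    have hτ0 : lam ≤ τ := by
      have h1 : (h : ℝ) ≤ 2 ^ γ * w := by
        have : h ≤ 2 ^ γ * w :=
          hw.trans (Nat.mul_le_mul_right _ (Nat.pow_le_pow_right (by norm_num) hgγ))
        exact_mod_cast this
      have h2 : (h : ℝ) * |p| ≤ 2 ^ γ * w * |p| := mul_le_mul_of_nonneg_right h1 (abs_nonneg _)
      have h3 : (0 : ℝ) < 2 ^ γ := by positivity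
      nlinarith
    have hτ1 : τ ≤ ub := by
      refine le_trans ?_ hp2
      rw [hτ]
      gcongr
    -- the new drifting profiles
    obtain ⟨L', hlen, hL'p, hL'⟩ : ∃ L' : List (ℝ × (ℝ → ℝ)), L'.length = L.length ∧
        (∀ x ∈ L', ∃ y ∈ L, y.1 = x.1) ∧
        ∀ v ∈ V.filter (fun v => v + w ∈ V), ∀ t, x₀ ≤ t → t ≤ Y - (q + 1) * ub →
          |iterDiff (u v ++ u (v + w)) (fun t => (N t - N (t + τ))
            + (L'.map fun p => p.2 (t - v * p.1)).sum) t| ≤ 2 * (2 ^ q * e) := by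
      have key : ∀ v ∈ V.filter (fun v => v + w ∈ V), ∀ t, x₀ ≤ t → t ≤ Y - q * ub →
          |iterDiff (u v ++ u (v + w)) (fun t => N t + (((p, S) :: L).map
            fun p => p.2 (t - v * p.1)).sum) t| ≤ 2 ^ q * e ∧
          |iterDiff (u v ++ u (v + w)) (fun t => N t + (((p, S) :: L).map
            fun p => p.2 (t - (v + w : ℕ) * p.1)).sum) t| ≤ 2 ^ q * e := by
        intro v hv t ht0 ht1
        rw [Finset.mem_filter] at hv
        obtain ⟨a1, a2, a3⟩ := hu v hv.1
        obtain ⟨b1, b2, b3⟩ := hu (v + w) hv.2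
        have gen : ∀ l₁ l₂ : List ℝ, l₂.length ≤ q → (∀ x ∈ l₂, lam ≤ x ∧ x ≤ ub) → ∀ f,
            (∀ t, x₀ ≤ t → t ≤ Y → |iterDiff l₁ f t| ≤ e) → |iterDiff l₂ (iterDiff l₁ f) t|
              ≤ 2 ^ q * e := by
          intro l₁ l₂ hq hx f hf
          have hq' : (l₂.length : ℝ) ≤ q := by exact_mod_cast hq
          refine (abs_iterDiff_le (ub := ub) l₂ _ Y (fun x hxx => ⟨hlam.trans (hx x hxx).1,
            (hx x hxx).2⟩) hf t ht0 (by nlinarith)).trans ?_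
          gcongr
          norm_num
        refine ⟨?_, ?_⟩
        · rw [iterDiff_append]
          exact gen _ _ b1 b2 _ a3
        · rw [iterDiff_append, iterDiff_comm]
          exact gen _ _ a1 a2 _ b3
      rcases le_total 0 p with hp0 | hp0
      · refine ⟨L.map fun x => (x.1, fun t => x.2 t - x.2 (t + w * (p - x.1))), by simp, ?_, ?_⟩
        · intro x hx
          simp only [List.mem_map] at hx
          obtain ⟨y, hy, rfl⟩ := hx
          exact ⟨y, hy, rfl⟩
        · intro v hv t ht0 ht1
          have hτp : τ = w * p := by rw [hτ, abs_of_nonneg hp0]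
          have h1 := (key v hv t ht0 (by linarith)).1
          have h2 := (key v hv (t + τ) (by linarith) (by linarith)).2
          rw [← iterDiff_shift] at h2
          have : (fun t => (N t - N (t + τ)) + ((L.map fun x : ℝ × (ℝ → ℝ) =>
              (x.1, fun t => x.2 t - x.2 (t + w * (p - x.1)))).map
                fun p => p.2 (t - v * p.1)).sum) =
              fun t => (N t + (((p, S) :: L).map fun p => p.2 (t - v * p.1)).sum) -
                (N (t + τ) + (((p, S) :: L).map
                  fun p => p.2 (t + τ - (v + w : ℕ) * p.1)).sum) := by
            funext t
            have hS : t + τ - (v + w : ℕ) * p = t - v * p := by rw [hτp]; push_cast; ring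
            simp only [List.map_cons, List.sum_cons, hS, List.map_map]
            have : (L.map ((fun p : ℝ × (ℝ → ℝ) => p.2 (t - v * p.1)) ∘ fun x : ℝ × (ℝ → ℝ) =>
                (x.1, fun t => x.2 t - x.2 (t + w * (p - x.1))))).sum =
                (L.map fun p => p.2 (t - v * p.1)).sum -
                  (L.map fun p => p.2 (t + τ - (v + w : ℕ) * p.1)).sum := by
              rw [← list_sum_map_sub]
              congr 1
              refine List.map_congr_left fun x _ => ?_
              have : t - v * x.1 + w * (p - x.1) = t + τ - (v + w : ℕ) * x.1 := by
                rw [hτp]; push_cast; ring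
              simp only [Function.comp, this]
            rw [this]
            ring
          rw [this, iterDiff_sub]
          rw [abs_le] at *
          constructor <;> linarith
      · refine ⟨L.map fun x => (x.1, fun t => x.2 (t - w * x.1) - x.2 (t + τ)), by simp, ?_, ?_⟩
        · intro x hx
          simp only [List.mem_map] at hx
          obtain ⟨y, hy, rfl⟩ := hx
          exact ⟨y, hy, rfl⟩
        · intro v hv t ht0 ht1
          have hτp : τ = - (w * p) := by rw [hτ, abs_of_nonpos hp0]; ring
          have h1 := (key v hv t ht0 (by linarith)).2
          have h2 := (key v hv (t + τ) (by linarith) (by linarith)).1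
          rw [← iterDiff_shift] at h2
          have : (fun t => (N t - N (t + τ)) + ((L.map fun x : ℝ × (ℝ → ℝ) =>
              (x.1, fun t => x.2 (t - w * x.1) - x.2 (t + τ))).map
                fun p => p.2 (t - v * p.1)).sum) =
              fun t => (N t + (((p, S) :: L).map fun p => p.2 (t - (v + w : ℕ) * p.1)).sum) -
                (N (t + τ) + (((p, S) :: L).map
                  fun p => p.2 (t + τ - v * p.1)).sum) := by
            funext t
            have hS : t - (v + w : ℕ) * p = t + τ - v * p := by rw [hτp]; push_cast; ring
            simp only [List.map_cons, List.sum_cons, hS, List.map_map]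
            have : (L.map ((fun p : ℝ × (ℝ → ℝ) => p.2 (t - v * p.1)) ∘ fun x : ℝ × (ℝ → ℝ) =>
                (x.1, fun t => x.2 (t - w * x.1) - x.2 (t + τ)))).sum =
                (L.map fun p => p.2 (t - (v + w : ℕ) * p.1)).sum -
                  (L.map fun p => p.2 (t + τ - v * p.1)).sum := by
              rw [← list_sum_map_sub]
              congr 1
              refine List.map_congr_left fun x _ => ?_
              have e1 : t - v * x.1 - w * x.1 = t - (v + w : ℕ) * x.1 := by
                push_cast; ring
              have e2 : t - v * x.1 + τ = t + τ - v * x.1 := by ring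
              simp only [Function.comp, e1, e2]
            rw [this]
            ring
          rw [this, iterDiff_sub]
          rw [abs_le] at *
          constructor <;> linarith
    obtain ⟨l, hl1, hl2, hl3⟩ := ih L' (2 * g + 2) (2 * q) (V.filter (fun v => v + w ∈ V))
      (fun v => u v ++ u (v + w)) (fun t => N t - N (t + τ)) (2 * (2 ^ q * e)) (Y - (q + 1) * ub)
      (hlen.trans hL) (le_trans (by nlinarith) hg') ((Finset.filter_subset _ _).trans hV) hV1
      (by positivity)
      (fun x hx => by
        obtain ⟨y, hy, hyx⟩ := hL'p x hx
        rw [← hyx]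
        exact hp y (by simp [hy]))
      (fun v hv => by
        refine ⟨?_, ?_, hL' v hv⟩
        · rw [Finset.mem_filter] at hv
          have := (hu v hv.1).1
          have := (hu _ hv.2).1
          simp only [List.length_append]
          omega
        · rw [Finset.mem_filter] at hv
          intro x hx
          rcases List.mem_append.1 hx with hx | hx
          · exact (hu v hv.1).2.1 x hx
          · exact (hu _ hv.2).2.1 x hx)
    refine ⟨τ :: l, ?_, ?_, ?_⟩
    · simp only [List.length_cons, pow_succ]
      nlinarith
    · intro x hx
      rcases List.mem_cons.1 hx with rfl | hx
      · exact ⟨hτ0, hτ1⟩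
      · exact hl2 x hx
    · intro t ht0 ht1
      have := hl3 t ht0 (by push_cast at ht1 ⊢; rw [pow_succ] at ht1; linarith)
      have e1 : (2 : ℝ) ^ (2 * q) = 2 ^ q * 2 ^ q := by rw [two_mul, pow_add]
      have e2 : (2 : ℝ) ^ (J + 2 ^ J * (2 * q)) * (2 * (2 ^ q * e)) =
          2 ^ q * (2 ^ (J + 1 + 2 ^ (J + 1) * q) * e) := by
        rw [show J + 1 + 2 ^ (J + 1) * q = (J + 2 ^ J * (2 * q)) + 1 by ring, pow_succ]
        ring
      rw [e1, e2, mul_assoc] at this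
      exact le_of_mul_le_mul_left this (by positivity)

/-- Projection in the `j`-th of `n` equidistributed directions. -/
def prj (n j : ℕ) (y : R2) : ℝ := proj ((j : ℝ) / n) y

/-- Projection orthogonal to `prj n j`. -/
def prp (n j : ℕ) (y : R2) : ℝ := projPerp ((j : ℝ) / n) y

lemma norm_sq_R2 (y : R2) : ‖y‖ ^ 2 = y 0 ^ 2 + y 1 ^ 2 := by
  rw [EuclideanSpace.norm_sq_eq]; simp [Fin.sum_univ_two]

lemma proj_sub (θ : ℝ) (x y : R2) : proj θ (x - y) = proj θ x - proj θ y := by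
  simp [proj]; ring

lemma projPerp_sub (θ : ℝ) (x y : R2) : projPerp θ (x - y) = projPerp θ x - projPerp θ y :=
  proj_sub _ _ _

lemma projPerp_eq (θ : ℝ) (y : R2) : projPerp θ y =
    - y 0 * Real.sin (2 * Real.pi * θ) + y 1 * Real.cos (2 * Real.pi * θ) := by
  have : 2 * Real.pi * (θ + 1 / 4) = 2 * Real.pi * θ + Real.pi / 2 := by ring
  rw [projPerp, proj, this, Real.cos_add_pi_div_two, Real.sin_add_pi_div_two]
  ring

lemma proj_sq_add_projPerp_sq (θ : ℝ) (y : R2) : proj θ y ^ 2 + projPerp θ y ^ 2 = ‖y‖ ^ 2 := by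
  rw [norm_sq_R2, projPerp_eq, proj]
  linear_combination (y 0 ^ 2 + y 1 ^ 2) * Real.sin_sq_add_cos_sq (2 * Real.pi * θ)

lemma abs_proj_le (θ : ℝ) (y : R2) : |proj θ y| ≤ ‖y‖ := by
  have := proj_sq_add_projPerp_sq θ y
  exact abs_le_of_sq_le_sq (by nlinarith [sq_nonneg (projPerp θ y)]) (norm_nonneg _)

lemma abs_projPerp_le (θ : ℝ) (y : R2) : |projPerp θ y| ≤ ‖y‖ := abs_proj_le _ _

lemma proj_add_angle (θ φ : ℝ) (y : R2) : proj (θ + φ) y =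
    Real.cos (2 * Real.pi * φ) * proj θ y + Real.sin (2 * Real.pi * φ) * projPerp θ y := by
  rw [projPerp_eq, proj, proj, mul_add, Real.cos_add, Real.sin_add]
  ring

lemma abs_proj_rotate_sub_le {θ φ : ℝ} (h0 : 0 ≤ 2 * Real.pi * φ) (h1 : 2 * Real.pi * φ ≤ 1)
    (y : R2) : |proj (θ + φ) y - (proj θ y + (2 * Real.pi * φ) * projPerp θ y)| ≤
      (2 * Real.pi * φ) ^ 2 * ‖y‖ := by
  rw [proj_add_angle]
  set x := 2 * Real.pi * φ
  have hc : |Real.cos x - 1| ≤ x ^ 2 / 2 := by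
    rw [abs_le]
    constructor
    · have := Real.one_sub_sq_div_two_le_cos (x := x); linarith
    · have := Real.cos_le_one x; nlinarith [sq_nonneg x]
  have hs : |Real.sin x - x| ≤ x ^ 2 / 2 := by
    rw [abs_le]
    constructor
    · rcases h0.eq_or_lt with h | h
      · simp [← h]
      · have := Real.sin_gt_sub_cube h
        nlinarith [mul_nonneg (sq_nonneg x) (by linarith : 0 ≤ 1 - x), sq_nonneg x]
    · have := Real.sin_le h0; nlinarith [sq_nonneg x]
  have e : Real.cos x * proj θ y + Real.sin x * projPerp θ y - (proj θ y + x * projPerp θ y)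
      = (Real.cos x - 1) * proj θ y + (Real.sin x - x) * projPerp θ y := by ring
  rw [e]
  calc _ ≤ |Real.cos x - 1| * |proj θ y| + |Real.sin x - x| * |projPerp θ y| := by
        rw [← abs_mul, ← abs_mul]; exact abs_add_le _ _
    _ ≤ x ^ 2 / 2 * ‖y‖ + x ^ 2 / 2 * ‖y‖ := by
        gcongr
        · exact abs_proj_le _ _
        · exact abs_projPerp_le _ _
    _ = _ := by ring

lemma abs_proj_rotate_sub_le' {θ φ : ℝ} (h0 : 0 ≤ 2 * Real.pi * φ) (h1 : 2 * Real.pi * φ ≤ 1)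
    (y : R2) : |proj (θ + φ) y - proj θ y| ≤ 2 * (2 * Real.pi * φ) * ‖y‖ := by
  have h := abs_proj_rotate_sub_le (θ := θ) h0 h1 y
  set x := 2 * Real.pi * φ
  have h2 : |x * projPerp θ y| ≤ x * ‖y‖ := by
    rw [abs_mul, abs_of_nonneg h0]
    exact mul_le_mul_of_nonneg_left (abs_projPerp_le _ _) h0
  have h3 : x ^ 2 * ‖y‖ ≤ x * ‖y‖ := by
    apply mul_le_mul_of_nonneg_right _ (norm_nonneg _); nlinarith
  rw [abs_le] at *
  constructor <;> linarith

lemma prj_sub (n j : ℕ) (x y : R2) : prj n j (x - y) = prj n j x - prj n j y := proj_sub _ _ _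

lemma abs_prj_le (n j : ℕ) (y : R2) : |prj n j y| ≤ ‖y‖ := abs_proj_le _ _

lemma abs_prp_sub_le (n j : ℕ) (x y : R2) : |prp n j x - prp n j y| ≤ ‖x - y‖ := by
  rw [prp, prp, ← projPerp_sub]; exact abs_projPerp_le _ _

lemma abs_prj_add_sub_le {n j v : ℕ} {ν : ℝ} (h : 2 * Real.pi / n * v ≤ ν) (hν : ν ≤ 1) (y : R2) :
    |prj n (j + v) y - prj n j y| ≤ 2 * ν * ‖y‖ ∧
    |prj n (j + v) y - (prj n j y + v * (2 * Real.pi / n * prp n j y))| ≤ ν ^ 2 * ‖y‖ := by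
  have e : 2 * Real.pi * ((v : ℝ) / n) = 2 * Real.pi / n * v := by ring
  have e2 : (((j + v : ℕ) : ℝ) / n) = (j : ℝ) / n + (v : ℝ) / n := by push_cast; ring
  have h0 : 0 ≤ 2 * Real.pi * ((v : ℝ) / n) := by positivity
  have h1 : 2 * Real.pi * ((v : ℝ) / n) ≤ 1 := by rw [e]; linarith
  have hp := norm_nonneg y
  constructor
  · refine (e2 ▸ abs_proj_rotate_sub_le' (θ := (j : ℝ) / n) h0 h1 y).trans ?_
    rw [e]; gcongr
  · have := e2 ▸ abs_proj_rotate_sub_le (θ := (j : ℝ) / n) h0 h1 y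
    rw [e] at this
    have e3 : (v : ℝ) * (2 * Real.pi / n * prp n j y) = 2 * Real.pi / n * v * prp n j y := by ring
    rw [e3]
    refine this.trans ?_
    gcongr

/-- Number of `y ∈ S` with `x y ∈ (t, t + lam]`. -/
def winCount (S : Finset R2) (x : R2 → ℝ) (lam t : ℝ) : ℝ :=
  ∑ y ∈ S, if t < x y ∧ x y ≤ t + lam then 1 else 0

lemma winCount_eq_card (S : Finset R2) (x : R2 → ℝ) (lam t : ℝ) :
    winCount S x lam t = (S.filter (fun y => t < x y ∧ x y ≤ t + lam)).card := by
  rw [winCount, Finset.sum_boole]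

/-- `P` has density at least `c` in each `[j, j + h)`, `h ≤ n`. -/
def DenseAt (c : ℝ) (n : ℕ) (P : Finset ℕ) (j : ℕ) : Prop :=
  ∀ h : ℕ, 1 ≤ h → h ≤ n → c * h ≤ (P.filter (fun x => j ≤ x ∧ x < j + h)).card

open Classical in
/-- The elements `j ∈ P` such that `P` has density at least `c` in each `[j, j + h)`, `h ≤ n`. -/
def thick (c : ℝ) (n : ℕ) (P : Finset ℕ) : Finset ℕ := P.filter (DenseAt c n P)

lemma thick_subset (c : ℝ) (n : ℕ) (P : Finset ℕ) : thick c n P ⊆ P := by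
  classical
  exact Finset.filter_subset _ _

lemma mem_thick {c : ℝ} {n : ℕ} {P : Finset ℕ} {j : ℕ} :
    j ∈ thick c n P ↔ j ∈ P ∧ DenseAt c n P j := by
  classical
  simp [thick]

lemma iterate_thick_subset (c : ℝ) (n : ℕ) (P : Finset ℕ) (i : ℕ) : (thick c n)^[i] P ⊆ P := by
  induction i with
  | zero => simp
  | succ i ih => rw [Function.iterate_succ_apply']; exact (thick_subset _ _ _).trans ih

/-- Hypotheses for the one-scale analysis around the origin: `E` is lower regular, its projection
counts are flat in the directions `G`, and the numerical parameters are well separated. -/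
structure ScaleData (n m γ g : ℕ) (A a lam ρ W D e : ℝ) (E : Finset R2) (G : Finset ℕ) : Prop where
  hm : 1 ≤ m
  hA : 1 ≤ A
  hlam : 1 ≤ lam
  hρ : 0 ≤ ρ
  hW : 12 ≤ W
  he : 0 ≤ e
  hn : 2 * D ≤ n
  hγ : (g + 3) * 2 ^ m ≤ γ
  h1 : 32 * lam * 2 ^ γ ≤ ρ * W
  h2 : 8 * m * lam * 2 ^ γ * (2 * W) ^ (m + 1) ≤ a
  h3 : 2 * m * 2 ^ ((m + 1) * m) * (4 * lam * (2 * W) ^ m * 2 ^ γ) ≤ a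
  hD : ∀ y ∈ E, ‖y‖ ≤ D
  regular : ∀ z ∈ E, a / A ≤ (E.filter (fun y => ‖y - z‖ ≤ a)).card
  flat : ∀ j ∈ G, ∀ t t', |t| ≤ 6 * a → |t'| ≤ 6 * a →
    |winCount E (prj n j) lam t - winCount E (prj n j) lam t'| ≤ e
  thin : ∀ j ∈ G, ∀ t, |t| ≤ 6 * a → (E.filter (fun y => |prj n j y - t| ≤ ρ / 2)).card ≤ e
  tube : ∀ j ∈ G, A * (E.filter (fun y => |prj n j y| ≤ 6 * a)).card < m * a

namespace ScaleData

variable {n m γ g : ℕ} {A a lam ρ W D e : ℝ} {E : Finset R2} {G : Finset ℕ}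

lemma a_ge (H : ScaleData n m γ g A a lam ρ W D e E G) : 8 * lam ≤ a := by
  have := H.h2
  have hm : (1 : ℝ) ≤ m := by exact_mod_cast H.hm
  have hl := H.hlam
  have h1 : (1 : ℝ) ≤ 2 ^ γ := one_le_pow₀ (by norm_num)
  have h2 : (1 : ℝ) ≤ (2 * W) ^ (m + 1) := one_le_pow₀ (by linarith [H.hW])
  calc 8 * lam = 8 * 1 * lam * 1 * 1 := by ring
    _ ≤ 8 * m * lam * 2 ^ γ * (2 * W) ^ (m + 1) := by gcongr
    _ ≤ a := this

lemma a_pos (H : ScaleData n m γ g A a lam ρ W D e E G) : 0 < a := by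
  have := H.a_ge; have := H.hlam; linarith

lemma card_lt_of_separated (H : ScaleData n m γ g A a lam ρ W D e E G) {j : ℕ} (hj : j ∈ G)
    {S : Finset R2} (hS : S ⊆ E) (hsep : ∀ x ∈ S, ∀ y ∈ S, x ≠ y → 2 * a < ‖x - y‖)
    (htube : ∀ x ∈ S, |prj n j x| ≤ 5 * a) : S.card < m := by
  classical
  have ha := H.a_pos
  have hA : 0 < A := by linarith [H.hA]
  have hdisj : (S : Set R2).PairwiseDisjoint (fun x => E.filter (fun y => ‖y - x‖ ≤ a)) := by
    intro x hx y hy hxy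
    simp only [Function.onFun]
    rw [Finset.disjoint_left]
    intro z hz1 hz2
    simp only [Finset.mem_filter] at hz1 hz2
    have := hsep x hx y hy hxy
    have h4 : ‖x - y‖ ≤ ‖z - x‖ + ‖z - y‖ := by
      rw [norm_sub_rev z x]
      have := norm_add_le (x - z) (z - y)
      simpa using this
    linarith [hz1.2, hz2.2]
  have h1 : ((S.biUnion fun x => E.filter (fun y => ‖y - x‖ ≤ a)).card : ℝ) ≤
      (E.filter (fun y => |prj n j y| ≤ 6 * a)).card := by
    norm_cast
    refine Finset.card_le_card fun z hz => ?_
    simp only [Finset.mem_biUnion, Finset.mem_filter] at hz ⊢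
    obtain ⟨x, hx, hz, hzx⟩ := hz
    refine ⟨hz, ?_⟩
    have h5 := htube x hx
    have h6 := abs_prj_le n j (z - x)
    rw [prj_sub] at h6
    rw [abs_le] at *
    constructor <;> linarith
  rw [Finset.card_biUnion hdisj] at h1
  push_cast at h1
  have h2 : (S.card : ℝ) * (a / A) ≤ ∑ x ∈ S, ((E.filter (fun y => ‖y - x‖ ≤ a)).card : ℝ) := by
    rw [← nsmul_eq_mul]
    exact Finset.card_nsmul_le_sum _ _ _ fun x hx => H.regular x (hS hx)
  have h3 := H.tube j hj
  have h4 : (S.card : ℝ) * a < m * a := by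
    have : (S.card : ℝ) * a = A * (S.card * (a / A)) := by field_simp
    rw [this]
    exact lt_of_le_of_lt (mul_le_mul_of_nonneg_left (h2.trans h1) hA.le) h3
  exact_mod_cast lt_of_mul_lt_mul_right h4 ha.le

lemma exists_empty_annulus (H : ScaleData n m γ g A a lam ρ W D e E G) {j : ℕ} (hj : j ∈ G)
    {r τ : ℝ} (hr : a ≤ r) (hτ : τ ≤ 5 * a) : ∃ l < m, ∀ y ∈ E, |prj n j y| ≤ τ →
      r * (2 * W) ^ l < ‖y‖ → W * (r * (2 * W) ^ l) < ‖y‖ := by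
  classical
  by_contra! hcon
  have hW := H.hW
  have ha := H.a_pos
  choose! f hfE hfτ hf1 hf2 using hcon
  have hsep : ∀ l < m, ∀ l' < m, l < l' → 2 * a < ‖f l - f l'‖ := by
    intro l hl l' hl' hll
    have h1 := hf2 l hl
    have h2 := hf1 l' hl'
    have h3 : (2 * W) ^ (l + 1) ≤ (2 * W) ^ l' := pow_le_pow_right₀ (by linarith) hll
    have h4 : (1 : ℝ) ≤ (2 * W) ^ l := one_le_pow₀ (by linarith)
    have h5 : r * (2 * W) ^ (l + 1) ≤ r * (2 * W) ^ l' :=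
      mul_le_mul_of_nonneg_left h3 (by linarith)
    rw [pow_succ] at h5
    have h6 : a ≤ r * (2 * W) ^ l := by nlinarith
    have h7 := norm_sub_norm_le (f l') (f l)
    rw [norm_sub_rev] at h7
    nlinarith
  have hinj : Set.InjOn f (Finset.range m) := by
    intro l hl l' hl' hll
    simp only [Finset.coe_range, mem_Iio] at hl hl'
    by_contra hne
    rcases Nat.lt_or_gt_of_ne hne with h | h
    · have := hsep l hl l' hl' h
      rw [hll, sub_self, norm_zero] at this; linarith
    · have := hsep l' hl' l hl h
      rw [hll, sub_self, norm_zero] at this; linarith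
  have := H.card_lt_of_separated hj (S := (Finset.range m).image f) (by
      intro x hx
      simp only [Finset.mem_image, Finset.mem_range] at hx
      obtain ⟨l, hl, rfl⟩ := hx
      exact hfE l hl) (by
      intro x hx y hy hxy
      simp only [Finset.mem_image, Finset.mem_range] at hx hy
      obtain ⟨l, hl, rfl⟩ := hx
      obtain ⟨l', hl', rfl⟩ := hy
      rcases lt_trichotomy l l' with h | h | h
      · exact hsep l hl l' hl' h
      · exact absurd (by rw [h]) hxy
      · rw [norm_sub_rev]; exact hsep l' hl' l hl h) (by
      intro x hx
      simp only [Finset.mem_image, Finset.mem_range] at hx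
      obtain ⟨l, hl, rfl⟩ := hx
      exact (hfτ l hl).trans hτ)
  rw [Finset.card_image_of_injOn hinj, Finset.card_range] at this
  exact lt_irrefl _ this

end ScaleData

/-- A finite set has a maximal `r`-separated subset, together with a nearest-point type map. -/
lemma exists_net (S : Finset R2) {r : ℝ} (hr : 0 ≤ r) : ∃ (C : Finset R2) (φ : R2 → R2), C ⊆ S ∧
    (∀ x ∈ C, ∀ y ∈ C, x ≠ y → r < ‖x - y‖) ∧ ∀ y ∈ S, φ y ∈ C ∧ ‖y - φ y‖ ≤ r := by
  classical
  induction S using Finset.induction_on with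
  | empty => exact ⟨∅, id, by simp, by simp, by simp⟩
  | insert z S hz ih =>
    obtain ⟨C, φ, hC, hsep, hφ⟩ := ih
    by_cases h : ∃ c ∈ C, ‖z - c‖ ≤ r
    · obtain ⟨c, hc, hzc⟩ := h
      refine ⟨C, Function.update φ z c, hC.trans (Finset.subset_insert _ _), hsep, ?_⟩
      intro y hy
      by_cases hyz : y = z
      · subst hyz; simp [hc, hzc]
      · rw [Function.update_of_ne hyz]
        exact hφ y (Finset.mem_of_mem_insert_of_ne hy hyz)
    · push Not at h
      refine ⟨insert z C, Function.update φ z z, Finset.insert_subset_insert _ hC, ?_, ?_⟩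
      · intro x hx y hy hxy
        rcases Finset.mem_insert.1 hx with hx | hx <;> rcases Finset.mem_insert.1 hy with hy | hy
        · exact absurd (hx.trans hy.symm) hxy
        · rw [hx]; exact h y hy
        · rw [norm_sub_rev, hy]; exact h x hx
        · exact hsep x hx y hy hxy
      · intro y hy
        by_cases hyz : y = z
        · subst hyz; simp [hr]
        · rw [Function.update_of_ne hyz]
          have := hφ y (Finset.mem_of_mem_insert_of_ne hy hyz)
          exact ⟨Finset.mem_insert_of_mem this.1, this.2⟩

lemma winCount_of_subset {S T : Finset R2} (hST : S ⊆ T) (x : R2 → ℝ) (lam t : ℝ)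
    (h : ∀ y ∈ T, y ∉ S → t < x y → x y ≤ t + lam → False) :
    winCount S x lam t = winCount T x lam t := by
  refine Finset.sum_subset hST fun y hy hyS => ?_
  rw [if_neg]
  exact fun hc => h y hy hyS hc.1 hc.2

lemma abs_winCount_sub_le {E S : Finset R2} (hS : S ⊆ E) {x x' : R2 → ℝ} {ρ lam t e : ℝ}
    (hx : ∀ y ∈ S, |x y - x' y| ≤ ρ / 2)
    (h1 : (E.filter (fun y => |x y - t| ≤ ρ / 2)).card ≤ e)
    (h2 : (E.filter (fun y => |x y - (t + lam)| ≤ ρ / 2)).card ≤ e) :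
    |winCount S x lam t - winCount S x' lam t| ≤ 2 * e := by
  have key : ∀ y ∈ S, |(if t < x y ∧ x y ≤ t + lam then (1 : ℝ) else 0) -
      (if t < x' y ∧ x' y ≤ t + lam then 1 else 0)| ≤
      (if |x y - t| ≤ ρ / 2 then 1 else 0) + (if |x y - (t + lam)| ≤ ρ / 2 then 1 else 0) := by
    intro y hy
    have h := hx y hy
    by_cases ha : |x y - t| ≤ ρ / 2
    · rw [if_pos ha]
      split_ifs <;> norm_num
    · by_cases hb : |x y - (t + lam)| ≤ ρ / 2
      · rw [if_pos hb]
        split_ifs <;> norm_num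
      · have : (t < x y ∧ x y ≤ t + lam) ↔ (t < x' y ∧ x' y ≤ t + lam) := by
          rw [not_le, lt_abs] at ha hb
          rw [abs_le] at h
          constructor
          · rintro ⟨h3, h4⟩
            constructor
            · rcases ha with ha | ha <;> linarith
            · rcases hb with hb | hb <;> linarith
          · rintro ⟨h3, h4⟩
            constructor
            · rcases ha with ha | ha <;> linarith
            · rcases hb with hb | hb <;> linarith
        simp [this, ha, hb]
  have hcard : ∀ s, (∑ y ∈ S, if |x y - s| ≤ ρ / 2 then (1 : ℝ) else 0) ≤
      (E.filter (fun y => |x y - s| ≤ ρ / 2)).card := by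
    intro s
    rw [Finset.sum_boole]
    exact_mod_cast Finset.card_le_card (Finset.filter_subset_filter _ hS)
  calc _ = |∑ y ∈ S, ((if t < x y ∧ x y ≤ t + lam then (1 : ℝ) else 0) -
      (if t < x' y ∧ x' y ≤ t + lam then 1 else 0))| := by
        rw [Finset.sum_sub_distrib, winCount, winCount]
    _ ≤ ∑ y ∈ S, ((if |x y - t| ≤ ρ / 2 then (1 : ℝ) else 0) +
        (if |x y - (t + lam)| ≤ ρ / 2 then 1 else 0)) :=
      (Finset.abs_sum_le_sum_abs _ _).trans (Finset.sum_le_sum key)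
    _ ≤ 2 * e := by
      rw [Finset.sum_add_distrib]
      have := hcard t
      have := hcard (t + lam)
      linarith

/-- A fixed group and finitely many rigidly drifting clusters, counted together. -/
lemma winCount_union_drift {N Γ C : Finset R2} (hd : Disjoint N Γ) {φ : R2 → R2}
    (hφ : ∀ y ∈ Γ, φ y ∈ C) (x p : R2 → ℝ) (v lam t : ℝ) [DecidableEq R2] :
    winCount N x lam t + ((C.toList.map fun c =>
      (p c, fun t => winCount (Γ.filter fun y => φ y = c) x lam t)).map
        fun q : ℝ × (ℝ → ℝ) => q.2 (t - v * q.1)).sum =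
    winCount (N ∪ Γ) (fun y => if y ∈ Γ then x y + v * p (φ y) else x y) lam t := by
  rw [List.map_map]
  have h1 : (C.toList.map ((fun q : ℝ × (ℝ → ℝ) => q.2 (t - v * q.1)) ∘ fun c =>
      (p c, fun t => winCount (Γ.filter fun y => φ y = c) x lam t))).sum =
      ∑ c ∈ C, winCount (Γ.filter fun y => φ y = c) x lam (t - v * p c) := by
    rw [← Finset.sum_map_toList]
    rfl
  have h2 : ∑ c ∈ C, winCount (Γ.filter fun y => φ y = c) x lam (t - v * p c) =
      winCount Γ (fun y => if y ∈ Γ then x y + v * p (φ y) else x y) lam t := by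
    rw [winCount, ← Finset.sum_fiberwise_of_maps_to hφ]
    refine Finset.sum_congr rfl fun c _ => Finset.sum_congr rfl fun y hy => ?_
    rw [Finset.mem_filter] at hy
    rw [if_pos hy.1, hy.2]
    have : (t - v * p c < x y ∧ x y ≤ t - v * p c + lam) ↔
        (t < x y + v * p c ∧ x y + v * p c ≤ t + lam) := by
      constructor <;> rintro ⟨_, _⟩ <;> constructor <;> linarith
    simp only [this]
  rw [h1, h2, winCount, winCount, winCount, Finset.sum_union hd]
  congr 1
  refine Finset.sum_congr rfl fun y hy => ?_
  rw [if_neg (Finset.disjoint_left.1 hd hy)]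

/-- The part of `E` within distance `R` of the origin. -/
def nearPart (E : Finset R2) (R : ℝ) : Finset R2 := E.filter (fun y => ‖y‖ ≤ R)

/-- The projection count of `nearPart E R` in each direction `j` of the `i`-fold thickness core of
`G` is annihilated by a short product of differences. -/
def Annihilated (n m γ g : ℕ) (a lam W e : ℝ) (E : Finset R2) (G : Finset ℕ) (i : ℕ) : Prop :=
  ∀ j ∈ (thick (1 / 2 ^ g) n)^[i] G, ∀ R, a ≤ R →
    (∀ y ∈ E, |prj n j y| ≤ (2 + i / m) * a → R < ‖y‖ → W * R < ‖y‖) →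
    (∃ S ⊆ E, S.card + i = m ∧ (∀ x ∈ S, ‖x‖ ≤ R ∧ |prj n j x| ≤ (5 - i / m) * a) ∧
      ∀ x ∈ S, ∀ y ∈ S, x ≠ y → 2 * a < ‖x - y‖) →
    ∃ u : List ℝ, u.length ≤ 2 ^ ((m + 1) * i) ∧
      (∀ x ∈ u, lam ≤ x ∧ x ≤ 4 * lam * (2 * W) ^ m * 2 ^ γ) ∧
      ∀ t, -a ≤ t → t ≤ a - i * 2 ^ ((m + 1) * m) * (4 * lam * (2 * W) ^ m * 2 ^ γ) →
        |iterDiff u (winCount (nearPart E R) (prj n j) lam) t| ≤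
          2 ^ (i * (2 * 2 ^ ((m + 1) * m) + 3)) * e

namespace ScaleData

variable {n m γ g : ℕ} {A a lam ρ W D e : ℝ} {E : Finset R2} {G : Finset ℕ}

lemma annihilated_zero (H : ScaleData n m γ g A a lam ρ W D e E G) :
    Annihilated n m γ g a lam W e E G 0 := by
  rintro j hj R hR - ⟨S, hSE, hScard, hS, hsep⟩
  simp only [Function.iterate_zero, id_eq] at hj
  have := H.card_lt_of_separated hj hSE hsep (fun x hx => by simpa using (hS x hx).2)
  omega

lemma lam_le_ub (H : ScaleData n m γ g A a lam ρ W D e E G) :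
    lam ≤ 4 * lam * (2 * W) ^ m * 2 ^ γ := by
  have hW := H.hW
  have hlam := H.hlam
  have hWm : (1 : ℝ) ≤ (2 * W) ^ m := one_le_pow₀ (by linarith)
  have hγ1 : (1 : ℝ) ≤ 2 ^ γ := one_le_pow₀ (by norm_num)
  calc lam = 1 * lam * 1 * 1 := by ring
    _ ≤ 4 * lam * (2 * W) ^ m * 2 ^ γ := by gcongr; norm_num

lemma drift_numerics (H : ScaleData n m γ g A a lam ρ W D e E G) {R r R' : ℝ} (hR : a ≤ R)
    (hrW : W * R < r) (hrR' : r ≤ R') (hR' : R' ≤ r * (2 * W) ^ m) :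
    ∃ ν : ℝ, 0 < ν ∧ ν ≤ 1 ∧ ν * r = 4 * lam * 2 ^ γ ∧
      ν * R' ≤ 4 * lam * (2 * W) ^ m * 2 ^ γ ∧ 2 * ν * (W * R') ≤ a / m ∧ 2 * ν * R ≤ ρ / 2 ∧
      3 * a * ν ≤ ρ / 2 ∧ ν * R' ≤ a := by
  have ha := H.a_pos
  have hlam := H.hlam
  have hW := H.hW
  have hm1 : (1 : ℝ) ≤ m := by exact_mod_cast H.hm
  have hm0 : (0 : ℝ) < m := by linarith
  have hWm : (1 : ℝ) ≤ (2 * W) ^ m := one_le_pow₀ (by linarith)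
  have hγ1 : (1 : ℝ) ≤ 2 ^ γ := one_le_pow₀ (by norm_num)
  have hWR : W * a ≤ W * R := by gcongr
  have hr0 : 0 < r := by nlinarith
  have hlub := H.lam_le_ub
  obtain ⟨ν, hν⟩ : ∃ ν, ν = 4 * lam * 2 ^ γ / r := ⟨_, rfl⟩
  have hν0 : 0 < ν := by rw [hν]; positivity
  have hνr : ν * r = 4 * lam * 2 ^ γ := by rw [hν]; field_simp
  have hνR' : ν * R' ≤ 4 * lam * (2 * W) ^ m * 2 ^ γ := by
    calc ν * R' ≤ ν * (r * (2 * W) ^ m) := by gcongr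
      _ = (ν * r) * (2 * W) ^ m := by ring
      _ = 4 * lam * (2 * W) ^ m * 2 ^ γ := by rw [hνr]; ring
  have hνWR' : 2 * ν * (W * R') ≤ a / m := by
    rw [le_div_iff₀ hm0]
    have h5 : ν * R' * (W * (2 * m)) ≤ 4 * lam * (2 * W) ^ m * 2 ^ γ * (W * (2 * m)) := by gcongr
    have h6 := H.h2
    rw [pow_succ] at h6
    have h7 : 0 ≤ lam * (2 * W) ^ m * 2 ^ γ * W * m := by positivity
    linarith
  have hνR : 2 * ν * R ≤ ρ / 2 := by
    have h6 := H.h1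
    have h7 : ν * (W * R) ≤ 4 * lam * 2 ^ γ := by rw [← hνr]; gcongr
    have h8 : W * (2 * ν * R) ≤ W * (ρ / 2) := by
      have : 0 ≤ lam * 2 ^ γ := by positivity
      linarith
    exact le_of_mul_le_mul_left h8 (by linarith)
  have hνa : 3 * a * ν ≤ ρ / 2 := by
    have h6 := H.h1
    have h7 : ν * (W * a) ≤ 4 * lam * 2 ^ γ := by
      rw [← hνr]; gcongr; linarith
    have h8 : W * (3 * a * ν) ≤ W * (ρ / 2) := by
      have : 0 ≤ lam * 2 ^ γ := by positivity
      linarith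
    exact le_of_mul_le_mul_left h8 (by linarith)
  have ham : a / m ≤ a := div_le_self ha.le hm1
  have hR'0 : 0 < R' := by linarith
  have hp := mul_pos hν0 hR'0
  have hνR'a : ν * R' ≤ a := by nlinarith
  have hν1 : ν ≤ 1 := by
    have h9 : 12 * a ≤ R' := by nlinarith
    have h10 : ν * (12 * a) ≤ ν * R' := by gcongr
    have h11 : ν * a ≤ 1 * a := by nlinarith
    exact le_of_mul_le_mul_right h11 ha
  exact ⟨ν, hν0, hν1, hνr, hνR', hνWR', hνR, hνa, hνR'a⟩

lemma exists_drift_range (H : ScaleData n m γ g A a lam ρ W D e E G) {r ν : ℝ} (hν0 : 0 < ν)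
    (hν1 : ν ≤ 1) (hr0 : 0 < r) (hνr : ν * r = 4 * lam * 2 ^ γ) (hrD : r ≤ D) :
    ∃ h : ℕ, 2 ^ γ ≤ h ∧ h ≤ n ∧ 2 * Real.pi / n * h ≤ ν ∧ ν ≤ 2 * (2 * Real.pi / n * h) := by
  have hn := H.hn
  have hlam := H.hlam
  have hn0 : (0 : ℝ) < n := by linarith
  have hpi4 := Real.pi_le_four
  have hpi3 := Real.pi_gt_three
  obtain ⟨β, hβ⟩ : ∃ β, β = 2 * Real.pi / n := ⟨_, rfl⟩
  have hβ0 : 0 < β := by rw [hβ]; positivity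
  have hβn : β * n = 2 * Real.pi := by rw [hβ]; field_simp
  rw [← hβ]
  have hγh : 2 ^ γ ≤ ⌊ν / β⌋₊ := by
    refine Nat.le_floor ?_
    rw [le_div_iff₀ hβ0]
    push_cast
    have h1 : (2 : ℝ) ^ γ * β * (r * n) ≤ ν * (r * n) := by
      have h2 : β * n * r ≤ 4 * lam * n := by rw [hβn]; nlinarith
      have h3 : (2 : ℝ) ^ γ * (β * n * r) ≤ 2 ^ γ * (4 * lam * n) := by gcongr
      have h4 : ν * r * n = 4 * lam * 2 ^ γ * n := by rw [hνr]
      linarith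
    exact le_of_mul_le_mul_right h1 (by positivity)
  have hh1 : 1 ≤ ⌊ν / β⌋₊ := Nat.one_le_two_pow.trans hγh
  have hβh : β * ⌊ν / β⌋₊ ≤ ν := by
    have := Nat.floor_le (div_nonneg hν0.le hβ0.le)
    rw [le_div_iff₀ hβ0] at this
    linarith
  refine ⟨⌊ν / β⌋₊, hγh, ?_, hβh, ?_⟩
  · have h5 : β * ⌊ν / β⌋₊ ≤ β * n := by rw [hβn]; linarith
    exact_mod_cast le_of_mul_le_mul_left h5 hβ0
  · have h5 := Nat.lt_floor_add_one (ν / β)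
    rw [div_lt_iff₀ hβ0] at h5
    have : (1 : ℝ) ≤ ⌊ν / β⌋₊ := by exact_mod_cast hh1
    nlinarith

/-- After rotating by a small angle, the projection counts of `nearPart E R'` are those of
`nearPart E R` together with the drifting clusters. -/
lemma abs_winCount_rotate_sub_le (H : ScaleData n m γ g A a lam ρ W D e E G) {j v : ℕ}
    (hjv : j + v ∈ G) {R r R' τ ν t : ℝ} (hRr : R < r) (hrR' : r ≤ R') (hτ0 : 2 * a + a / m ≤ τ)
    (hν0 : 0 ≤ ν) (hν1 : ν ≤ 1) (hv : 2 * Real.pi / n * v ≤ ν) (hνR' : 2 * ν * R' ≤ a / m)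
    (hνR : 2 * ν * R ≤ ρ / 2)
    (hνa : 3 * a * ν ≤ ρ / 2) (hνR'a : ν * R' ≤ a)
    (hnear : ∀ y ∈ E, |prj n j y| ≤ τ → ‖y‖ < r → ‖y‖ ≤ R)
    {Γ C : Finset R2} {φ : R2 → R2}
    (hΓ : ∀ y, y ∈ Γ ↔ y ∈ E ∧ |prj n j y| ≤ τ ∧ r ≤ ‖y‖ ∧ ‖y‖ ≤ R')
    (hφ : ∀ y ∈ Γ, φ y ∈ C ∧ ‖y - φ y‖ ≤ 2 * a) (ht0 : -a ≤ t) (ht1 : t + lam ≤ 2 * a) :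
    |winCount (nearPart E R') (prj n (j + v)) lam t - (winCount (nearPart E R) (prj n j) lam t +
          ((C.toList.map fun c => (2 * Real.pi / n * prp n j c,
            fun t => winCount (Γ.filter fun y => φ y = c) (prj n j) lam t)).map
              fun q : ℝ × (ℝ → ℝ) => q.2 (t - v * q.1)).sum)| ≤ 2 * e := by
  classical
  have ha := H.a_pos
  have hlam := H.hlam
  have hal := H.a_ge
  have hd : Disjoint (nearPart E R) Γ := by
    rw [Finset.disjoint_left]
    intro y hy hyΓ
    have h1 := (Finset.mem_filter.1 hy).2
    have h2 := ((hΓ y).1 hyΓ).2.2.1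
    linarith
  rw [winCount_union_drift hd (fun y hy => (hφ y hy).1) (prj n j) (fun c => 2 * Real.pi / n * prp n j c)]
  have hsub : nearPart E R ∪ Γ ⊆ nearPart E R' := by
    intro y hy
    rcases Finset.mem_union.1 hy with hy | hy
    · obtain ⟨h1, h2⟩ := Finset.mem_filter.1 hy
      exact Finset.mem_filter.2 ⟨h1, by linarith⟩
    · obtain ⟨h1, h2, h3, h4⟩ := (hΓ y).1 hy
      exact Finset.mem_filter.2 ⟨h1, h4⟩
  rw [← winCount_of_subset hsub]
  · refine abs_winCount_sub_le (E := E) (ρ := ρ) (hsub.trans (Finset.filter_subset _ _)) ?_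
      (H.thin _ hjv _ ?_) (H.thin _ hjv _ ?_)
    · intro y hy
      have hdr := abs_prj_add_sub_le (j := j) hv hν1 y
      by_cases hyΓ : y ∈ Γ
      · rw [if_pos hyΓ]
        obtain ⟨h1, h2, h3, h4⟩ := (hΓ y).1 hyΓ
        have h5 := abs_prp_sub_le n j y (φ y)
        have h6 := (hφ y hyΓ).2
        have h7 : |v * (2 * Real.pi / n * prp n j y) - v * (2 * Real.pi / n * prp n j (φ y))| ≤
            ν * (2 * a) := by
          have : v * (2 * Real.pi / n * prp n j y) - v * (2 * Real.pi / n * prp n j (φ y)) =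
            (2 * Real.pi / n * v) * (prp n j y - prp n j (φ y)) := by ring
          rw [this, abs_mul, abs_of_nonneg (by have := Real.pi_pos; positivity)]
          gcongr
          exact h5.trans h6
        have h8 : ν ^ 2 * ‖y‖ ≤ ν * a := by
          rw [pow_two, mul_assoc]
          gcongr
          exact le_trans (by gcongr) hνR'a
        have h9 := hdr.2
        rw [abs_le] at h7 h9 ⊢
        constructor <;> linarith
      · rw [if_neg hyΓ]
        have hyR : ‖y‖ ≤ R := by
          rcases Finset.mem_union.1 hy with hy | hy
          · exact (Finset.mem_filter.1 hy).2
          · exact absurd hy hyΓ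
        refine hdr.1.trans (le_trans ?_ hνR)
        gcongr
    · rw [abs_le]; constructor <;> linarith
    · rw [abs_le]; constructor <;> linarith
  · intro y hy hyn h1 h2
    obtain ⟨hyE, hyR'⟩ := Finset.mem_filter.1 hy
    have hdr := (abs_prj_add_sub_le (j := j) hv hν1 y).1
    have h3 : 2 * ν * ‖y‖ ≤ a / m := le_trans (by gcongr) hνR'
    have h4 : |prj n j y| ≤ τ := by
      rw [abs_le] at *
      constructor <;> linarith
    apply hyn
    rw [Finset.mem_union]
    rcases lt_or_ge ‖y‖ r with h | h
    · exact Or.inl (Finset.mem_filter.2 ⟨hyE, hnear y hyE h4 h⟩)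
    · exact Or.inr ((hΓ y).2 ⟨hyE, h4, h, hyR'⟩)

end ScaleData

namespace ScaleData

variable {n m γ g : ℕ} {A a lam ρ W D e : ℝ} {E : Finset R2} {G : Finset ℕ}

lemma domain_bound (H : ScaleData n m γ g A a lam ρ W D e E G) (i : ℕ) :
    a - (i + 1 : ℕ) * 2 ^ ((m + 1) * m) * (4 * lam * (2 * W) ^ m * 2 ^ γ) ≤
      a - 2 ^ ((m + 1) * m) * (4 * lam * (2 * W) ^ m * 2 ^ γ) := by
  have h5 : 0 ≤ (2 : ℝ) ^ ((m + 1) * m) * (4 * lam * (2 * W) ^ m * 2 ^ γ) := by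
    have := H.lam_le_ub
    have := H.hlam
    have : 0 ≤ 4 * lam * (2 * W) ^ m * 2 ^ γ := by linarith
    positivity
  have : (1 : ℝ) ≤ (i + 1 : ℕ) := by exact_mod_cast Nat.le_add_left 1 i
  nlinarith

lemma two_mul_shift_le (H : ScaleData n m γ g A a lam ρ W D e E G) :
    2 * (2 ^ ((m + 1) * m) * (4 * lam * (2 * W) ^ m * 2 ^ γ)) ≤ a := by
  have := H.h3
  have h1 := H.lam_le_ub
  have h2 := H.hlam
  have hm1 : (1 : ℝ) ≤ m := by exact_mod_cast H.hm
  have h4 : 0 ≤ 4 * lam * (2 * W) ^ m * 2 ^ γ := by linarith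
  have h5 : 0 ≤ (2 : ℝ) ^ ((m + 1) * m) * (4 * lam * (2 * W) ^ m * 2 ^ γ) := by positivity
  nlinarith

lemma le_tube_width (H : ScaleData n m γ g A a lam ρ W D e E G) (i : ℕ) :
    2 * a ≤ (2 + (i : ℝ) / m) * a := by
  have ha := H.a_pos
  have : 0 ≤ (i : ℝ) / m := by positivity
  nlinarith

lemma tube_width_le (H : ScaleData n m γ g A a lam ρ W D e E G) {i : ℕ} (hi : i ≤ m) :
    (2 + (i : ℝ) / m) * a ≤ 3 * a := by
  have ha := H.a_pos
  have hm0 : (0 : ℝ) < m := by exact_mod_cast H.hm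
  have : (i : ℝ) / m ≤ 1 := by rw [div_le_one hm0]; exact_mod_cast hi
  nlinarith

lemma annihilated_succ_of_no_far (H : ScaleData n m γ g A a lam ρ W D e E G) {i j : ℕ}
    (hj : j ∈ G) {R : ℝ}
    (hfar : ∀ y ∈ E, |prj n j y| ≤ (2 + (i + 1 : ℕ) / m) * a → ‖y‖ ≤ R) :
    ∃ u : List ℝ, u.length ≤ 2 ^ ((m + 1) * (i + 1)) ∧
      (∀ x ∈ u, lam ≤ x ∧ x ≤ 4 * lam * (2 * W) ^ m * 2 ^ γ) ∧
      ∀ t, -a ≤ t →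
        t ≤ a - (i + 1 : ℕ) * 2 ^ ((m + 1) * m) * (4 * lam * (2 * W) ^ m * 2 ^ γ) →
        |iterDiff u (winCount (nearPart E R) (prj n j) lam) t| ≤
          2 ^ ((i + 1) * (2 * 2 ^ ((m + 1) * m) + 3)) * e := by
  have hal := H.a_ge
  have hlam := H.hlam
  have hY := H.domain_bound i
  have hub := H.lam_le_ub
  have h5 : 0 ≤ (2 : ℝ) ^ ((m + 1) * m) * (4 * lam * (2 * W) ^ m * 2 ^ γ) := by
    have : 0 ≤ 4 * lam * (2 * W) ^ m * 2 ^ γ := by linarith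
    positivity
  have hw := H.le_tube_width (i + 1)
  refine ⟨[lam], by simpa using Nat.one_le_two_pow, by simpa using hub, fun t ht0 ht1 => ?_⟩
  have hcnt : ∀ s, -a ≤ s → s ≤ 2 * a - lam →
      winCount (nearPart E R) (prj n j) lam s = winCount E (prj n j) lam s := by
    intro s hs0 hs1
    refine winCount_of_subset (Finset.filter_subset _ _) _ _ _ fun y hy hyn h3 h4 => hyn ?_
    refine Finset.mem_filter.2 ⟨hy, hfar y hy ?_⟩
    rw [abs_le]
    constructor <;> linarith
  have h5 := H.flat j hj t (t + lam) (by rw [abs_le]; constructor <;> linarith)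
    (by rw [abs_le]; constructor <;> linarith)
  simp only [iterDiff]
  rw [hcnt t ht0 (by linarith), hcnt (t + lam) (by linarith) (by linarith)]
  exact h5.trans (le_mul_of_one_le_left H.he (one_le_pow₀ (by norm_num)))

/-- Annihilating the fixed group from annihilators of the drifting configurations. -/
lemma exists_annihilator_of_clusters (H : ScaleData n m γ g A a lam ρ W D e E G) {i : ℕ}
    (hi : i < m) {h : ℕ} (hh : 2 ^ γ ≤ h) {V : Finset ℕ} (hV : V ⊆ Finset.range h)
    (hVd : h ≤ 2 ^ g * V.card) (N : ℝ → ℝ) {L : List (ℝ × (ℝ → ℝ))} (hL : L.length < m)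
    (hLp : ∀ p ∈ L, lam * 2 ^ γ ≤ h * |p.1| ∧ h * |p.1| ≤ 4 * lam * (2 * W) ^ m * 2 ^ γ)
    (hstep : ∀ v ∈ V, ∃ u : List ℝ, u.length ≤ 2 ^ ((m + 1) * i) ∧
      (∀ x ∈ u, lam ≤ x ∧ x ≤ 4 * lam * (2 * W) ^ m * 2 ^ γ) ∧
      ∀ t, -a ≤ t → t ≤ a - i * 2 ^ ((m + 1) * m) * (4 * lam * (2 * W) ^ m * 2 ^ γ) →
        |iterDiff u (fun t => N t + (L.map fun q => q.2 (t - v * q.1)).sum) t| ≤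
          2 ^ (i * (2 * 2 ^ ((m + 1) * m) + 3)) * e + 2 ^ (2 ^ ((m + 1) * m)) * (2 * e)) :
    ∃ u : List ℝ, u.length ≤ 2 ^ ((m + 1) * (i + 1)) ∧
      (∀ x ∈ u, lam ≤ x ∧ x ≤ 4 * lam * (2 * W) ^ m * 2 ^ γ) ∧
      ∀ t, -a ≤ t →
        t ≤ a - (i + 1 : ℕ) * 2 ^ ((m + 1) * m) * (4 * lam * (2 * W) ^ m * 2 ^ γ) →
        |iterDiff u N t| ≤ 2 ^ ((i + 1) * (2 * 2 ^ ((m + 1) * m) + 3)) * e := by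
  have he := H.he
  have hlam := H.hlam
  have hub := H.lam_le_ub
  choose! u hu using hstep
  obtain ⟨l, hl1, hl2, hl3⟩ := exists_annihilator_of_drifting (x₀ := -a) (by linarith : 0 ≤ lam)
    (by linarith) hh L.length L g _ V u N _ _ rfl
    (le_trans (Nat.mul_le_mul_left _ (Nat.pow_le_pow_right (by norm_num) hL.le)) H.hγ) hV hVd
    (by positivity) hLp hu
  have hlen : L.length + 2 ^ L.length * 2 ^ ((m + 1) * i) ≤ 2 ^ ((m + 1) * (i + 1)) := by
    have h1 : L.length < 2 ^ m := hL.trans Nat.lt_two_pow_self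
    have h2 : 2 ^ L.length ≤ 2 ^ m := Nat.pow_le_pow_right (by norm_num) hL.le
    have h3 : 1 ≤ 2 ^ ((m + 1) * i) := Nat.one_le_two_pow
    have h4 : 2 ^ ((m + 1) * (i + 1)) = 2 * (2 ^ m * 2 ^ ((m + 1) * i)) := by ring
    have h5 := Nat.mul_le_mul_right (2 ^ ((m + 1) * i)) h2
    have h6 := Nat.mul_le_mul_left (2 ^ m) h3
    omega
  have hQ : 2 ^ ((m + 1) * (i + 1)) ≤ 2 ^ ((m + 1) * m) :=
    Nat.pow_le_pow_right (by norm_num) (Nat.mul_le_mul_left _ hi)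
  refine ⟨l, hl1.trans hlen, hl2, fun t ht0 ht1 => ?_⟩
  have h1 := hl3 t ht0 (by
    have h2 : ((L.length : ℝ) + 2 ^ L.length * (2 ^ ((m + 1) * i) : ℕ) - (2 ^ ((m + 1) * i) : ℕ))
        ≤ 2 ^ ((m + 1) * m) := by
      have : ((L.length + 2 ^ L.length * 2 ^ ((m + 1) * i) : ℕ) : ℝ) ≤ (2 ^ ((m + 1) * m) : ℕ) := by
        exact_mod_cast hlen.trans hQ
      push_cast at this ⊢
      have h3 : (0 : ℝ) ≤ 2 ^ ((m + 1) * i) := by positivity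
      linarith
    have h3 := mul_le_mul_of_nonneg_right h2
      (by linarith : 0 ≤ 4 * lam * (2 * W) ^ m * 2 ^ γ)
    push_cast at ht1 h3 ⊢
    linarith)
  have h4 : (1 : ℝ) ≤ 2 ^ (2 ^ ((m + 1) * i)) := one_le_pow₀ (by norm_num)
  have h5 : |iterDiff l N t| ≤ 2 ^ (2 ^ ((m + 1) * i)) * |iterDiff l N t| :=
    le_mul_of_one_le_left (abs_nonneg _) h4
  refine (h5.trans h1).trans ?_
  set Q := 2 ^ ((m + 1) * m)
  have h6 : (2 : ℝ) ^ (L.length + 2 ^ L.length * 2 ^ ((m + 1) * i)) ≤ 2 ^ Q :=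
    pow_le_pow_right₀ (by norm_num) (hlen.trans hQ)
  have h7 : (2 : ℝ) ^ (i * (2 * Q + 3)) * e + 2 ^ Q * (2 * e) ≤
      2 ^ (i * (2 * Q + 3) + Q + 3) * e := by
    rw [pow_add, pow_add]
    have a1 : (1 : ℝ) ≤ 2 ^ (i * (2 * Q + 3)) := one_le_pow₀ (by norm_num)
    have a2 : (1 : ℝ) ≤ 2 ^ Q := one_le_pow₀ (by norm_num)
    have a3 : (2 : ℝ) ^ (i * (2 * Q + 3)) * 1 ≤ 2 ^ (i * (2 * Q + 3)) * 2 ^ Q := by gcongr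
    have a4 : (1 : ℝ) * 2 ^ Q ≤ 2 ^ (i * (2 * Q + 3)) * 2 ^ Q := by gcongr
    nlinarith
  calc _ ≤ (2 : ℝ) ^ Q * (2 ^ (i * (2 * Q + 3) + Q + 3) * e) := by gcongr
    _ = 2 ^ ((i + 1) * (2 * Q + 3)) * e := by
      rw [← mul_assoc, ← pow_add]
      congr 2
      ring

lemma abs_iterDiff_drift_le (H : ScaleData n m γ g A a lam ρ W D e E G) {i : ℕ} (hi : i ≤ m)
    {f g₁ : ℝ → ℝ} {u : List ℝ} (hlen : u.length ≤ 2 ^ ((m + 1) * i))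
    (hu : ∀ x ∈ u, lam ≤ x ∧ x ≤ 4 * lam * (2 * W) ^ m * 2 ^ γ)
    (hf : ∀ t, -a ≤ t → t ≤ a - i * 2 ^ ((m + 1) * m) * (4 * lam * (2 * W) ^ m * 2 ^ γ) →
      |iterDiff u f t| ≤ 2 ^ (i * (2 * 2 ^ ((m + 1) * m) + 3)) * e)
    (hfg : ∀ t, -a ≤ t → t + lam ≤ 2 * a → |f t - g₁ t| ≤ 2 * e) :
    ∀ t, -a ≤ t → t ≤ a - i * 2 ^ ((m + 1) * m) * (4 * lam * (2 * W) ^ m * 2 ^ γ) →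
        |iterDiff u g₁ t| ≤
          2 ^ (i * (2 * 2 ^ ((m + 1) * m) + 3)) * e + 2 ^ (2 ^ ((m + 1) * m)) * (2 * e) := by
  intro t ht0 ht1
  have hlam := H.hlam
  have hal := H.a_ge
  have he := H.he
  have hub := H.lam_le_ub
  have h2 := H.two_mul_shift_le
  have hQ : u.length ≤ 2 ^ ((m + 1) * m) :=
    hlen.trans (Nat.pow_le_pow_right (by norm_num) (Nat.mul_le_mul_left _ hi))
  have hQ' : (u.length : ℝ) ≤ 2 ^ ((m + 1) * m) := by exact_mod_cast hQ
  have hub0 : 0 ≤ 4 * lam * (2 * W) ^ m * 2 ^ γ := by linarith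
  have h3 : (u.length : ℝ) * (4 * lam * (2 * W) ^ m * 2 ^ γ) ≤ a / 2 := by
    have := mul_le_mul_of_nonneg_right hQ' hub0
    linarith
  have h4 : 0 ≤ (i : ℝ) * 2 ^ ((m + 1) * m) * (4 * lam * (2 * W) ^ m * 2 ^ γ) := by positivity
  have h1 := abs_iterDiff_le (ub := 4 * lam * (2 * W) ^ m * 2 ^ γ) u (fun t => f t - g₁ t)
    (2 * a - lam) (fun x hx => ⟨by linarith [(hu x hx).1], (hu x hx).2⟩)
    (fun s hs0 hs1 => hfg s hs0 (by linarith)) t ht0 (by linarith)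
  rw [iterDiff_sub] at h1
  have h5 : (2 : ℝ) ^ u.length * (2 * e) ≤ 2 ^ (2 ^ ((m + 1) * m)) * (2 * e) := by
    gcongr
    norm_num
  have h6 := hf t ht0 ht1
  rw [abs_le] at *
  constructor <;> linarith

lemma abs_prp_ge (H : ScaleData n m γ g A a lam ρ W D e E G) {j : ℕ} {r : ℝ} {c : R2}
    (hc : r ≤ ‖c‖) (hr : 12 * a ≤ r) (hj : |prj n j c| ≤ 3 * a) : r / 2 ≤ |prp n j c| := by
  have ha := H.a_pos
  have h1 := proj_sq_add_projPerp_sq ((j : ℝ) / n) c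
  change prj n j c ^ 2 + prp n j c ^ 2 = ‖c‖ ^ 2 at h1
  have h2 : prj n j c ^ 2 ≤ (3 * a) ^ 2 := sq_le_sq' (abs_le.1 hj).1 (abs_le.1 hj).2
  have hr0 : 0 ≤ r := by linarith
  have h3 : r ^ 2 ≤ ‖c‖ ^ 2 := by gcongr
  have h4 : (r / 2) ^ 2 ≤ prp n j c ^ 2 := by nlinarith
  have := sq_le_sq.1 h4
  rwa [abs_of_nonneg (by linarith : 0 ≤ r / 2)] at this

/-- Adding a new point to a separated family inside a tube, after a small rotation. -/
lemma exists_insert_separated (H : ScaleData n m γ g A a lam ρ W D e E G) {i j j' : ℕ}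
    (hi : i < m) {R R' r : ℝ} (hRr : R + 2 * a < r) (hR'r : r ≤ R') {S : Finset R2} (hSE : S ⊆ E)
    (hScard : S.card + (i + 1) = m)
    (hS : ∀ x ∈ S, ‖x‖ ≤ R ∧ |prj n j x| ≤ (5 - (i + 1 : ℕ) / m) * a)
    (hsep : ∀ x ∈ S, ∀ y ∈ S, x ≠ y → 2 * a < ‖x - y‖)
    {y₁ : R2} (hy₁E : y₁ ∈ E) (hr : r = ‖y₁‖)
    (hy₁t : |prj n j y₁| ≤ (2 + (i + 1 : ℕ) / m) * a)
    (hrot : ∀ y : R2, ‖y‖ ≤ R' → |prj n j' y - prj n j y| ≤ a / m) :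
    ∃ S ⊆ E, S.card + i = m ∧ (∀ x ∈ S, ‖x‖ ≤ R' ∧ |prj n j' x| ≤ (5 - (i : ℝ) / m) * a) ∧
      ∀ x ∈ S, ∀ y ∈ S, x ≠ y → 2 * a < ‖x - y‖ := by
  classical
  have ha := H.a_pos
  have hm0 : (0 : ℝ) < m := by exact_mod_cast H.hm
  have hm1 : (1 : ℝ) ≤ m := by exact_mod_cast H.hm
  have ham : a / m ≤ a := div_le_self ha.le hm1
  have hsucc : ((i + 1 : ℕ) : ℝ) / m * a = i / m * a + a / m := by push_cast; ring
  have hyS : y₁ ∉ S := fun h => by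
    have := (hS _ h).1
    linarith
  have him : (i : ℝ) / m * a ≤ a - a / m := by
    have h1 : ((i + 1 : ℕ) : ℝ) / m ≤ 1 := by rw [div_le_one hm0]; exact_mod_cast hi
    have := mul_le_mul_of_nonneg_right h1 ha.le
    linarith
  have hfar : ∀ x ∈ S, 2 * a < ‖y₁ - x‖ := by
    intro x hx
    have h1 := (hS x hx).1
    have h2 := norm_sub_norm_le y₁ x
    linarith
  refine ⟨insert y₁ S, Finset.insert_subset hy₁E hSE, ?_, ?_, ?_⟩
  · rw [Finset.card_insert_of_notMem hyS]; omega
  · intro x hx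
    rcases Finset.mem_insert.1 hx with rfl | hx
    · refine ⟨by linarith, ?_⟩
      have h1 := hrot x (by linarith)
      rw [abs_le] at *
      constructor <;> linarith
    · obtain ⟨h2, h3⟩ := hS x hx
      have h4 : ‖x‖ ≤ R' := by linarith
      refine ⟨h4, ?_⟩
      have h1 := hrot x h4
      rw [abs_le] at *
      constructor <;> linarith
  · intro x hx y hy hxy
    rcases Finset.mem_insert.1 hx with hx | hx <;> rcases Finset.mem_insert.1 hy with hy | hy
    · exact absurd (hx.trans hy.symm) hxy
    · rw [hx]; exact hfar y hy
    · rw [norm_sub_rev, hy]; exact hfar x hx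
    · exact hsep x hx y hy hxy

/-- A radius after a gap is much larger. -/
lemma gap_le (H : ScaleData n m γ g A a lam ρ W D e E G) {R r : ℝ} (hR : a ≤ R)
    (hrW : W * R < r) : 12 * a ≤ r ∧ R + 2 * a < r := by
  have ha := H.a_pos
  have hW := H.hW
  have : 12 * R ≤ W * R := by gcongr; linarith
  constructor <;> linarith

lemma annihilated_succ (H : ScaleData n m γ g A a lam ρ W D e E G) {i : ℕ} (hi : i < m)
    (ih : Annihilated n m γ g a lam W e E G i) :
    Annihilated n m γ g a lam W e E G (i + 1) := by
  classical
  rintro j hj R hR hgap ⟨S, hSE, hScard, hS, hsep⟩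
  rw [Function.iterate_succ_apply', mem_thick] at hj
  obtain ⟨hji, hdense⟩ := hj
  have hjG := iterate_thick_subset _ _ _ _ hji
  by_cases hfar : ∃ y ∈ E, |prj n j y| ≤ (2 + (i + 1 : ℕ) / m) * a ∧ R < ‖y‖
  swap
  · push Not at hfar
    exact H.annihilated_succ_of_no_far hjG hfar
  obtain ⟨y₁, hy₁, hmin⟩ := (E.filter fun y => |prj n j y| ≤ (2 + (i + 1 : ℕ) / m) * a ∧
    R < ‖y‖).exists_min_image (fun y => ‖y‖) (by
      obtain ⟨y, hy⟩ := hfar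
      exact ⟨y, by simpa using hy⟩)
  obtain ⟨hy₁E, hy₁t, hy₁R⟩ := Finset.mem_filter.1 hy₁
  obtain ⟨r, hr⟩ : ∃ r, r = ‖y₁‖ := ⟨_, rfl⟩
  rw [← hr] at hy₁R
  have hrW : W * R < r := hr ▸ hgap y₁ hy₁E hy₁t (hr ▸ hy₁R)
  have hrD : r ≤ D := hr ▸ H.hD y₁ hy₁E
  have ha := H.a_pos
  have hW := H.hW
  obtain ⟨hra, hRr⟩ := H.gap_le hR hrW
  have hr0 : 0 < r := by linarith
  have hw3 := H.tube_width_le (i := i + 1) hi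
  obtain ⟨l, hl, hann⟩ := H.exists_empty_annulus hjG (r := r)
    (τ := (2 + (i + 1 : ℕ) / m) * a) (by linarith) (by linarith)
  obtain ⟨R', hR'⟩ : ∃ R', R' = r * (2 * W) ^ l := ⟨_, rfl⟩
  rw [← hR'] at hann
  have hR'r : r ≤ R' := hR' ▸ le_mul_of_one_le_right hr0.le (one_le_pow₀ (by linarith))
  have hR'u : R' ≤ r * (2 * W) ^ m := by
    rw [hR']; gcongr
    linarith
  obtain ⟨ν, hν0, hν1, hνr, hνR', hνWR', hνR, hνa, hνR'a⟩ :=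
    H.drift_numerics hR hrW hR'r hR'u
  obtain ⟨h, hγh, hhn, hβh, hβh'⟩ := H.exists_drift_range hν0 hν1 hr0 hνr hrD
  have hh1 : 1 ≤ h := Nat.one_le_two_pow.trans hγh
  have hpi := Real.pi_pos
  have hβ0 : 0 ≤ 2 * Real.pi / n := by positivity
  obtain ⟨V, hV⟩ : ∃ V, V = (Finset.range h).filter
    (fun v => j + v ∈ (thick (1 / 2 ^ g) n)^[i] G) := ⟨_, rfl⟩
  have hVr : V ⊆ Finset.range h := hV ▸ Finset.filter_subset _ _
  have hVd : h ≤ 2 ^ g * V.card := by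
    have h5 := hdense h hh1 hhn
    have h6 : (((thick (1 / 2 ^ g) n)^[i] G).filter (fun x => j ≤ x ∧ x < j + h)).card
        ≤ V.card := by
      refine Finset.card_le_card_of_injOn (fun x => x - j) ?_ ?_
      · intro x hx
        simp only [Finset.coe_filter, mem_ofPred_eq] at hx
        simp only [hV, Finset.coe_filter, Finset.mem_range, mem_ofPred_eq]
        refine ⟨by omega, ?_⟩
        rw [Nat.add_sub_cancel' hx.2.1]
        exact hx.1
      · intro x hx y hy hxy
        simp only [Finset.coe_filter, mem_ofPred_eq] at hx hy
        simp only at hxy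
        omega
    have h7 : (1 : ℝ) / 2 ^ g * h ≤ V.card := h5.trans (by exact_mod_cast h6)
    rw [div_mul_eq_mul_div, one_mul, div_le_iff₀ (by positivity)] at h7
    have : (h : ℝ) ≤ 2 ^ g * V.card := by linarith
    exact_mod_cast this
  have hVβ : ∀ v ∈ V, 2 * Real.pi / n * v ≤ ν := by
    intro v hv
    have : v < h := Finset.mem_range.1 (hVr hv)
    have : (v : ℝ) ≤ h := by exact_mod_cast this.le
    exact le_trans (by gcongr) hβh
  obtain ⟨Γ, hΓ⟩ : ∃ Γ, Γ = E.filter (fun y => |prj n j y| ≤ (2 + (i + 1 : ℕ) / m) * a ∧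
    r ≤ ‖y‖ ∧ ‖y‖ ≤ R') := ⟨_, rfl⟩
  have hΓm : ∀ y, y ∈ Γ ↔ y ∈ E ∧ |prj n j y| ≤ (2 + (i + 1 : ℕ) / m) * a ∧
    r ≤ ‖y‖ ∧ ‖y‖ ≤ R' := by intro y; rw [hΓ, Finset.mem_filter]
  obtain ⟨C, φ, hCΓ, hCsep, hφ⟩ := exists_net Γ (r := 2 * a) (by linarith)
  have hCm : C.card < m := H.card_lt_of_separated hjG (fun x hx => ((hΓm x).1 (hCΓ hx)).1) hCsep
    (fun x hx => by
      have := ((hΓm x).1 (hCΓ hx)).2.1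
      linarith)
  have hm0 : (0 : ℝ) < m := by exact_mod_cast H.hm
  have hm1 : (1 : ℝ) ≤ m := by exact_mod_cast H.hm
  have ham : a / m ≤ a := div_le_self ha.le hm1
  have hsucc : ((i + 1 : ℕ) : ℝ) / m * a = i / m * a + a / m := by push_cast; ring
  have hwi := H.le_tube_width i
  have hR'0 : 0 < R' := by linarith
  have hR'W : R' ≤ W * R' := le_mul_of_one_le_left hR'0.le (by linarith)
  refine H.exists_annihilator_of_clusters hi hγh hVr hVd _ (L := C.toList.map fun c =>
    (2 * Real.pi / n * prp n j c, fun t => winCount (Γ.filter fun y => φ y = c) (prj n j) lam t))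
    (by simpa using hCm) ?_ ?_
  · intro p hp
    obtain ⟨c, hc, rfl⟩ := List.mem_map.1 hp
    rw [Finset.mem_toList] at hc
    obtain ⟨hcE, hct, hcr, hcR⟩ := (hΓm c).1 (hCΓ hc)
    simp only [abs_mul, abs_of_nonneg hβ0]
    have h1 : r / 2 ≤ |prp n j c| := H.abs_prp_ge hcr hra (hct.trans hw3)
    have h2 : |prp n j c| ≤ R' := (abs_projPerp_le _ _).trans hcR
    constructor
    · have h3 : ν / 2 * (r / 2) ≤ (2 * Real.pi / n * h) * |prp n j c| := by
        gcongr; linarith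
      linarith
    · have h3 : (2 * Real.pi / n * h) * |prp n j c| ≤ ν * R' := by gcongr
      linarith
  · intro v hv
    have hjv : j + v ∈ (thick (1 / 2 ^ g) n)^[i] G := by
      rw [hV] at hv; exact (Finset.mem_filter.1 hv).2
    have hjvG := iterate_thick_subset _ _ _ _ hjv
    have hrot : ∀ y : R2, ‖y‖ ≤ W * R' → |prj n (j + v) y - prj n j y| ≤ a / m := by
      intro y hy
      refine ((abs_prj_add_sub_le (j := j) (hVβ v hv) hν1 y).1).trans (le_trans ?_ hνWR')
      gcongr
    obtain ⟨u, hu1, hu2, hu3⟩ := ih (j + v) hjv R' (by linarith) (by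
        intro y hy hyt hyR'
        by_contra hcon
        rw [not_lt] at hcon
        have h1 := hrot y hcon
        refine absurd (hann y hy ?_ hyR') (not_lt.2 hcon)
        rw [abs_le] at *
        constructor <;> linarith) (by
        exact H.exists_insert_separated hi hRr hR'r hSE hScard hS hsep hy₁E hr hy₁t
          fun y hy => hrot y (hy.trans hR'W))
    refine ⟨u, hu1, hu2, H.abs_iterDiff_drift_le hi.le hu1 hu2 hu3 fun t ht0 ht1 => ?_⟩
    refine H.abs_winCount_rotate_sub_le hjvG (τ := (2 + (i + 1 : ℕ) / m) * a) (r := r)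
      (by linarith) hR'r (by linarith) hν0.le hν1 (hVβ v hv) (le_trans (by gcongr) hνWR')
      hνR hνa hνR'a ?_ hΓm hφ ht0 ht1
    intro y hy hyt hyr
    by_contra hcon
    rw [not_le] at hcon
    have := hmin y (Finset.mem_filter.2 ⟨hy, hyt, hcon⟩)
    rw [← hr] at this
    linarith

lemma annihilated (H : ScaleData n m γ g A a lam ρ W D e E G) {i : ℕ} (hi : i ≤ m) :
    Annihilated n m γ g a lam W e E G i := by
  induction i with
  | zero => exact H.annihilated_zero
  | succ i ih => exact H.annihilated_succ hi (ih (by omega))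

/-- A direction in which the origin is an end point of `E` is not in the thickness core of the set
of flat directions. -/
lemma notMem_thick_of_tip (H : ScaleData n m γ g A a lam ρ W D e E G) {j : ℕ} {σ s : ℝ}
    (hσ : 4 * σ ≤ lam)
    (hs : W * (a * (2 * W) ^ m) ≤ s) (htip : ∀ y ∈ E, ‖y‖ ≤ s → prj n j y ≤ σ)
    (hmass : 2 ^ (m * (2 * 2 ^ ((m + 1) * m) + 3)) * e <
      (E.filter (fun y => ‖y‖ ≤ lam / 2)).card) :
    j ∉ (thick (1 / 2 ^ g) n)^[m] G := by
  intro hj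
  have ha := H.a_pos
  have hal := H.a_ge
  have hlam := H.hlam
  have hW := H.hW
  have hjG := iterate_thick_subset _ _ _ _ hj
  have hm0 : (m : ℝ) ≠ 0 := by exact_mod_cast (by have := H.hm; omega)
  obtain ⟨l, hl, hann⟩ := H.exists_empty_annulus hjG (r := a) (τ := 3 * a) le_rfl (by linarith)
  have hWm : (1 : ℝ) ≤ (2 * W) ^ l := one_le_pow₀ (by linarith)
  have hRa : a ≤ a * (2 * W) ^ l := le_mul_of_one_le_right ha.le hWm
  have hRs : a * (2 * W) ^ l ≤ s := by
    have h1 : a * (2 * W) ^ l ≤ a * (2 * W) ^ m := by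
      gcongr
      linarith
    nlinarith
  obtain ⟨u, hu1, hu2, hu3⟩ := H.annihilated le_rfl j hj _ hRa (by
    intro y hy hyt
    rw [div_self hm0] at hyt
    exact hann y hy (by linarith)) ⟨∅, by simp, by simp, by simp, by simp⟩
  have hsh := H.two_mul_shift_le
  have h3 := H.h3
  have hσ0 : -a ≤ σ - lam := by
    by_contra hcon
    have hcard : (E.filter (fun y => ‖y‖ ≤ lam / 2)) = ∅ := by
      rw [Finset.filter_eq_empty_iff]
      intro y hy hy2
      have h4 := htip y hy (by linarith)
      have := abs_prj_le n j y
      rw [abs_le] at this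
      linarith
    rw [hcard] at hmass
    have := H.he
    have : 0 ≤ 2 ^ (m * (2 * 2 ^ ((m + 1) * m) + 3)) * e := by positivity
    simp at hmass
    linarith
  have h4 := hu3 (σ - lam) hσ0 (by linarith)
  rw [iterDiff_eq_self (lam := lam) (by linarith) u _ _ (fun x hx => (hu2 x hx).1)] at h4
  · refine absurd ((le_abs_self _).trans h4) (not_le.2 (hmass.trans_le ?_))
    rw [winCount_eq_card]
    norm_cast
    refine Finset.card_le_card fun y hy => ?_
    obtain ⟨hyE, hy⟩ := Finset.mem_filter.1 hy
    have h5 := abs_prj_le n j y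
    have h6 := htip y hyE (by linarith)
    rw [abs_le] at h5
    exact Finset.mem_filter.2 ⟨Finset.mem_filter.2 ⟨hyE, by linarith⟩, by linarith, by linarith⟩
  · intro t ht
    rw [winCount_eq_card]
    norm_cast
    rw [Finset.card_eq_zero, Finset.filter_eq_empty_iff]
    rintro y hy ⟨h5, -⟩
    obtain ⟨hyE, hyR⟩ := Finset.mem_filter.1 hy
    have := htip y hyE (hyR.trans hRs)
    linarith

end ScaleData

lemma exists_disjoint_Ico_cover (h : ℕ → ℕ) (S : Finset ℕ) (hh : ∀ j ∈ S, 1 ≤ h j) :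
    ∃ S' ⊆ S, (S' : Set ℕ).PairwiseDisjoint (fun j => Finset.Ico j (j + h j)) ∧
      S ⊆ S'.biUnion (fun j => Finset.Ico j (j + h j)) := by
  classical
  induction S using Finset.strongInduction with
  | H S ih =>
    rcases S.eq_empty_or_nonempty with rfl | hne
    · exact ⟨∅, by simp⟩
    obtain ⟨j₀, hj₀, hmin⟩ := S.exists_min_image id hne
    have hsub : S.filter (fun j => j₀ + h j₀ ≤ j) ⊂ S := by
      refine Finset.filter_ssubset.2 ⟨j₀, hj₀, ?_⟩
      have := hh j₀ hj₀
      omega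
    obtain ⟨S', hS'S, hdisj, hcov⟩ := ih _ hsub fun j hj => hh j (Finset.mem_filter.1 hj).1
    refine ⟨insert j₀ S', ?_, ?_, ?_⟩
    · exact Finset.insert_subset hj₀ (hS'S.trans (Finset.filter_subset _ _))
    · rw [Finset.coe_insert]
      refine hdisj.insert fun j hj hne => ?_
      have h1 := (Finset.mem_filter.1 (hS'S hj)).2
      rw [Finset.disjoint_left]
      intro x hx hx'
      rw [Finset.mem_Ico] at hx hx'
      omega
    · intro j hj
      rw [Finset.biUnion_insert, Finset.mem_union, Finset.mem_Ico]
      by_cases hlt : j < j₀ + h j₀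
      · exact Or.inl ⟨hmin j hj, hlt⟩
      · exact Or.inr (hcov (Finset.mem_filter.2 ⟨hj, not_lt.1 hlt⟩))

/-- Points of `S` with a forward interval containing many points of `B` are few. -/
lemma card_le_of_forward_density {S B : Finset ℕ} {c : ℝ} (hc : 0 < c)
    (hS : ∀ j ∈ S, ∃ h : ℕ, 1 ≤ h ∧ c * h ≤ (B.filter (fun x => j ≤ x ∧ x < j + h)).card) :
    c * S.card ≤ B.card := by
  classical
  choose! h hh using hS
  obtain ⟨S', hS'S, hdisj, hcov⟩ := exists_disjoint_Ico_cover h S fun j hj => (hh j hj).1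
  have h1 : S.card ≤ ∑ j ∈ S', h j := by
    refine (Finset.card_le_card hcov).trans (Finset.card_biUnion_le.trans (le_of_eq ?_))
    simp
  have h2 : ∑ j ∈ S', (B.filter (fun x => j ≤ x ∧ x < j + h j)).card ≤ B.card := by
    rw [← Finset.card_biUnion]
    · exact Finset.card_le_card (Finset.biUnion_subset.2 fun j _ => Finset.filter_subset _ _)
    · intro x hx y hy hxy
      refine Finset.disjoint_left.2 fun z hz hz' => ?_
      rw [Finset.mem_filter] at hz hz'
      exact Finset.disjoint_left.1 (hdisj hx hy hxy) (Finset.mem_Ico.2 hz.2) (Finset.mem_Ico.2 hz'.2)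
  calc c * S.card ≤ c * (∑ j ∈ S', h j : ℕ) := by gcongr
    _ = ∑ j ∈ S', c * h j := by push_cast; rw [Finset.mul_sum]
    _ ≤ ∑ j ∈ S', ((B.filter (fun x => j ≤ x ∧ x < j + h j)).card : ℝ) :=
        Finset.sum_le_sum fun j hj => (hh j (hS'S hj)).2
    _ ≤ B.card := by exact_mod_cast h2

lemma card_le_card_thick_add {n : ℕ} {c : ℝ} (hc : 0 ≤ c) {P : Finset ℕ}
    (hP : P ⊆ Finset.range n) : (P.card : ℝ) ≤ (thick c n P).card + 2 * c * n := by
  classical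
  have hbad : ∀ j ∈ P \ thick c n P, ∃ h : ℕ, 1 ≤ h ∧ h ≤ n ∧
      ((P.filter (fun x => j ≤ x ∧ x < j + h)).card : ℝ) < c * h := by
    intro j hj
    rw [Finset.mem_sdiff, mem_thick] at hj
    have := hj.2
    simp only [hj.1, true_and, DenseAt] at this
    push Not at this
    exact this
  choose! h hh using hbad
  obtain ⟨S', hS'S, hdisj, hcov⟩ := exists_disjoint_Ico_cover h _ fun j hj => (hh j hj).1
  have h1 : (P \ thick c n P).card ≤
      ∑ j ∈ S', (P.filter (fun x => j ≤ x ∧ x < j + h j)).card := by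
    refine (Finset.card_le_card fun x hx => ?_).trans Finset.card_biUnion_le
    obtain ⟨j, hj, hx'⟩ := Finset.mem_biUnion.1 (hcov hx)
    exact Finset.mem_biUnion.2
      ⟨j, hj, Finset.mem_filter.2 ⟨(Finset.mem_sdiff.1 hx).1, Finset.mem_Ico.1 hx'⟩⟩
  have h2 : ∑ j ∈ S', h j ≤ 2 * n := by
    have : ∑ j ∈ S', h j = (S'.biUnion (fun j => Finset.Ico j (j + h j))).card := by
      rw [Finset.card_biUnion hdisj]; simp
    rw [this]
    refine (Finset.card_le_card (t := Finset.range (2 * n)) fun x hx => ?_).trans (by simp)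
    obtain ⟨j, hj, hx'⟩ := Finset.mem_biUnion.1 hx
    have h3 := hP (Finset.mem_sdiff.1 (hS'S hj)).1
    have h4 := (hh j (hS'S hj)).2.1
    rw [Finset.mem_Ico] at hx'
    rw [Finset.mem_range] at h3 ⊢
    omega
  have h3 : ((P \ thick c n P).card : ℝ) ≤ 2 * c * n := by
    calc ((P \ thick c n P).card : ℝ) ≤
        (∑ j ∈ S', (P.filter (fun x => j ≤ x ∧ x < j + h j)).card : ℕ) := by exact_mod_cast h1
      _ ≤ ∑ j ∈ S', c * h j := by
        push_cast
        exact Finset.sum_le_sum fun j hj => (hh j (hS'S hj)).2.2.le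
      _ = c * (∑ j ∈ S', h j : ℕ) := by push_cast; rw [Finset.mul_sum]
      _ ≤ c * (2 * n : ℕ) := by gcongr
      _ = 2 * c * n := by push_cast; ring
  have h4 : P.card = (P \ thick c n P).card + (thick c n P).card :=
    (Finset.card_sdiff_add_card_eq_card (thick_subset _ _ _)).symm
  rw [h4]; push_cast; linarith

lemma card_le_card_iterate_thick_add {n : ℕ} {c : ℝ} (hc : 0 ≤ c) {P : Finset ℕ}
    (hP : P ⊆ Finset.range n) (i : ℕ) :
    (P.card : ℝ) ≤ ((thick c n)^[i] P).card + i * (2 * c * n) := by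
  induction i with
  | zero => simp
  | succ i ih =>
    rw [Function.iterate_succ_apply']
    have := card_le_card_thick_add (n := n) hc ((iterate_thick_subset c n P i).trans hP)
    push_cast
    linarith

lemma thick_mono {n : ℕ} {c : ℝ} {P Q : Finset ℕ} (h : P ⊆ Q) : thick c n P ⊆ thick c n Q := by
  intro j hj
  rw [mem_thick] at hj ⊢
  refine ⟨h hj.1, fun l h1 h2 => (hj.2 l h1 h2).trans ?_⟩
  exact_mod_cast Finset.card_le_card (Finset.filter_subset_filter _ h)

lemma iterate_thick_mono {n : ℕ} {c : ℝ} {P Q : Finset ℕ} (h : P ⊆ Q) (i : ℕ) :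
    (thick c n)^[i] P ⊆ (thick c n)^[i] Q := by
  induction i with
  | zero => exact h
  | succ i ih => rw [Function.iterate_succ_apply', Function.iterate_succ_apply']; exact thick_mono ih

/-- Passing to thickness cores of `G ⊆ P` loses only a bounded factor, if the thresholds differ. -/
lemma card_iterate_thick_sdiff_le {n : ℕ} {c : ℝ} (hc : 0 < c) (P G : Finset ℕ) (i : ℕ) :
    (((thick (2 * c) n)^[i] P \ (thick c n)^[i] G).card : ℝ) ≤
      (1 + 1 / c) ^ i * (P \ G).card := by
  classical
  induction i with
  | zero => simp
  | succ i ih =>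
    rw [Function.iterate_succ_apply', Function.iterate_succ_apply']
    set P' := (thick (2 * c) n)^[i] P
    set G' := (thick c n)^[i] G
    have h1 : c * ((thick (2 * c) n P' \ thick c n G') \ (P' \ G')).card ≤ (P' \ G').card := by
      refine card_le_of_forward_density hc fun j hj => ?_
      simp only [Finset.mem_sdiff, mem_thick, not_and, not_not] at hj
      obtain ⟨⟨⟨hjP, hd⟩, hnG⟩, hjG⟩ := hj
      have := hnG (hjG hjP)
      simp only [DenseAt] at this
      push Not at this
      obtain ⟨h, h1, h2, h3⟩ := this
      refine ⟨h, h1, ?_⟩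
      have h4 := hd h h1 h2
      have h5 : (P'.filter (fun x => j ≤ x ∧ x < j + h)).card ≤
          ((P' \ G').filter (fun x => j ≤ x ∧ x < j + h)).card +
          (G'.filter (fun x => j ≤ x ∧ x < j + h)).card := by
        refine (Finset.card_le_card fun x hx => ?_).trans (Finset.card_union_le _ _)
        simp only [Finset.mem_union, Finset.mem_filter, Finset.mem_sdiff] at hx ⊢
        tauto
      have h6 : ((P'.filter (fun x => j ≤ x ∧ x < j + h)).card : ℝ) ≤
          ((P' \ G').filter (fun x => j ≤ x ∧ x < j + h)).card +
          (G'.filter (fun x => j ≤ x ∧ x < j + h)).card := by exact_mod_cast h5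
      linarith
    have h2 : (thick (2 * c) n P' \ thick c n G').card ≤
        ((thick (2 * c) n P' \ thick c n G') \ (P' \ G')).card + (P' \ G').card := by
      rw [← Nat.sub_le_iff_le_add]
      exact Finset.le_card_sdiff _ _
    have h2' : ((thick (2 * c) n P' \ thick c n G').card : ℝ) ≤
        ((thick (2 * c) n P' \ thick c n G') \ (P' \ G')).card + (P' \ G').card := by
      exact_mod_cast h2
    have h3 : (((thick (2 * c) n P' \ thick c n G') \ (P' \ G')).card : ℝ) ≤
        1 / c * (P' \ G').card := by
      rw [div_mul_eq_mul_div, one_mul, le_div_iff₀ hc]; linarith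
    calc _ ≤ (1 + 1 / c) * ((P' \ G').card : ℝ) := by linarith
      _ ≤ (1 + 1 / c) * ((1 + 1 / c) ^ i * (P \ G).card) := by gcongr
      _ = _ := by ring

/-- The concavity deficit of `x ↦ x / (1 + x)`. -/
def deficit (a b : ℝ) : ℝ := (a - b) ^ 2 / (2 * (1 + a) * (1 + b) * (2 + a + b))

lemma deficit_nonneg {a b : ℝ} (ha : 0 ≤ a) (hb : 0 ≤ b) : 0 ≤ deficit a b := by
  unfold deficit; positivity

lemma deficit_eq {a b : ℝ} (ha : 0 ≤ a) (hb : 0 ≤ b) : deficit a b =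
    (a + b) / 2 / (1 + (a + b) / 2) - (a / (1 + a) + b / (1 + b)) / 2 := by
  unfold deficit
  have h1 : (1 + a) ≠ 0 := by positivity
  have h2 : (1 + b) ≠ 0 := by positivity
  have h3 : (2 + a + b) ≠ 0 := by positivity
  have h4 : (1 + (a + b) / 2) ≠ 0 := by positivity
  have h5 : 1 + (a + b) / 2 = (2 + a + b) / 2 := by ring
  rw [h5]
  field_simp
  ring

/-- The average of the push-forward of the counting measure of `E` over `[i, i + 2 ^ k)`. -/
def cellAvg (E : Finset R2) (x : R2 → ℝ) (k : ℕ) (i : ℤ) : ℝ :=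
  (E.filter (fun y => (i : ℝ) ≤ x y ∧ x y < i + 2 ^ k)).card / 2 ^ k

lemma cellAvg_nonneg (E : Finset R2) (x : R2 → ℝ) (k : ℕ) (i : ℤ) : 0 ≤ cellAvg E x k i := by
  unfold cellAvg; positivity

lemma cellAvg_succ (E : Finset R2) (x : R2 → ℝ) (k : ℕ) (i : ℤ) :
    cellAvg E x (k + 1) i = (cellAvg E x k i + cellAvg E x k (i + 2 ^ k)) / 2 := by
  classical
  have h : (E.filter (fun y => (i : ℝ) ≤ x y ∧ x y < i + 2 ^ (k + 1))).card =
      (E.filter (fun y => (i : ℝ) ≤ x y ∧ x y < i + 2 ^ k)).card +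
      (E.filter (fun y => ((i + 2 ^ k : ℤ) : ℝ) ≤ x y ∧ x y < (i + 2 ^ k : ℤ) + 2 ^ k)).card := by
    have hp : (0 : ℝ) < 2 ^ k := by positivity
    rw [← Finset.card_union_of_disjoint]
    · congr 1
      ext y
      simp only [Finset.mem_filter, Finset.mem_union]
      push_cast
      rw [pow_succ]
      constructor
      · rintro ⟨h1, h2, h3⟩
        by_cases h4 : x y < i + 2 ^ k
        · exact Or.inl ⟨h1, h2, h4⟩
        · exact Or.inr ⟨h1, not_lt.1 h4, by linarith⟩
      · rintro (⟨h1, h2, h3⟩ | ⟨h1, h2, h3⟩)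
        · exact ⟨h1, h2, by linarith⟩
        · exact ⟨h1, by linarith, by linarith⟩
    · refine Finset.disjoint_left.2 fun y hy hy' => ?_
      have h1 := (Finset.mem_filter.1 hy).2.2
      have h2 := (Finset.mem_filter.1 hy').2.1
      push_cast at h2
      linarith
  unfold cellAvg
  rw [h, pow_succ]
  push_cast
  field_simp

lemma hasSum_cellAvg (E : Finset R2) (x : R2 → ℝ) (k : ℕ) :
    HasSum (cellAvg E x k) (E.card : ℝ) := by
  induction k with
  | zero =>
    have h1 : cellAvg E x 0 = fun i => ∑ y ∈ E, if i = ⌊x y⌋ then (1 : ℝ) else 0 := by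
      funext i
      rw [cellAvg, pow_zero, div_one, Finset.sum_boole]
      congr 2
      ext y
      simp only [Finset.mem_filter]
      rw [eq_comm, Int.floor_eq_iff]
    rw [h1, Finset.card_eq_sum_ones]
    push_cast
    exact hasSum_sum fun y _ => hasSum_ite_eq _ _
  | succ k ih =>
    have h1 := (Equiv.addRight ((2 : ℤ) ^ k)).hasSum_iff.2 ih
    have h2 := (ih.add h1).div_const 2
    rw [add_self_div_two] at h2
    exact h2.congr_fun fun i => cellAvg_succ E x k i

/-- The deficit of two neighbouring dyadic cells. -/
def cellDeficit (E : Finset R2) (x : R2 → ℝ) (k : ℕ) (i : ℤ) : ℝ :=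
  deficit (cellAvg E x k i) (cellAvg E x k (i + 2 ^ k))

lemma cellDeficit_nonneg (E : Finset R2) (x : R2 → ℝ) (k : ℕ) (i : ℤ) : 0 ≤ cellDeficit E x k i :=
  deficit_nonneg (cellAvg_nonneg _ _ _ _) (cellAvg_nonneg _ _ _ _)

lemma summable_cellAvg_div (E : Finset R2) (x : R2 → ℝ) (k : ℕ) :
    Summable fun i => cellAvg E x k i / (1 + cellAvg E x k i) := by
  refine (hasSum_cellAvg E x k).summable.of_nonneg_of_le (fun i => ?_) fun i => ?_
  · have := cellAvg_nonneg E x k i; positivity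
  · have := cellAvg_nonneg E x k i
    exact div_le_self this (by linarith)

lemma hasSum_cellDeficit (E : Finset R2) (x : R2 → ℝ) (k : ℕ) :
    HasSum (cellDeficit E x k) ((∑' i, cellAvg E x (k + 1) i / (1 + cellAvg E x (k + 1) i)) -
      ∑' i, cellAvg E x k i / (1 + cellAvg E x k i)) := by
  have h0 := (summable_cellAvg_div E x k).hasSum
  have h1 := (Equiv.addRight ((2 : ℤ) ^ k)).hasSum_iff.2 h0
  have h2 := (h0.add h1).div_const 2
  rw [add_self_div_two] at h2
  refine ((summable_cellAvg_div E x (k + 1)).hasSum.sub h2).congr_fun fun i => ?_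
  rw [cellAvg_succ, cellDeficit, deficit_eq (cellAvg_nonneg _ _ _ _) (cellAvg_nonneg _ _ _ _)]
  rfl

lemma sum_tsum_cellDeficit_le (E : Finset R2) (x : R2 → ℝ) (K : ℕ) :
    ∑ k ∈ Finset.range K, ∑' i, cellDeficit E x k i ≤ E.card := by
  simp_rw [fun k => (hasSum_cellDeficit E x k).tsum_eq]
  rw [Finset.sum_range_sub fun k => ∑' i, cellAvg E x k i / (1 + cellAvg E x k i)]
  have h1 : ∑' i, cellAvg E x K i / (1 + cellAvg E x K i) ≤ E.card := by
    rw [← (hasSum_cellAvg E x K).tsum_eq]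
    refine (summable_cellAvg_div E x K).tsum_le_tsum (fun i => ?_) (hasSum_cellAvg E x K).summable
    have := cellAvg_nonneg E x K i
    exact div_le_self this (by linarith)
  have h2 : 0 ≤ ∑' i, cellAvg E x 0 i / (1 + cellAvg E x 0 i) :=
    tsum_nonneg fun i => by have := cellAvg_nonneg E x 0 i; positivity
  linarith

/-- Points with few neighbours in projection at scale `2 ^ k` are few in a window. -/
lemma card_alive_window_le (E : Finset R2) (x : R2 → ℝ) (k R : ℕ) {M : ℝ} (hM : 0 ≤ M) (i : ℤ) :
    ((E.filter fun z => ((E.filter fun y => |x y - x z| ≤ 2 ^ k).card : ℝ) ≤ M * 2 ^ k ∧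
      i - R * 2 ^ k ≤ ⌊x z⌋ ∧ ⌊x z⌋ ≤ i + R * 2 ^ k).card : ℝ) ≤
      (2 * R + 1) * (M * 2 ^ k) := by
  classical
  set S := E.filter fun z => ((E.filter fun y => |x y - x z| ≤ 2 ^ k).card : ℝ) ≤ M * 2 ^ k ∧
      i - R * 2 ^ k ≤ ⌊x z⌋ ∧ ⌊x z⌋ ≤ i + R * 2 ^ k with hS
  have hpk : (0 : ℤ) < 2 ^ k := by positivity
  have hM : 0 ≤ M * 2 ^ k := by positivity
  set f : R2 → ℤ := fun z => (⌊x z⌋ - (i - R * 2 ^ k)) / 2 ^ k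
  have hf : ∀ z ∈ S, f z ∈ Finset.Icc (0 : ℤ) (2 * R) := by
    intro z hz
    obtain ⟨-, -, h1, h2⟩ := Finset.mem_filter.1 hz
    rw [Finset.mem_Icc]
    constructor
    · exact Int.ediv_nonneg (by linarith) hpk.le
    · refine Int.ediv_le_of_le_mul hpk (by linarith)
  rw [Finset.card_eq_sum_card_fiberwise hf]
  push_cast
  have hc : ((Finset.Icc (0 : ℤ) (2 * R)).card : ℝ) = 2 * R + 1 := by
    rw [Int.card_Icc]
    have : (2 * (R : ℤ) + 1 - 0).toNat = 2 * R + 1 := by omega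
    rw [this]; push_cast; ring
  rw [← hc, ← nsmul_eq_mul]
  refine Finset.sum_le_card_nsmul _ _ _ fun b _ => ?_
  rcases (S.filter fun z => f z = b).eq_empty_or_nonempty with h | ⟨z, hz⟩
  · rw [h]; simpa using hM
  obtain ⟨hzS, hzb⟩ := Finset.mem_filter.1 hz
  refine le_trans ?_ (Finset.mem_filter.1 hzS).2.1
  norm_cast
  refine Finset.card_le_card fun y hy => ?_
  obtain ⟨hyS, hyb⟩ := Finset.mem_filter.1 hy
  refine Finset.mem_filter.2 ⟨(Finset.mem_filter.1 hyS).1, ?_⟩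
  have h1 := Int.mul_ediv_add_emod (⌊x z⌋ - (i - R * 2 ^ k)) (2 ^ k)
  have h2 := Int.mul_ediv_add_emod (⌊x y⌋ - (i - R * 2 ^ k)) (2 ^ k)
  have h3 := Int.emod_nonneg (⌊x z⌋ - (i - R * 2 ^ k)) hpk.ne'
  have h4 := Int.emod_nonneg (⌊x y⌋ - (i - R * 2 ^ k)) hpk.ne'
  have h5 := Int.emod_lt_of_pos (⌊x z⌋ - (i - R * 2 ^ k)) hpk
  have h6 := Int.emod_lt_of_pos (⌊x y⌋ - (i - R * 2 ^ k)) hpk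
  change _ * f z + _ = _ at h1
  change _ * f y + _ = _ at h2
  rw [hzb] at h1
  rw [hyb] at h2
  have h7 : ⌊x y⌋ + 1 ≤ ⌊x z⌋ + 2 ^ k := by linarith
  have h8 : ⌊x z⌋ + 1 ≤ ⌊x y⌋ + 2 ^ k := by linarith
  have h7' : (⌊x y⌋ : ℝ) + 1 ≤ ⌊x z⌋ + 2 ^ k := by exact_mod_cast h7
  have h8' : (⌊x z⌋ : ℝ) + 1 ≤ ⌊x y⌋ + 2 ^ k := by exact_mod_cast h8
  have := Int.floor_le (x y)
  have := Int.floor_le (x z)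
  have := Int.lt_floor_add_one (x y)
  have := Int.lt_floor_add_one (x z)
  rw [abs_le]
  push_cast
  constructor <;> linarith

/-- Total non-flatness is controlled by the number of points. -/
lemma sum_card_nonflat_le (E : Finset R2) (x : R2 → ℝ) (K R : ℕ) {M e : ℝ} (hM : 0 ≤ M)
    (he : 0 < e) :
    ∑ k ∈ Finset.range K, ((E.filter fun z =>
      ((E.filter fun y => |x y - x z| ≤ 2 ^ k).card : ℝ) ≤ M * 2 ^ k ∧
      e * 2 ^ k < ∑ i ∈ Finset.Icc (⌊x z⌋ - R * 2 ^ k) (⌊x z⌋ + R * 2 ^ k),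
        cellDeficit E x k i).card : ℝ) ≤ (2 * R + 1) * M / e * E.card := by
  classical
  refine le_trans ?_ (mul_le_mul_of_nonneg_left (sum_tsum_cellDeficit_le E x K) (by positivity))
  rw [Finset.mul_sum]
  refine Finset.sum_le_sum fun k _ => ?_
  set U := E.filter fun z =>
      ((E.filter fun y => |x y - x z| ≤ 2 ^ k).card : ℝ) ≤ M * 2 ^ k ∧
      e * 2 ^ k < ∑ i ∈ Finset.Icc (⌊x z⌋ - R * 2 ^ k) (⌊x z⌋ + R * 2 ^ k), cellDeficit E x k i
    with hU
  set J : R2 → Finset ℤ := fun z => Finset.Icc (⌊x z⌋ - R * 2 ^ k) (⌊x z⌋ + R * 2 ^ k) with hJ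
  have h1 : (U.card : ℝ) * (e * 2 ^ k) ≤ ∑ z ∈ U, ∑ i ∈ J z, cellDeficit E x k i := by
    rw [← nsmul_eq_mul]
    exact Finset.card_nsmul_le_sum _ _ _ fun z hz => (Finset.mem_filter.1 hz).2.2.le
  have h2 : ∑ z ∈ U, ∑ i ∈ J z, cellDeficit E x k i =
      ∑ i ∈ U.biUnion J, (U.filter fun z => i ∈ J z).card * cellDeficit E x k i := by
    simp_rw [← nsmul_eq_mul, ← Finset.sum_const]
    refine Finset.sum_comm' fun z i => ?_
    simp only [Finset.mem_filter, Finset.mem_biUnion]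
    tauto
  have h3 : ∀ i, ((U.filter fun z => i ∈ J z).card : ℝ) ≤ (2 * R + 1) * (M * 2 ^ k) := by
    intro i
    refine le_trans ?_ (card_alive_window_le E x k R hM i)
    refine Nat.cast_le.2 (Finset.card_le_card fun z hz => ?_)
    obtain ⟨hz, hi⟩ := Finset.mem_filter.1 hz
    obtain ⟨hz, hz2, -⟩ := Finset.mem_filter.1 hz
    rw [hJ, Finset.mem_Icc] at hi
    exact Finset.mem_filter.2 ⟨hz, hz2, by linarith [hi.2], by linarith [hi.1]⟩
  have h4 : ∑ i ∈ U.biUnion J, (U.filter fun z => i ∈ J z).card * cellDeficit E x k i ≤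
      (2 * R + 1) * (M * 2 ^ k) * ∑' i, cellDeficit E x k i := by
    calc _ ≤ ∑ i ∈ U.biUnion J, (2 * R + 1) * (M * 2 ^ k) * cellDeficit E x k i :=
          Finset.sum_le_sum fun i _ => mul_le_mul_of_nonneg_right (h3 i) (cellDeficit_nonneg _ _ _ _)
      _ = (2 * R + 1) * (M * 2 ^ k) * ∑ i ∈ U.biUnion J, cellDeficit E x k i := by
          rw [Finset.mul_sum]
      _ ≤ _ := by
          gcongr
          exact (hasSum_cellDeficit E x k).summable.sum_le_tsum _ fun i _ =>
            cellDeficit_nonneg _ _ _ _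
  have h5 : (0 : ℝ) < 2 ^ k := by positivity
  rw [div_mul_eq_mul_div, le_div_iff₀ he]
  have h6 : (U.card : ℝ) * e * 2 ^ k ≤ (2 * R + 1) * M * (∑' i, cellDeficit E x k i) * 2 ^ k := by
    linarith
  exact le_of_mul_le_mul_right h6 h5

/-- Pigeonholing an offset for which all deficits are small. -/
lemma exists_offset (d : ℤ → ℝ) (hd : ∀ i, 0 ≤ d i) (c : ℤ) (k B R : ℕ) (hBR : B + 1 ≤ R) {e : ℝ}
    (h : ∑ i ∈ Finset.Icc (c - R * 2 ^ k) (c + R * 2 ^ k), d i ≤ e * 2 ^ k) :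
    ∃ o : ℤ, c ≤ o ∧ o < c + 2 ^ k ∧ ∀ l : ℤ, |l| ≤ B → d (o + 2 ^ k * l) ≤ e := by
  classical
  by_contra! hcon
  have hpk : (0 : ℤ) < 2 ^ k := by positivity
  choose! l hl hl2 using hcon
  have h1 : ∑ o ∈ Finset.Ico c (c + 2 ^ k), d (o + 2 ^ k * l o) ≤
      ∑ i ∈ Finset.Icc (c - R * 2 ^ k) (c + R * 2 ^ k), d i := by
    rw [← Finset.sum_image (f := d) (s := Finset.Ico c (c + 2 ^ k))
      (g := fun o => o + 2 ^ k * l o)]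
    · refine Finset.sum_le_sum_of_subset_of_nonneg ?_ fun i _ _ => hd i
      intro i hi
      obtain ⟨o, ho, rfl⟩ := Finset.mem_image.1 hi
      rw [Finset.mem_Ico] at ho
      have h2 := abs_le.1 (hl o ho.1 ho.2)
      have h3 : (2 : ℤ) ^ k * l o ≤ 2 ^ k * B := by gcongr; exact h2.2
      have h4 : (2 : ℤ) ^ k * (-B) ≤ 2 ^ k * l o := by gcongr; exact h2.1
      have h5 : (2 : ℤ) ^ k * (B + 1) ≤ 2 ^ k * R := by gcongr; exact_mod_cast hBR
      rw [Finset.mem_Icc]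
      constructor <;> linarith
    · intro o ho o' ho' heq
      simp only [Finset.coe_Ico, mem_Ico] at ho ho' heq
      have h2 : (2 : ℤ) ^ k ∣ o - o' := ⟨l o' - l o, by linarith⟩
      have h3 := Int.eq_zero_of_abs_lt_dvd h2 (by rw [abs_lt]; constructor <;> linarith)
      linarith
  have h2 : ∑ o ∈ Finset.Ico c (c + 2 ^ k), e < ∑ o ∈ Finset.Ico c (c + 2 ^ k),
      d (o + 2 ^ k * l o) := by
    refine Finset.sum_lt_sum_of_nonempty ?_ fun o ho => ?_
    · rw [Finset.nonempty_Ico]; linarith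
    · rw [Finset.mem_Ico] at ho
      exact hl2 o ho.1 ho.2
  rw [Finset.sum_const, Int.card_Ico, nsmul_eq_mul] at h2
  have h3 : ((c + 2 ^ k - c).toNat : ℝ) = 2 ^ k := by
    have : c + 2 ^ k - c = ((2 ^ k : ℕ) : ℤ) := by push_cast; ring
    rw [this, Int.toNat_natCast]
    push_cast
    rfl
  rw [h3] at h2
  linarith

/-- Small deficit forces the values to be close. -/
lemma abs_sub_le_of_deficit_le {a b P e η : ℝ} (ha : 0 ≤ a) (hb : 0 ≤ b) (haP : 1 + a ≤ 2 * P)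
    (he : 96 * e * P ^ 3 ≤ η ^ 2) (he0 : 0 ≤ e) (he2 : 48 * e * P ≤ 1) (hη : 0 ≤ η)
    (h : deficit a b ≤ e ∨ deficit b a ≤ e) :
    |a - b| ≤ η := by
  have hd : deficit b a = deficit a b := by unfold deficit; congr 1 <;> ring
  rw [hd, or_self, deficit, div_le_iff₀ (by positivity)] at h
  obtain ⟨p, hp⟩ : ∃ p, p = 1 + a := ⟨_, rfl⟩
  obtain ⟨q, hq⟩ : ∃ q, q = 1 + b := ⟨_, rfl⟩
  have hab : a - b = p - q := by rw [hp, hq]; ring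
  have h2 : 2 + a + b = p + q := by rw [hp, hq]; ring
  rw [h2, ← hp, ← hq, hab] at h
  rw [← hp] at haP
  have hp1 : 1 ≤ p := by linarith
  have hq1 : 1 ≤ q := by linarith
  have hP0 : 0 < P := by linarith
  have hep : e * p ≤ 1 / 24 := by nlinarith
  have hqp : q ≤ 4 * P := by
    by_contra! hcon
    have h3 : q / 2 ≤ q - p := by linarith
    have h4 : (q / 2) ^ 2 ≤ (p - q) ^ 2 := by nlinarith
    have h5 : e * (2 * p * q * (p + q)) ≤ (1 / 24) * (2 * q * (q / 2 + q)) := by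
      have h6 : e * (2 * p * q * (p + q)) = (e * p) * (2 * q * (p + q)) := by ring
      rw [h6]
      have : p + q ≤ q / 2 + q := by linarith
      gcongr
    nlinarith
  have h3 : e * (2 * p * q * (p + q)) ≤ e * (2 * (2 * P) * (4 * P) * (2 * P + 4 * P)) := by gcongr
  rw [hab]
  refine abs_le_of_sq_le_sq ?_ hη
  nlinarith

lemma abs_sub_le_of_chain {v : ℤ → ℝ} (hv : ∀ l, 0 ≤ v l) {B : ℕ} {M e η : ℝ} (hM : 1 ≤ M)
    (h0 : v 0 ≤ 2 * M) (hη : 0 ≤ η) (hBη : B * η ≤ M) (he0 : 0 ≤ e)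
    (he : 96 * e * (3 * M) ^ 3 ≤ η ^ 2) (he2 : 48 * e * (3 * M) ≤ 1)
    (hd : ∀ l : ℤ, |l| ≤ B → deficit (v l) (v (l + 1)) ≤ e) (N : ℕ) (hN : N ≤ B) :
    |v N - v 0| ≤ N * η ∧ |v (-N) - v 0| ≤ N * η := by
  induction N with
  | zero => simp
  | succ N ih =>
    obtain ⟨h1, h2⟩ := ih (by omega)
    have hNη : N * η ≤ B * η := by gcongr; omega
    have h3 := hd N (by simp; omega)
    have h4 := hd (-(N + 1 : ℕ)) (by rw [abs_neg, Nat.abs_cast]; exact_mod_cast hN)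
    have h5 : (-(N + 1 : ℕ) : ℤ) + 1 = -N := by push_cast; ring
    rw [h5] at h4
    have h6 := abs_sub_le_of_deficit_le (P := 3 * M) (η := η) (hv N) (hv (N + 1))
      (by linarith [(abs_le.1 h1).2]) he he0 he2 hη (Or.inl h3)
    have h7 := abs_sub_le_of_deficit_le (P := 3 * M) (η := η) (hv (-N)) (hv (-(N + 1 : ℕ)))
      (by linarith [(abs_le.1 h2).2]) he he0 he2 hη (Or.inr h4)
    push_cast at h7 ⊢
    rw [abs_le] at h1 h2 h6 h7
    rw [abs_le, abs_le]
    constructor <;> constructor <;> linarith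

lemma card_filter_cell (E : Finset R2) (x : R2 → ℝ) (k : ℕ) (o : ℤ) (L : Finset ℤ) :
    ((E.filter fun y => ⌊(x y - o) / 2 ^ k⌋ ∈ L).card : ℝ) =
      ∑ l ∈ L, cellAvg E x k (o + 2 ^ k * l) * 2 ^ k := by
  classical
  have hp : (0 : ℝ) < 2 ^ k := by positivity
  rw [Finset.card_eq_sum_card_fiberwise (f := fun y => ⌊(x y - o) / 2 ^ k⌋) (t := L)
    (s := E.filter fun y => ⌊(x y - o) / 2 ^ k⌋ ∈ L)
    fun y hy => (Finset.mem_filter.1 hy).2]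
  push_cast
  refine Finset.sum_congr rfl fun l hl => ?_
  rw [cellAvg, div_mul_cancel₀ _ hp.ne']
  congr 2
  ext y
  simp only [Finset.mem_filter]
  rw [and_assoc]
  refine and_congr_right fun _ => ?_
  have h1 : ⌊(x y - o) / 2 ^ k⌋ = l ↔
      ((o + 2 ^ k * l : ℤ) : ℝ) ≤ x y ∧ x y < (o + 2 ^ k * l : ℤ) + 2 ^ k := by
    rw [Int.floor_eq_iff, le_div_iff₀ hp, div_lt_iff₀ hp]
    push_cast
    constructor <;> rintro ⟨h1, h2⟩ <;> constructor <;> linarith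
  rw [← h1]
  constructor
  · exact fun h => h.2
  · exact fun h => ⟨h ▸ hl, h⟩

/-- Near constancy of the cell averages bounds interval counts. -/
lemma window_count_bounds {E : Finset R2} {x : R2 → ℝ} {k τ q B : ℕ} {o : ℤ} {c β v₀ : ℝ}
    (ho : ⌊c⌋ ≤ o) (ho' : o < ⌊c⌋ + 2 ^ k) (hB : τ + q + 2 ≤ B)
    (hv : ∀ l : ℤ, |l| ≤ B → |cellAvg E x k (o + 2 ^ k * l) - v₀| ≤ β) {t : ℝ}
    (ht : |t| ≤ τ * 2 ^ k) (hq : 1 ≤ q) :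
    ((E.filter fun y => c + t ≤ x y ∧ x y ≤ c + t + q * 2 ^ k).card : ℝ) ≤
      (q + 1) * (v₀ + β) * 2 ^ k ∧
    (q - 1) * (v₀ - β) * 2 ^ k ≤
      ((E.filter fun y => c + t < x y ∧ x y ≤ c + t + q * 2 ^ k).card : ℝ) := by
  classical
  have hp : (0 : ℝ) < 2 ^ k := by positivity
  have hp1 : (1 : ℝ) ≤ 2 ^ k := one_le_pow₀ (by norm_num)
  obtain ⟨s, hs⟩ : ∃ s : ℝ, s = (c + t - o) / 2 ^ k := ⟨_, rfl⟩
  have hs' : c + t = o + s * 2 ^ k := by rw [hs]; field_simp; ring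
  obtain ⟨f, hf⟩ : ∃ f, f = ⌊s⌋ := ⟨_, rfl⟩
  have hf1 : (f : ℝ) ≤ s := hf ▸ Int.floor_le s
  have hf2 : s < f + 1 := hf ▸ Int.lt_floor_add_one s
  have hc1 := Int.floor_le c
  have hc2 := Int.lt_floor_add_one c
  have ho1 : (⌊c⌋ : ℝ) ≤ o := by exact_mod_cast ho
  have ho2 : (o : ℝ) + 1 ≤ ⌊c⌋ + 2 ^ k := by
    have : o + 1 ≤ ⌊c⌋ + 2 ^ k := ho'
    exact_mod_cast this
  rw [abs_le] at ht
  have hsl : -(τ : ℝ) - 1 ≤ s := by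
    rw [hs, le_div_iff₀ hp]; linarith
  have hsu : s ≤ τ + 1 := by
    rw [hs, div_le_iff₀ hp]; linarith
  have hfl : -(τ : ℤ) - 2 ≤ f := by
    have : -(τ : ℝ) - 2 < f := by linarith
    have h2 : ((-(τ : ℤ) - 2 : ℤ) : ℝ) < f := by push_cast; exact this
    exact (Int.cast_lt.1 h2).le
  have hfu : f ≤ (τ : ℤ) + 1 := by
    have : ((f : ℤ) : ℝ) ≤ ((τ + 1 : ℤ) : ℝ) := by push_cast; linarith
    exact Int.cast_le.1 this
  have hrange : ∀ l : ℤ, f ≤ l → l ≤ f + q → |l| ≤ B := by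
    intro l h1 h2
    rw [abs_le]
    constructor <;> omega
  constructor
  · have h1 : E.filter (fun y => c + t ≤ x y ∧ x y ≤ c + t + q * 2 ^ k) ⊆
        E.filter fun y => ⌊(x y - o) / 2 ^ k⌋ ∈ Finset.Icc f (f + q) := by
      intro y hy
      obtain ⟨hy, h2, h3⟩ := Finset.mem_filter.1 hy
      refine Finset.mem_filter.2 ⟨hy, Finset.mem_Icc.2 ⟨Int.le_floor.2 ?_, ?_⟩⟩
      · rw [le_div_iff₀ hp]
        have : (f : ℝ) * 2 ^ k ≤ s * 2 ^ k := by gcongr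
        linarith
      · refine Int.lt_add_one_iff.1 (Int.floor_lt.2 ?_)
        rw [div_lt_iff₀ hp]
        push_cast
        have : s * 2 ^ k < (f + 1) * 2 ^ k := by gcongr
        linarith
    have h2 : ((E.filter fun y => c + t ≤ x y ∧ x y ≤ c + t + q * 2 ^ k).card : ℝ) ≤ _ :=
      Nat.cast_le.2 (Finset.card_le_card h1)
    refine h2.trans ?_
    rw [card_filter_cell]
    refine (Finset.sum_le_card_nsmul _ _ ((v₀ + β) * 2 ^ k) fun l hl => ?_).trans (le_of_eq ?_)
    · rw [Finset.mem_Icc] at hl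
      have := (abs_le.1 (hv l (hrange l hl.1 hl.2))).2
      gcongr
      linarith
    · have h3 : f + q + 1 - f = ((q + 1 : ℕ) : ℤ) := by push_cast; ring
      rw [Int.card_Icc, nsmul_eq_mul, h3, Int.toNat_natCast]
      push_cast
      ring
  · have h1 : E.filter (fun y => ⌊(x y - o) / 2 ^ k⌋ ∈ Finset.Ico (f + 1) (f + q)) ⊆
        E.filter (fun y => c + t < x y ∧ x y ≤ c + t + q * 2 ^ k) := by
      intro y hy
      obtain ⟨hy, h2⟩ := Finset.mem_filter.1 hy
      rw [Finset.mem_Ico] at h2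
      have h3 := Int.le_floor.1 h2.1
      have h4 := Int.floor_lt.1 h2.2
      rw [le_div_iff₀ hp] at h3
      rw [div_lt_iff₀ hp] at h4
      push_cast at h3 h4
      have h5 : s * 2 ^ k < (f + 1) * 2 ^ k := by gcongr
      have h6 : (f : ℝ) * 2 ^ k ≤ s * 2 ^ k := by gcongr
      exact Finset.mem_filter.2 ⟨hy, by linarith, by linarith⟩
    have h2 : _ ≤ ((E.filter fun y => c + t < x y ∧ x y ≤ c + t + q * 2 ^ k).card : ℝ) :=
      Nat.cast_le.2 (Finset.card_le_card h1)
    refine le_trans ?_ h2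
    rw [card_filter_cell]
    refine le_trans (le_of_eq ?_) (Finset.card_nsmul_le_sum _ _ ((v₀ - β) * 2 ^ k) fun l hl => ?_)
    · have h3 : f + q - (f + 1) = ((q - 1 : ℕ) : ℤ) := by push_cast [hq]; ring
      rw [Int.card_Ico, nsmul_eq_mul, h3, Int.toNat_natCast]
      push_cast [hq]
      ring
    · rw [Finset.mem_Ico] at hl
      have := (abs_le.1 (hv l (hrange l (by linarith) (by linarith)))).1
      gcongr
      linarith

/-- The projected counting measure of `E` near `c` is flat at scale `q 2 ^ k` and thin at scale
`2 ^ k`. -/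
structure FlatThin (E : Finset R2) (x : R2 → ℝ) (c : ℝ) (k τ q : ℕ) (M : ℝ) : Prop where
  flat : ∀ t t' : ℝ, |t| ≤ τ * 2 ^ k → |t'| ≤ τ * 2 ^ k →
    |((E.filter fun y => c + t < x y ∧ x y ≤ c + t + q * 2 ^ k).card : ℝ) -
      (E.filter fun y => c + t' < x y ∧ x y ≤ c + t' + q * 2 ^ k).card| ≤ 9 * M * 2 ^ k
  thin : ∀ t : ℝ, |t| ≤ τ * 2 ^ k →
    ((E.filter fun y => |x y - (c + t)| ≤ 2 ^ k).card : ℝ) ≤ 9 * M * 2 ^ k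

lemma flatThin_of_cellDeficit {E : Finset R2} {x : R2 → ℝ} {k τ q B : ℕ} {c M e : ℝ}
    (hM : 1 ≤ M) (hq : 2 ≤ q) (hB : τ + q + 3 ≤ B) (he0 : 0 ≤ e)
    (he : 96 * e * (3 * M) ^ 3 ≤ (M / (q * B)) ^ 2)
    (halive : ((E.filter fun y => |x y - c| ≤ 2 ^ (k + 1)).card : ℝ) ≤ M * 2 ^ (k + 1))
    (h : ∑ i ∈ Finset.Icc (⌊c⌋ - (B + 1 : ℕ) * 2 ^ k) (⌊c⌋ + (B + 1 : ℕ) * 2 ^ k),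
      cellDeficit E x k i ≤ e * 2 ^ k) :
    FlatThin E x c k τ q M := by
  classical
  have hp : (0 : ℝ) < 2 ^ k := by positivity
  have hp1 : (1 : ℝ) ≤ 2 ^ k := one_le_pow₀ (by norm_num)
  obtain ⟨o, ho, ho', hd⟩ := exists_offset _ (cellDeficit_nonneg E x k) ⌊c⌋ k B (B + 1) le_rfl h
  have hc1 := Int.floor_le c
  have hc2 := Int.lt_floor_add_one c
  have ho1 : (⌊c⌋ : ℝ) ≤ o := by exact_mod_cast ho
  have ho2 : (o : ℝ) + 1 ≤ ⌊c⌋ + 2 ^ k := by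
    have : o + 1 ≤ ⌊c⌋ + 2 ^ k := ho'
    exact_mod_cast this
  obtain ⟨v, hv⟩ : ∃ v : ℤ → ℝ, v = fun l => cellAvg E x k (o + 2 ^ k * l) := ⟨_, rfl⟩
  have hv0 : v 0 ≤ 2 * M := by
    rw [hv]
    simp only [mul_zero, add_zero]
    rw [cellAvg, div_le_iff₀ hp]
    have h1 : 2 * M * 2 ^ k = M * 2 ^ (k + 1) := by ring
    rw [h1]
    refine le_trans (Nat.cast_le.2 (Finset.card_le_card fun y hy => ?_)) halive
    obtain ⟨hy, h2, h3⟩ := Finset.mem_filter.1 hy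
    refine Finset.mem_filter.2 ⟨hy, ?_⟩
    rw [abs_le, pow_succ]
    constructor <;> linarith
  have hvn : ∀ l, 0 ≤ v l := fun l => hv ▸ cellAvg_nonneg _ _ _ _
  have hq0 : (2 : ℝ) ≤ q := by exact_mod_cast hq
  have hB0 : (1 : ℝ) ≤ B := by exact_mod_cast (by omega : 1 ≤ B)
  have hBη : B * (M / (q * B)) = M / q := by field_simp
  have hMq : M / q ≤ M / 2 := by gcongr
  have hqB : 1 ≤ q * (B : ℝ) := by nlinarith
  have hη1 : M / (q * B) ≤ M := div_le_self (by linarith) hqB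
  have he2 : 48 * e * (3 * M) ≤ 1 := by
    have h1 : (M / (q * B)) ^ 2 ≤ M ^ 2 := by gcongr
    have h2 : (48 * e * (3 * M)) * (18 * M ^ 2) ≤ 1 * M ^ 2 := by
      have : (48 * e * (3 * M)) * (18 * M ^ 2) = 96 * e * (3 * M) ^ 3 := by ring
      linarith
    have h3 : 0 < M ^ 2 := by positivity
    have h4 : 0 ≤ 48 * e * (3 * M) := by positivity
    nlinarith
  have hchain := abs_sub_le_of_chain hvn (B := B) (η := M / (q * B)) hM hv0 (by positivity)
    (by linarith) he0 he he2 (fun l hl => by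
      have := hd l hl
      rw [cellDeficit] at this
      rw [hv]
      simp only
      rwa [mul_add, mul_one, ← add_assoc])
  have hclose : ∀ l : ℤ, |l| ≤ B → |cellAvg E x k (o + 2 ^ k * l) - v 0| ≤ M / q := by
    intro l hl
    obtain ⟨N, hN⟩ := Int.eq_nat_or_neg l
    have hNB : N ≤ B := by
      rcases hN with rfl | rfl <;> simpa using hl
    have h1 : N * (M / (q * B)) ≤ M / q := by rw [← hBη]; gcongr
    have h2 := hchain N hNB
    change |(fun l => cellAvg E x k (o + 2 ^ k * l)) l - v 0| ≤ _
    rw [← hv]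
    rcases hN with rfl | rfl
    · exact h2.1.trans h1
    · exact h2.2.trans h1
  have hqM : q * (M / q) = M := by field_simp
  have key : ∀ t t' : ℝ, |t| ≤ τ * 2 ^ k → |t'| ≤ τ * 2 ^ k →
      ((E.filter fun y => c + t < x y ∧ x y ≤ c + t + q * 2 ^ k).card : ℝ) -
      (E.filter fun y => c + t' < x y ∧ x y ≤ c + t' + q * 2 ^ k).card ≤ 9 * M * 2 ^ k := by
    intro t t' ht ht'
    have h1 := (window_count_bounds ho ho' (by omega) hclose ht (by omega : 1 ≤ q)).1
    have h2 := (window_count_bounds ho ho' (by omega) hclose ht' (by omega : 1 ≤ q)).2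
    have h3 : ((E.filter fun y => c + t < x y ∧ x y ≤ c + t + q * 2 ^ k).card : ℝ) ≤
        (E.filter fun y => c + t ≤ x y ∧ x y ≤ c + t + q * 2 ^ k).card :=
      Nat.cast_le.2 (Finset.card_le_card fun y hy => by
        rw [Finset.mem_filter] at hy ⊢
        exact ⟨hy.1, hy.2.1.le, hy.2.2⟩)
    have h4 : (q + 1) * (v 0 + M / q) * 2 ^ k - (q - 1) * (v 0 - M / q) * 2 ^ k ≤
        9 * M * 2 ^ k := by
      have : (q + 1) * (v 0 + M / q) * 2 ^ k - (q - 1) * (v 0 - M / q) * 2 ^ k =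
        (2 * v 0 + 2 * (q * (M / q))) * 2 ^ k := by ring
      rw [this, hqM]
      gcongr
      linarith
    linarith
  refine ⟨fun t t' ht ht' => abs_le.2 ⟨?_, key t t' ht ht'⟩, fun t ht => ?_⟩
  · have := key t' t ht' ht
    linarith
  · have ht' : |t - 2 ^ k| ≤ (τ + 1 : ℕ) * 2 ^ k := by
      rw [abs_le] at *
      push_cast
      constructor <;> linarith
    have h1 := (window_count_bounds (q := 2) ho ho' (by omega) hclose ht' (by omega)).1
    have h2 : ((E.filter fun y => |x y - (c + t)| ≤ 2 ^ k).card : ℝ) ≤ _ :=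
      le_trans (Nat.cast_le.2 (Finset.card_le_card fun y hy => by
        rw [Finset.mem_filter] at hy ⊢
        obtain ⟨hy, h⟩ := hy
        rw [abs_le] at h
        push_cast
        exact ⟨hy, by linarith, by linarith⟩)) h1
    refine h2.trans (mul_le_mul_of_nonneg_right ?_ hp.le)
    push_cast
    linarith

/-- The number of points of `E` whose projection is within `r` of that of `z`. -/
def tubeCount (E : Finset R2) (n j : ℕ) (z : R2) (r : ℝ) : ℕ :=
  (E.filter fun y => |prj n j y - prj n j z| ≤ r).card

open Classical in
/-- Directions in which `z` has small multiplicity at all scales from `2 ^ k` on. -/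
def aliveDirs (E : Finset R2) (n k : ℕ) (M : ℝ) (z : R2) : Finset ℕ :=
  (Finset.range n).filter fun j => ∀ k', k ≤ k' → (tubeCount E n j z (2 ^ k') : ℝ) ≤ M * 2 ^ k'

open Classical in
/-- Alive directions in which the projected measure is flat at scale `2 ^ k`. -/
def flatDirs (E : Finset R2) (n k τ q : ℕ) (M : ℝ) (z : R2) : Finset ℕ :=
  (aliveDirs E n k M z).filter fun j => FlatThin E (prj n j) (prj n j z) k τ q M

lemma mem_aliveDirs {E : Finset R2} {n k : ℕ} {M : ℝ} {z : R2} {j : ℕ} :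
    j ∈ aliveDirs E n k M z ↔
      j < n ∧ ∀ k', k ≤ k' → (tubeCount E n j z (2 ^ k') : ℝ) ≤ M * 2 ^ k' := by
  simp [aliveDirs]

lemma mem_flatDirs {E : Finset R2} {n k τ q : ℕ} {M : ℝ} {z : R2} {j : ℕ} :
    j ∈ flatDirs E n k τ q M z ↔
      j ∈ aliveDirs E n k M z ∧ FlatThin E (prj n j) (prj n j z) k τ q M := by
  simp [flatDirs]

lemma aliveDirs_subset_range (E : Finset R2) (n k : ℕ) (M : ℝ) (z : R2) :
    aliveDirs E n k M z ⊆ Finset.range n := by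
  classical
  exact Finset.filter_subset _ _

lemma aliveDirs_mono {E : Finset R2} {n k k' : ℕ} (h : k ≤ k') {M : ℝ} {z : R2} :
    aliveDirs E n k M z ⊆ aliveDirs E n k' M z := by
  intro j hj
  rw [mem_aliveDirs] at hj ⊢
  exact ⟨hj.1, fun l hl => hj.2 l (h.trans hl)⟩

/-- Nearby points have comparable multiplicities. -/
lemma aliveDirs_subset_of_norm_le {E : Finset R2} {n k : ℕ} {M : ℝ} {z z' : R2}
    (h : ‖z - z'‖ ≤ 3 * 2 ^ k) : aliveDirs E n k M z ⊆ aliveDirs E n k (4 * M) z' := by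
  intro j hj
  rw [mem_aliveDirs] at hj ⊢
  refine ⟨hj.1, fun l hl => ?_⟩
  refine le_trans (Nat.cast_le.2 (Finset.card_le_card fun y hy => ?_))
    ((hj.2 (l + 2) (by omega)).trans (le_of_eq (by ring)))
  rw [Finset.mem_filter] at hy ⊢
  refine ⟨hy.1, ?_⟩
  have h1 := (abs_prj_le n j (z' - z)).trans ((norm_sub_rev z' z).trans_le h)
  rw [prj_sub] at h1
  have h2 : (2 : ℝ) ^ k ≤ 2 ^ l := pow_le_pow_right₀ (by norm_num) hl
  have h3 : (2 : ℝ) ^ (l + 2) = 4 * 2 ^ l := by ring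
  have h4 := hy.2
  rw [h3]
  rw [abs_le] at *
  constructor <;> linarith

/-- A finite set that is lower regular at scales between `1` and `D`, of diameter at most `D`. -/
structure RegularNet (A D : ℝ) (E : Finset R2) : Prop where
  hA : 1 ≤ A
  diam_le : ∀ x ∈ E, ∀ y ∈ E, ‖x - y‖ ≤ D
  le_card : ∀ z ∈ E, ∀ r : ℝ, 1 ≤ r → r ≤ D → r / A ≤ (E.filter fun y => ‖y - z‖ ≤ r).card

/-- Admissible parameters in the analysis of end points. -/
structure TipParams (A M : ℝ) (m g γ β b q : ℕ) (W : ℝ) : Prop where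
  hm : 1 ≤ m
  hM : 1 ≤ M
  hq : 4 ≤ q
  hW : 12 ≤ W
  hγ : (g + 3) * 2 ^ m ≤ γ
  h1 : 16 * q * 2 ^ γ ≤ W
  h2 : 8 * m * q * 2 ^ γ * (2 * W) ^ (m + 1) ≤ 2 ^ β
  h3 : 2 * m * 2 ^ ((m + 1) * m) * (4 * q * (2 * W) ^ m * 2 ^ γ) ≤ (2 : ℝ) ^ β
  hAM : 8 * A * M < m
  hb : 2 * (W * (2 ^ β * (2 * W) ^ m)) ≤ 2 ^ b
  hmass : 2 ^ (m * (2 * 2 ^ ((m + 1) * m) + 3)) * (9 * M) < q / (2 * A)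

namespace TipParams

variable {A M : ℝ} {m g γ β b q : ℕ} {W : ℝ}

lemma beta_le (p : TipParams A M m g γ β b q W) : β ≤ b := by
  by_contra! h
  have h1 : (2 : ℝ) ^ b ≤ 2 ^ β := pow_le_pow_right₀ (by norm_num) h.le
  have h2 : (1 : ℝ) ≤ (2 * W) ^ m := one_le_pow₀ (by linarith [p.hW])
  have h3 := p.hb
  have h4 : (2 : ℝ) ^ β ≤ W * (2 ^ β * (2 * W) ^ m) := by
    calc (2 : ℝ) ^ β = 1 * (2 ^ β * 1) := by ring
      _ ≤ _ := by
        have : 1 ≤ W := by linarith [p.hW]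
        gcongr
  have h5 : (0 : ℝ) < 2 ^ β := by positivity
  linarith

lemma q_le (p : TipParams A M m g γ β b q W) : (8 * q : ℝ) ≤ 2 ^ β := by
  refine le_trans ?_ p.h2
  have h1 : (1 : ℝ) ≤ 2 ^ γ := one_le_pow₀ (by norm_num)
  have h2 : (1 : ℝ) ≤ (2 * W) ^ (m + 1) := one_le_pow₀ (by linarith [p.hW])
  have h3 : (1 : ℝ) ≤ m := by exact_mod_cast p.hm
  calc (8 * q : ℝ) = 8 * 1 * q * 1 * 1 := by ring
    _ ≤ _ := by gcongr

lemma scaleData (p : TipParams A M m g γ β b q W) {D : ℝ} {E : Finset R2}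
    (hE : RegularNet A D E) {n k : ℕ} (hn : 2 * D ≤ n) (hk : 2 ^ (k + β) ≤ D) {z : R2}
    (hz : z ∈ E) :
    ScaleData n m γ g A (2 ^ β * 2 ^ k) (q * 2 ^ k) (2 * 2 ^ k) W D (9 * M * 2 ^ k)
      (E.image fun y => y - z) (flatDirs E n k (6 * 2 ^ β) q M z) := by
  classical
  have hσ : (0 : ℝ) < 2 ^ k := by positivity
  have hσ1 : (1 : ℝ) ≤ 2 ^ k := one_le_pow₀ (by norm_num)
  have hβ1 : (1 : ℝ) ≤ 2 ^ β := one_le_pow₀ (by norm_num)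
  have hq : (4 : ℝ) ≤ q := by exact_mod_cast p.hq
  have hM := p.hM
  have hA := hE.hA
  have hinj : Function.Injective fun y : R2 => y - z := sub_left_injective
  have hcard : ∀ P : R2 → Prop, ∀ _ : DecidablePred P, ((E.image fun y => y - z).filter P).card =
      (E.filter fun y => P (y - z)).card := by
    intro P _
    rw [Finset.filter_image, Finset.card_image_of_injective _ hinj]
  have hk' : (2 : ℝ) ^ β * 2 ^ k ≤ D := by rw [← pow_add, add_comm]; exact hk
  refine ⟨p.hm, hA, by nlinarith, by positivity, p.hW, by positivity, hn, p.hγ, ?_, ?_, ?_, ?_,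
    ?_, ?_, ?_, ?_⟩
  · calc 32 * (q * 2 ^ k) * (2 : ℝ) ^ γ = 2 * 2 ^ k * (16 * q * 2 ^ γ) := by ring
      _ ≤ 2 * 2 ^ k * W := by gcongr; exact p.h1
  · calc 8 * m * (q * 2 ^ k) * 2 ^ γ * (2 * W) ^ (m + 1) =
        (8 * m * q * 2 ^ γ * (2 * W) ^ (m + 1)) * 2 ^ k := by ring
      _ ≤ _ := by gcongr; exact p.h2
  · calc 2 * m * 2 ^ ((m + 1) * m) * (4 * (q * 2 ^ k) * (2 * W) ^ m * 2 ^ γ) =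
        (2 * m * 2 ^ ((m + 1) * m) * (4 * q * (2 * W) ^ m * 2 ^ γ)) * 2 ^ k := by ring
      _ ≤ _ := by gcongr; exact p.h3
  · intro y hy
    obtain ⟨y, hy', rfl⟩ := Finset.mem_image.1 hy
    exact hE.diam_le y hy' z hz
  · intro w hw
    obtain ⟨w, hw', rfl⟩ := Finset.mem_image.1 hw
    rw [hcard]
    simp only [sub_sub_sub_cancel_right]
    exact hE.le_card w hw' _ (one_le_mul_of_one_le_of_one_le hβ1 hσ1) hk'
  · intro j hj t t' ht ht'
    have h1 := (mem_flatDirs.1 hj).2.flat t t' (by push_cast; linarith) (by push_cast; linarith)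
    rw [winCount_eq_card, winCount_eq_card, hcard, hcard]
    simp only [prj_sub, lt_sub_iff_add_lt', sub_le_iff_le_add', ← add_assoc]
    exact h1
  · intro j hj t ht
    have h1 := (mem_flatDirs.1 hj).2.thin t (by push_cast; linarith)
    rw [hcard]
    simp only [prj_sub, sub_sub]
    rw [show (2 : ℝ) * 2 ^ k / 2 = 2 ^ k by ring]
    exact h1
  · intro j hj
    have h1 := (mem_aliveDirs.1 (mem_flatDirs.1 hj).1).2 (k + β + 3) (by omega)
    rw [hcard]
    simp only [prj_sub]
    have h2 : ((E.filter fun y => |prj n j y - prj n j z| ≤ 6 * (2 ^ β * 2 ^ k)).card : ℝ) ≤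
        tubeCount E n j z (2 ^ (k + β + 3)) := by
      refine Nat.cast_le.2 (Finset.card_le_card fun y hy => ?_)
      rw [Finset.mem_filter] at hy ⊢
      refine ⟨hy.1, hy.2.trans ?_⟩
      rw [pow_add, pow_add]
      have : (0 : ℝ) < 2 ^ k * 2 ^ β := by positivity
      linarith
    calc A * ((E.filter fun y => |prj n j y - prj n j z| ≤ 6 * (2 ^ β * 2 ^ k)).card : ℝ)
        ≤ A * (M * 2 ^ (k + β + 3)) := by gcongr; exact h2.trans h1
      _ = 8 * A * M * (2 ^ β * 2 ^ k) := by ring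
      _ < m * (2 ^ β * 2 ^ k) := by gcongr; exact p.hAM

/-- A point that is locally extremal in a direction is not in the thickness core of the flat
directions. -/
lemma notMem_thick_flatDirs (p : TipParams A M m g γ β b q W) {D : ℝ} {E : Finset R2}
    (hE : RegularNet A D E) {n k : ℕ} (hn : 2 * D ≤ n) (hk : 2 ^ (k + b) ≤ D) {z : R2}
    (hz : z ∈ E) {j : ℕ}
    (htip : ∀ y ∈ E, ‖y - z‖ ≤ 2 ^ (k + b) / 2 → prj n j y ≤ prj n j z + 2 ^ k) :
    j ∉ (thick (1 / 2 ^ g) n)^[m] (flatDirs E n k (6 * 2 ^ β) q M z) := by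
  classical
  have hσ : (0 : ℝ) < 2 ^ k := by positivity
  have hq : (4 : ℝ) ≤ q := by exact_mod_cast p.hq
  have hA := hE.hA
  have hσ1 : (1 : ℝ) ≤ 2 ^ k := one_le_pow₀ (by norm_num)
  have hk2 : (2 : ℝ) ^ (k + β) ≤ D :=
    le_trans (pow_le_pow_right₀ (by norm_num) (by have := p.beta_le; omega)) hk
  refine (p.scaleData hE hn hk2 hz).notMem_thick_of_tip (σ := 2 ^ k) (s := 2 ^ (k + b) / 2)
    (by gcongr) ?_ ?_ ?_
  · have := mul_le_mul_of_nonneg_right p.hb hσ.le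
    rw [pow_add]
    linarith
  · intro y hy hys
    obtain ⟨y, hy', rfl⟩ := Finset.mem_image.1 hy
    rw [prj_sub]
    linarith [htip y hy' hys]
  · have hinj : Function.Injective fun y : R2 => y - z := sub_left_injective
    rw [Finset.filter_image, Finset.card_image_of_injective _ hinj]
    refine lt_of_lt_of_le ?_ (hE.le_card z hz (q * 2 ^ k / 2) (by nlinarith) ?_)
    · have := mul_lt_mul_of_pos_right p.hmass hσ
      calc _ = 2 ^ (m * (2 * 2 ^ ((m + 1) * m) + 3)) * (9 * M) * 2 ^ k := by ring
        _ < _ := this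
        _ = _ := by field_simp
    · have h1 := p.q_le
      rw [pow_add] at hk2
      have := mul_le_mul_of_nonneg_left h1 hσ.le
      have h3 : 0 ≤ q * (2 : ℝ) ^ k := by positivity
      linarith

end TipParams

/-- The length of the polygonal path through the points of a list. -/
def pathLen {X : Type*} [PseudoMetricSpace X] : List X → ℝ
  | [] => 0
  | [_] => 0
  | x :: y :: l => dist x y + pathLen (y :: l)

section PathLen

variable {X : Type*} [PseudoMetricSpace X]

@[simp] lemma pathLen_nil : pathLen ([] : List X) = 0 := rfl

@[simp] lemma pathLen_singleton (x : X) : pathLen [x] = 0 := rfl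

@[simp] lemma pathLen_cons_cons (x y : X) (l : List X) :
    pathLen (x :: y :: l) = dist x y + pathLen (y :: l) := rfl

lemma pathLen_nonneg : ∀ l : List X, 0 ≤ pathLen l
  | [] => le_rfl
  | [_] => le_rfl
  | _ :: y :: l => add_nonneg dist_nonneg (pathLen_nonneg (y :: l))

lemma pathLen_append_cons (l : List X) (x : X) (r : List X) :
    pathLen (l ++ x :: r) = pathLen (l ++ [x]) + pathLen (x :: r) := by
  induction l with
  | nil => simp
  | cons a t ih =>
    cases t with
    | nil => simp
    | cons c t =>
      simp only [List.cons_append, pathLen_cons_cons] at ih ⊢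
      rw [ih]; ring

/-- A path that is too long can be cut just before it becomes too long. -/
lemma exists_cut_of_lt_pathLen {D : ℝ} (hD : 0 ≤ D) (l : List X) (h : D < pathLen l) :
    ∃ p x r, l = p ++ x :: r ∧ pathLen p ≤ D ∧ D < pathLen (p ++ [x]) := by
  induction l using List.reverseRecOn with
  | nil => simp at h; linarith
  | append_singleton l a ih =>
    by_cases h' : D < pathLen l
    · obtain ⟨p, x, r, rfl, hp, hx⟩ := ih h'
      exact ⟨p, x, r ++ [a], by simp, hp, hx⟩
    · exact ⟨l, a, [], rfl, not_lt.1 h', h⟩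

/-- If short pieces of a path meet few points of `F`, then so does the whole path. -/
lemma card_filter_mem_list_le [DecidableEq X] {D : ℝ} (hD : 0 < D) (F : Finset X) (h : ℝ) (hh : 0 ≤ h)
    (l : List X) (H : ∀ p, p <:+: l → pathLen p ≤ D → ((F.filter (· ∈ p)).card : ℝ) ≤ h) :
    ((F.filter (· ∈ l)).card : ℝ) ≤ h * (pathLen l / D + 1) := by
  induction hN : l.length using Nat.strong_induction_on generalizing l with
  | _ N ih =>
  have h0 : 0 ≤ pathLen l / D := div_nonneg (pathLen_nonneg l) hD.le
  by_cases hl : pathLen l ≤ D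
  · exact (H l (List.infix_refl l) hl).trans (by nlinarith)
  obtain ⟨p, x, r, rfl, hp, hx⟩ := exists_cut_of_lt_pathLen hD.le l (not_le.1 hl)
  have hp0 : p ≠ [] := by
    rintro rfl
    simp at hx; linarith
  have h1 := H p ⟨[], x :: r, by simp⟩ hp
  have h2 := ih (x :: r).length (by
    have := List.length_pos_iff.2 hp0
    simp only [List.length_append] at hN; omega) (x :: r)
    (fun p' hp' => H p' (hp'.trans ⟨p, [], by simp⟩)) rfl
  have h3 : F.filter (· ∈ p ++ x :: r) ⊆ F.filter (· ∈ p) ∪ F.filter (· ∈ x :: r) := by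
    intro y hy
    simp only [Finset.mem_filter, List.mem_append, Finset.mem_union] at hy ⊢
    tauto
  have h4 : ((F.filter (· ∈ p ++ x :: r)).card : ℝ) ≤
      (F.filter (· ∈ p)).card + (F.filter (· ∈ x :: r)).card := by
    rw [← Nat.cast_add]
    exact Nat.cast_le.2 ((Finset.card_le_card h3).trans (Finset.card_union_le _ _))
  have h5 : pathLen (x :: r) / D + 1 ≤ pathLen (p ++ x :: r) / D := by
    rw [pathLen_append_cons, add_div, add_comm]
    gcongr
    rw [le_div_iff₀ hD]; linarith
  have h6 := mul_le_mul_of_nonneg_left h5 hh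
  linarith

/-- The points of `Q` can be visited by a closed path of length at most `L` from any of them. -/
def HasTour (Q : Finset X) (L : ℝ) : Prop :=
  ∀ x ∈ Q, ∃ l : List X, l.head? = some x ∧ l.getLast? = some x ∧ (∀ y, y ∈ l ↔ y ∈ Q) ∧
    pathLen l ≤ L

lemma hasTour_singleton (x : X) : HasTour {x} 0 := by
  intro y hy
  rw [Finset.mem_singleton] at hy
  subst hy
  exact ⟨[y], by simp⟩

lemma HasTour.union_aux [DecidableEq X] {Q Q' : Finset X} {L L' r : ℝ} (h : HasTour Q L)
    (h' : HasTour Q' L') {a b : X} (ha : a ∈ Q) (hb : b ∈ Q') (hab : dist a b ≤ r) {x : X}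
    (hx : x ∈ Q) :
    ∃ l : List X, l.head? = some x ∧ l.getLast? = some x ∧ (∀ y, y ∈ l ↔ y ∈ Q ∪ Q') ∧
      pathLen l ≤ L + L' + 2 * r := by
  obtain ⟨l, h1, h2, h3, h4⟩ := h x hx
  obtain ⟨l', h1', h2', h3', h4'⟩ := h' b hb
  obtain ⟨s, t, rfl⟩ := List.append_of_mem ((h3 a).2 ha)
  obtain ⟨u, hu⟩ : ∃ u, l' = b :: u := by
    cases l' with
    | nil => simp at h1'
    | cons c u => simp at h1'; exact ⟨u, by rw [h1']⟩
  obtain ⟨v, hv⟩ : ∃ v, l' = v ++ [b] := List.getLast?_eq_some_iff.1 h2'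
  refine ⟨s ++ a :: (l' ++ a :: t), ?_, ?_, ?_, ?_⟩
  · cases s <;> simpa using h1
  · have e : s ++ a :: (l' ++ a :: t) = (s ++ a :: l') ++ (a :: t) := by simp
    rw [List.getLast?_append_of_ne_nil _ (by simp)] at h2
    rw [e, List.getLast?_append_of_ne_nil _ (by simp), h2]
  · intro y
    have hy := h3 y
    simp only [List.mem_append, List.mem_cons, Finset.mem_union, h3'] at hy ⊢
    tauto
  · rw [pathLen_append_cons, hu, List.cons_append, pathLen_cons_cons, ← List.cons_append, ← hu, hv,
      List.append_assoc, List.singleton_append, pathLen_append_cons v, pathLen_cons_cons, ← hv,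
      dist_comm b a]
    rw [pathLen_append_cons] at h4
    linarith

lemma HasTour.union [DecidableEq X] {Q Q' : Finset X} {L L' r : ℝ} (h : HasTour Q L)
    (h' : HasTour Q' L') {a b : X} (ha : a ∈ Q) (hb : b ∈ Q') (hab : dist a b ≤ r) :
    HasTour (Q ∪ Q') (L + L' + 2 * r) := by
  intro x hx
  rcases Finset.mem_union.1 hx with hx | hx
  · exact h.union_aux h' ha hb hab hx
  · obtain ⟨l, h⟩ := h'.union_aux h hb ha ((dist_comm b a).trans_le hab) hx
    refine ⟨l, h.1, h.2.1, ?_, ?_⟩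
    · rw [Finset.union_comm]; exact h.2.2.1
    · linarith [h.2.2.2]

/-- Nonempty sets with union `F`, visited by closed paths of total length at most `c`. -/
structure TourFamily [DecidableEq X] (F : Finset X) (𝒬 : Finset (Finset X)) (c : ℝ) : Prop where
  nonempty : ∀ Q ∈ 𝒬, Q.Nonempty
  mem_iff : ∀ x, x ∈ F ↔ ∃ Q ∈ 𝒬, x ∈ Q
  tours : ∃ L : Finset X → ℝ, (∀ Q ∈ 𝒬, 0 ≤ L Q ∧ HasTour Q (L Q)) ∧ ∑ Q ∈ 𝒬, L Q ≤ c

lemma tourFamily_singletons [DecidableEq X] (F : Finset X) :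
    TourFamily F (F.image fun x => {x}) 0 := by
  refine ⟨?_, ?_, fun _ => 0, ?_, by simp⟩
  · intro Q hQ
    obtain ⟨x, -, rfl⟩ := Finset.mem_image.1 hQ
    exact Finset.singleton_nonempty x
  · intro x
    simp
  · intro Q hQ
    obtain ⟨x, -, rfl⟩ := Finset.mem_image.1 hQ
    exact ⟨le_rfl, hasTour_singleton x⟩

/-- Merging the sets that are at distance at most `r`. -/
lemma TourFamily.exists_separated [DecidableEq X] {F : Finset X} {𝒬 : Finset (Finset X)} {c r : ℝ}
    (hr : 0 ≤ r) (h : TourFamily F 𝒬 c) :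
    ∃ 𝒬', TourFamily F 𝒬' (c + 2 * r * 𝒬.card) ∧
      ∀ Q ∈ 𝒬', ∀ Q' ∈ 𝒬', Q ≠ Q' → ∀ x ∈ Q, ∀ y ∈ Q', r < dist x y := by
  induction hN : 𝒬.card using Nat.strong_induction_on generalizing 𝒬 c with
  | _ N ih =>
  subst hN
  by_cases hs : ∀ Q ∈ 𝒬, ∀ Q' ∈ 𝒬, Q ≠ Q' → ∀ x ∈ Q, ∀ y ∈ Q', r < dist x y
  · refine ⟨𝒬, ⟨h.nonempty, h.mem_iff, ?_⟩, hs⟩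
    obtain ⟨L, h1, h2⟩ := h.tours
    exact ⟨L, h1, h2.trans (by nlinarith [Nat.cast_nonneg (α := ℝ) 𝒬.card])⟩
  push Not at hs
  obtain ⟨Q, hQ, Q', hQ', hne, x, hx, y, hy, hxy⟩ := hs
  set 𝒬₀ := (𝒬.erase Q).erase Q' with h𝒬₀
  have hQ'1 : Q' ∈ 𝒬.erase Q := Finset.mem_erase.2 ⟨hne.symm, hQ'⟩
  have hc0 : 𝒬₀.card + 2 = 𝒬.card := by
    rw [← Finset.card_erase_add_one hQ, ← Finset.card_erase_add_one hQ'1]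
  have hc1 : (insert (Q ∪ Q') 𝒬₀).card ≤ 𝒬₀.card + 1 := Finset.card_insert_le _ _
  have hfam : TourFamily F (insert (Q ∪ Q') 𝒬₀) (c + 2 * r) := by
    refine ⟨?_, ?_, ?_⟩
    · intro R hR
      rcases Finset.mem_insert.1 hR with rfl | hR
      · exact ⟨x, Finset.mem_union_left _ hx⟩
      · exact h.nonempty R (Finset.mem_of_mem_erase (Finset.mem_of_mem_erase hR))
    · intro w
      rw [h.mem_iff]
      constructor
      · rintro ⟨R, hR, hw⟩
        by_cases h1 : R = Q
        · exact ⟨_, Finset.mem_insert_self _ _, Finset.mem_union_left _ (h1 ▸ hw)⟩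
        by_cases h2 : R = Q'
        · exact ⟨_, Finset.mem_insert_self _ _, Finset.mem_union_right _ (h2 ▸ hw)⟩
        · exact ⟨R, Finset.mem_insert_of_mem (Finset.mem_erase.2 ⟨h2, Finset.mem_erase.2 ⟨h1, hR⟩⟩),
            hw⟩
      · rintro ⟨R, hR, hw⟩
        rcases Finset.mem_insert.1 hR with rfl | hR
        · rcases Finset.mem_union.1 hw with hw | hw
          · exact ⟨Q, hQ, hw⟩
          · exact ⟨Q', hQ', hw⟩
        · exact ⟨R, Finset.mem_of_mem_erase (Finset.mem_of_mem_erase hR), hw⟩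
    · obtain ⟨L, h1, h2⟩ := h.tours
      refine ⟨Function.update L (Q ∪ Q') (L Q + L Q' + 2 * r), ?_, ?_⟩
      · intro R hR
        by_cases hRQ : R = Q ∪ Q'
        · subst hRQ
          rw [Function.update_self]
          exact ⟨by linarith [(h1 Q hQ).1, (h1 Q' hQ').1],
            (h1 Q hQ).2.union (h1 Q' hQ').2 hx hy hxy⟩
        · rw [Function.update_of_ne hRQ]
          rcases Finset.mem_insert.1 hR with rfl | hR
          · exact absurd rfl hRQ
          · exact h1 R (Finset.mem_of_mem_erase (Finset.mem_of_mem_erase hR))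
      · have h0 : insert (Q ∪ Q') 𝒬₀ = insert (Q ∪ Q') (𝒬₀.erase (Q ∪ Q')) := by
          ext R
          simp only [Finset.mem_insert, Finset.mem_erase]
          tauto
        rw [h0, Finset.sum_insert (Finset.notMem_erase _ _),
          Function.update_self]
        have h3 : ∑ R ∈ 𝒬₀.erase (Q ∪ Q'),
            Function.update L (Q ∪ Q') (L Q + L Q' + 2 * r) R ≤ ∑ R ∈ 𝒬₀, L R := by
          rw [Finset.sum_congr rfl fun R hR => Function.update_of_ne (Finset.ne_of_mem_erase hR) _ _]
          exact Finset.sum_le_sum_of_subset_of_nonneg (Finset.erase_subset _ _) fun R hR _ =>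
            (h1 R (Finset.mem_of_mem_erase (Finset.mem_of_mem_erase hR))).1
        have h4 := Finset.add_sum_erase 𝒬 L hQ
        have h5 := Finset.add_sum_erase (𝒬.erase Q) L hQ'1
        linarith
  obtain ⟨𝒬', h1, h2⟩ := ih _ (by omega) hfam rfl
  refine ⟨𝒬', ⟨h1.nonempty, h1.mem_iff, ?_⟩, h2⟩
  obtain ⟨L, h3, h4⟩ := h1.tours
  refine ⟨L, h3, h4.trans ?_⟩
  have h5 : ((insert (Q ∪ Q') 𝒬₀).card : ℝ) + 1 ≤ 𝒬.card := by
    exact_mod_cast (by omega)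
  nlinarith

/-- Visiting `F` by merging through an increasing sequence of scales. -/
lemma exists_tour_of_scales [DecidableEq X] (F : Finset X) (r : ℕ → ℝ) (hr : ∀ k, 0 ≤ r k)
    (N : ℕ → ℝ) (K : ℕ) (hK : 1 ≤ K)
    (hN : ∀ k, 1 ≤ k → k < K → ∀ 𝒬 : Finset (Finset X), (∀ Q ∈ 𝒬, Q.Nonempty) →
      (∀ x, x ∈ F ↔ ∃ Q ∈ 𝒬, x ∈ Q) →
      (∀ Q ∈ 𝒬, ∀ Q' ∈ 𝒬, Q ≠ Q' → ∀ x ∈ Q, ∀ y ∈ Q', r k < dist x y) → (𝒬.card : ℝ) ≤ N k)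
    (hF : ∀ x ∈ F, ∀ y ∈ F, dist x y ≤ r K) :
    ∃ l : List X, (∀ y, y ∈ l ↔ y ∈ F) ∧
      pathLen l ≤ 2 * r 1 * F.card + ∑ k ∈ Finset.Ico 1 K, 2 * r (k + 1) * N k := by
  have key : ∀ k, 1 ≤ k → k ≤ K → ∃ 𝒬,
      TourFamily F 𝒬 (2 * r 1 * F.card + ∑ i ∈ Finset.Ico 1 k, 2 * r (i + 1) * N i) ∧
      ∀ Q ∈ 𝒬, ∀ Q' ∈ 𝒬, Q ≠ Q' → ∀ x ∈ Q, ∀ y ∈ Q', r k < dist x y := by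
    intro k hk
    induction k, hk using Nat.le_induction with
    | base =>
      intro _
      obtain ⟨𝒬, h1, h2⟩ := (tourFamily_singletons F).exists_separated (hr 1)
      refine ⟨𝒬, ?_, h2⟩
      rw [Finset.card_image_of_injective _ Finset.singleton_injective] at h1
      simpa using h1
    | succ k hk ih =>
      intro hkK
      obtain ⟨𝒬, h1, h2⟩ := ih (by omega)
      obtain ⟨𝒬', h3, h4⟩ := h1.exists_separated (hr (k + 1))
      refine ⟨𝒬', ⟨h3.nonempty, h3.mem_iff, ?_⟩, h4⟩
      obtain ⟨L, h5, h6⟩ := h3.tours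
      refine ⟨L, h5, h6.trans ?_⟩
      rw [Finset.sum_Ico_succ_top hk, ← add_assoc]
      gcongr
      · linarith [hr (k + 1)]
      · exact hN k hk (by omega) 𝒬 h1.nonempty h1.mem_iff h2
  obtain ⟨𝒬, h1, h2⟩ := key K hK le_rfl
  obtain ⟨L, h3, h4⟩ := h1.tours
  rcases 𝒬.eq_empty_or_nonempty with h0 | ⟨Q, hQ⟩
  · refine ⟨[], fun y => ?_, ?_⟩
    · rw [h1.mem_iff]; simp [h0]
    · rw [h0] at h4; simpa using h4
  obtain ⟨x, hx⟩ := h1.nonempty Q hQ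
  have hall : ∀ Q' ∈ 𝒬, Q' = Q := by
    intro Q' hQ'
    by_contra hne
    obtain ⟨y, hy⟩ := h1.nonempty Q' hQ'
    exact absurd (hF y ((h1.mem_iff y).2 ⟨Q', hQ', hy⟩) x ((h1.mem_iff x).2 ⟨Q, hQ, hx⟩))
      (not_le.2 (h2 Q' hQ' Q hQ hne y hy x hx))
  obtain ⟨l, -, -, h5, h6⟩ := (h3 Q hQ).2 x hx
  refine ⟨l, fun y => ?_, ?_⟩
  · rw [h5, h1.mem_iff]
    constructor
    · intro h; exact ⟨Q, hQ, h⟩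
    · rintro ⟨Q', hQ', hy⟩
      rwa [← hall Q' hQ']
  · refine h6.trans (le_trans ?_ h4)
    exact Finset.single_le_sum (f := L) (fun R hR => (h3 R hR).1) hQ

end PathLen

open Classical in
/-- Points whose direction `j` robustly persists as alive direction, but not as a flat one. -/
def tipPoints (E : Finset R2) (n k τ q : ℕ) (M : ℝ) (m g j : ℕ) : Finset R2 :=
  E.filter fun z => j ∈ (thick (2 * (1 / 2 ^ g)) n)^[m] (aliveDirs E n k M z) \
    (thick (1 / 2 ^ g) n)^[m] (flatDirs E n k τ q M z)

open Classical in
/-- Points at distance comparable to `2 ^ k` from `F`. -/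
def frontierPoints (E F : Finset R2) (k b : ℕ) : Finset R2 :=
  E.filter fun y => (∃ x ∈ F, ‖y - x‖ ≤ 3 * 2 ^ (k + b)) ∧ ∀ x ∈ F, 2 ^ k ≤ 2 * ‖y - x‖

open Classical in
/-- Points whose direction `j` robustly persists as alive direction at the unit scale. -/
def persistentPoints (E : Finset R2) (n : ℕ) (M : ℝ) (m g j : ℕ) : Finset R2 :=
  E.filter fun z => j ∈ (thick (2 * (1 / 2 ^ g)) n)^[m] (aliveDirs E n 1 M z)

namespace TipParams

variable {A M : ℝ} {m g γ β b q : ℕ} {W : ℝ}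

lemma le_two_pow (p : TipParams A M m g γ β b q W) : (24 : ℝ) ≤ 2 ^ b := by
  have hW := p.hW
  have h1 : (1 : ℝ) ≤ 2 ^ β * (2 * W) ^ m :=
    one_le_mul_of_one_le_of_one_le (one_le_pow₀ (by norm_num)) (one_le_pow₀ (by linarith))
  have h2 := p.hb
  nlinarith

/-- Well separated pieces of the set of persistent points are few, up to tips and frontier. -/
lemma card_mul_le (p : TipParams A (4 * M) m g γ β b q W) {D : ℝ} {E : Finset R2}
    (hE : RegularNet A D E) {n k j : ℕ} (hn : 2 * D ≤ n) (hk1 : 1 ≤ k) (hk : 2 ^ (k + b) ≤ D)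
    (𝒬 : Finset (Finset R2)) (hne : ∀ Q ∈ 𝒬, Q.Nonempty)
    (hcov : ∀ x, x ∈ persistentPoints E n M m g j ↔ ∃ Q ∈ 𝒬, x ∈ Q)
    (hsep : ∀ Q ∈ 𝒬, ∀ Q' ∈ 𝒬, Q ≠ Q' → ∀ x ∈ Q, ∀ y ∈ Q', 8 * 2 ^ (k + b) < dist x y) :
    𝒬.card * (2 ^ k / 2 / A) ≤ (tipPoints E n k (6 * 2 ^ β) q (4 * M) m g j).card +
      (frontierPoints E (persistentPoints E n M m g j) k b).card := by
  classical
  set F := persistentPoints E n M m g j with hF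
  have hFE : F ⊆ E := by
    rw [hF, persistentPoints]; exact Finset.filter_subset _ _
  have hQE : ∀ Q ∈ 𝒬, Q ⊆ E := fun Q hQ x hx => hFE ((hcov x).2 ⟨Q, hQ, hx⟩)
  have hσ : (0 : ℝ) < 2 ^ k := by positivity
  have hσ2 : (2 : ℝ) ≤ 2 ^ k := by
    calc (2 : ℝ) = 2 ^ 1 := by norm_num
      _ ≤ 2 ^ k := pow_le_pow_right₀ (by norm_num) hk1
  have hb := p.le_two_pow
  obtain ⟨s, hs⟩ : ∃ s : ℝ, s = 2 ^ (k + b) := ⟨_, rfl⟩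
  have hsσ : 24 * 2 ^ k ≤ s := by
    rw [hs, pow_add]; nlinarith
  rw [← hs] at hk hsep
  have hex : ∀ Q ∈ 𝒬, ∃ z ∈ E, (∃ x ∈ Q, ‖z - x‖ ≤ 2 * s) ∧
      ∀ y ∈ E, (∃ x ∈ Q, ‖y - x‖ ≤ 2 * s) → prj n j y ≤ prj n j z := by
    intro Q hQ
    obtain ⟨x, hx⟩ := hne Q hQ
    obtain ⟨z, hz, hmax⟩ := (E.filter fun y => ∃ x ∈ Q, ‖y - x‖ ≤ 2 * s).exists_max_image
      (prj n j) ⟨x, Finset.mem_filter.2 ⟨hQE Q hQ hx, x, hx, by simp; linarith⟩⟩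
    rw [Finset.mem_filter] at hz
    exact ⟨z, hz.1, hz.2, fun y hy hyx => hmax y (Finset.mem_filter.2 ⟨hy, hyx⟩)⟩
  choose! z hzE hzQ hzmax using hex
  have hdisj : (𝒬 : Set (Finset R2)).PairwiseDisjoint
      fun Q => E.filter fun y => ‖y - z Q‖ ≤ 2 ^ k / 2 := by
    intro Q hQ Q' hQ' hQQ'
    refine Finset.disjoint_left.2 fun y hy hy' => ?_
    rw [Finset.mem_filter] at hy hy'
    obtain ⟨x, hx, hxz⟩ := hzQ Q hQ
    obtain ⟨x', hx', hxz'⟩ := hzQ Q' hQ'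
    have h1 := hsep Q hQ Q' hQ' hQQ' x hx x' hx'
    have h2 : dist x x' ≤ dist x (z Q) + dist (z Q) y + (dist y (z Q') + dist (z Q') x') :=
      (dist_triangle _ y _).trans (add_le_add (dist_triangle _ _ _) (dist_triangle _ _ _))
    rw [dist_comm x (z Q), dist_comm (z Q) y] at h2
    simp only [dist_eq_norm] at h1 h2
    linarith [hy.2, hy'.2]
  have hsub : (𝒬.biUnion fun Q => E.filter fun y => ‖y - z Q‖ ≤ 2 ^ k / 2) ⊆
      tipPoints E n k (6 * 2 ^ β) q (4 * M) m g j ∪ frontierPoints E F k b := by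
    intro z' hz'
    obtain ⟨Q, hQ, hz'Q⟩ := Finset.mem_biUnion.1 hz'
    rw [Finset.mem_filter] at hz'Q
    rw [Finset.mem_union]
    by_cases hc : ∃ x ∈ Q, ‖z Q - x‖ ≤ 2 ^ k
    · left
      obtain ⟨x, hx, hxz⟩ := hc
      rw [tipPoints, Finset.mem_filter, Finset.mem_sdiff]
      refine ⟨hz'Q.1, ?_, ?_⟩
      · have hxF : x ∈ F := (hcov x).2 ⟨Q, hQ, hx⟩
        rw [hF, persistentPoints, Finset.mem_filter] at hxF
        refine iterate_thick_mono ?_ m hxF.2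
        refine (aliveDirs_mono hk1).trans (aliveDirs_subset_of_norm_le ?_)
        have h1 : dist x z' ≤ dist x (z Q) + dist (z Q) z' := dist_triangle _ _ _
        rw [dist_comm x (z Q), dist_comm (z Q) z'] at h1
        simp only [dist_eq_norm] at h1
        linarith [hz'Q.2]
      · refine p.notMem_thick_flatDirs hE hn (hs ▸ hk) hz'Q.1 fun y hy hyz => ?_
        rw [← hs] at hyz
        have h1 : dist y x ≤ dist y z' + dist z' (z Q) + dist (z Q) x :=
          (dist_triangle _ (z Q) _).trans (add_le_add_left (dist_triangle _ _ _) _)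
        simp only [dist_eq_norm] at h1
        have h2 := hzmax Q hQ y hy ⟨x, hx, by linarith [hz'Q.2]⟩
        have h3 := abs_prj_le n j (z' - z Q)
        rw [prj_sub, abs_le] at h3
        linarith [hz'Q.2, h3.1]
    · right
      push Not at hc
      rw [frontierPoints, Finset.mem_filter]
      refine ⟨hz'Q.1, ?_, ?_⟩
      · obtain ⟨x, hx, hxz⟩ := hzQ Q hQ
        refine ⟨x, (hcov x).2 ⟨Q, hQ, hx⟩, ?_⟩
        rw [← hs]
        have h1 : dist z' x ≤ dist z' (z Q) + dist (z Q) x := dist_triangle _ _ _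
        simp only [dist_eq_norm] at h1
        linarith [hz'Q.2]
      · intro x hx
        obtain ⟨Q', hQ', hxQ'⟩ := (hcov x).1 hx
        have h0 : 2 ^ k ≤ ‖z Q - x‖ := by
          by_cases hQQ' : Q = Q'
          · subst hQQ'
            exact (hc x hxQ').le
          · obtain ⟨w, hw, hwz⟩ := hzQ Q hQ
            have h1 := hsep Q hQ Q' hQ' hQQ' w hw x hxQ'
            have h2 : dist w x ≤ dist w (z Q) + dist (z Q) x := dist_triangle _ _ _
            rw [dist_comm w (z Q)] at h2
            simp only [dist_eq_norm] at h1 h2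
            linarith
        have h1 : dist (z Q) x ≤ dist (z Q) z' + dist z' x := dist_triangle _ _ _
        rw [dist_comm (z Q) z'] at h1
        simp only [dist_eq_norm] at h1
        linarith [hz'Q.2]
  have h1 : ((𝒬.biUnion fun Q => E.filter fun y => ‖y - z Q‖ ≤ 2 ^ k / 2).card : ℝ) ≤
      (tipPoints E n k (6 * 2 ^ β) q (4 * M) m g j).card + (frontierPoints E F k b).card := by
    rw [← Nat.cast_add]
    exact Nat.cast_le.2 ((Finset.card_le_card hsub).trans (Finset.card_union_le _ _))
  refine le_trans ?_ h1
  rw [Finset.card_biUnion hdisj, Nat.cast_sum, ← nsmul_eq_mul]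
  refine Finset.card_nsmul_le_sum _ _ _ fun Q hQ => ?_
  exact hE.le_card (z Q) (hzE Q hQ) _ (by linarith) (by linarith)

end TipParams

/-- A point is in the frontier at boundedly many scales. -/
lemma sum_card_frontierPoints_le (E F : Finset R2) (b K : ℕ) :
    ∑ k ∈ Finset.range K, (frontierPoints E F k b).card ≤ (b + 3) * E.card := by
  classical
  simp only [frontierPoints, Finset.card_filter]
  rw [Finset.sum_comm, mul_comm, ← smul_eq_mul]
  refine Finset.sum_le_card_nsmul _ _ _ fun y _ => ?_
  rw [← Finset.card_filter]
  set S := (Finset.range K).filter fun k =>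
    (∃ x ∈ F, ‖y - x‖ ≤ 3 * 2 ^ (k + b)) ∧ ∀ x ∈ F, 2 ^ k ≤ 2 * ‖y - x‖ with hS
  rcases S.eq_empty_or_nonempty with h0 | h0
  · rw [h0]; simp
  have hmin := S.min'_mem h0
  set k₀ := S.min' h0 with hk₀
  refine (Finset.card_le_card (t := Finset.Ico k₀ (k₀ + (b + 3))) fun k hk => ?_).trans
    (by simp)
  refine Finset.mem_Ico.2 ⟨S.min'_le k hk, ?_⟩
  rw [hS, Finset.mem_filter] at hmin hk
  obtain ⟨x, hx, hxy⟩ := hmin.2.1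
  have h1 := hk.2.2 x hx
  by_contra! h
  have h2 : (2 : ℝ) ^ (k₀ + (b + 3)) ≤ 2 ^ k := pow_le_pow_right₀ (by norm_num) h
  have h3 : (2 : ℝ) ^ (k₀ + (b + 3)) = 8 * 2 ^ (k₀ + b) := by ring
  have h4 : (0 : ℝ) < 2 ^ (k₀ + b) := by positivity
  linarith

/-- The persistent points in a fixed direction are visited by a short path. -/
lemma TipParams.exists_path {A M : ℝ} {m g γ β b q : ℕ} {W : ℝ}
    (p : TipParams A (4 * M) m g γ β b q W) {D : ℝ} {E : Finset R2} (hE : RegularNet A D E)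
    {n j : ℕ} (hn : 2 * D ≤ n) (K : ℕ) (hK : 1 ≤ K) (hKD : ∀ k < K, 1 ≤ k → 2 ^ (k + b) ≤ D)
    (hDK : D ≤ 2 ^ (K + b)) :
    ∃ l : List R2, (∀ y, y ∈ l ↔ y ∈ persistentPoints E n M m g j) ∧
      pathLen l ≤ 2 ^ (b + 6) * A * ((b + 4) * E.card +
        ∑ k ∈ Finset.range K, ((tipPoints E n k (6 * 2 ^ β) q (4 * M) m g j).card : ℝ)) := by
  classical
  set F := persistentPoints E n M m g j with hF
  have hFE : F ⊆ E := by
    rw [hF, persistentPoints]; exact Finset.filter_subset _ _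
  have hA := hE.hA
  obtain ⟨l, h1, h2⟩ := exists_tour_of_scales F (fun k => 8 * 2 ^ (k + b)) (fun k => by positivity)
    (fun k => ((tipPoints E n k (6 * 2 ^ β) q (4 * M) m g j).card + (frontierPoints E F k b).card) *
      (2 * A / 2 ^ k)) K hK
    (fun k hk hkK 𝒬 hne hcov hsep => by
      have h := p.card_mul_le hE hn hk (hKD k hkK hk) 𝒬 hne hcov hsep
      have h' := mul_le_mul_of_nonneg_right h (show 0 ≤ 2 * A / 2 ^ k by positivity)
      have e : (𝒬.card : ℝ) * (2 ^ k / 2 / A) * (2 * A / 2 ^ k) = 𝒬.card := by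
        field_simp
      rw [e] at h'
      exact h')
    (fun x hx y hy => by
      rw [dist_eq_norm]
      refine (hE.diam_le x (hFE hx) y (hFE hy)).trans (hDK.trans ?_)
      have : (0 : ℝ) < 2 ^ (K + b) := by positivity
      linarith)
  refine ⟨l, h1, h2.trans ?_⟩
  have e1 : ∀ k, 2 * (8 * 2 ^ (k + 1 + b)) * (((tipPoints E n k (6 * 2 ^ β) q (4 * M) m g j).card +
      (frontierPoints E F k b).card) * (2 * A / 2 ^ k)) = 2 ^ (b + 6) * A *
      (((tipPoints E n k (6 * 2 ^ β) q (4 * M) m g j).card : ℝ) +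
        (frontierPoints E F k b).card) := by
    intro k
    have : (2 : ℝ) ^ k ≠ 0 := by positivity
    field_simp
    ring
  simp only [e1]
  rw [← Finset.mul_sum, Finset.sum_add_distrib]
  have h3 : (F.card : ℝ) ≤ E.card := Nat.cast_le.2 (Finset.card_le_card hFE)
  have h4 : ∑ k ∈ Finset.Ico 1 K, ((frontierPoints E F k b).card : ℝ) ≤ (b + 3) * E.card := by
    refine le_trans (Finset.sum_le_sum_of_subset_of_nonneg (t := Finset.range K) ?_ ?_) ?_
    · intro k hk
      exact Finset.mem_range.2 (Finset.mem_Ico.1 hk).2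
    · intros; positivity
    · exact_mod_cast sum_card_frontierPoints_le E F b K
  have h5 : ∑ k ∈ Finset.Ico 1 K, ((tipPoints E n k (6 * 2 ^ β) q (4 * M) m g j).card : ℝ) ≤
      ∑ k ∈ Finset.range K, ((tipPoints E n k (6 * 2 ^ β) q (4 * M) m g j).card : ℝ) := by
    refine Finset.sum_le_sum_of_subset_of_nonneg ?_ ?_
    · intro k hk
      exact Finset.mem_range.2 (Finset.mem_Ico.1 hk).2
    · intros; positivity
  have h6 : 2 * (8 * (2 : ℝ) ^ (1 + b)) * F.card ≤ 2 ^ (b + 6) * A * E.card := by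
    have : (2 : ℝ) ^ (b + 6) = 2 * (8 * 2 ^ (1 + b)) * 2 := by ring
    rw [this]
    have h7 : 2 * (8 * (2 : ℝ) ^ (1 + b)) * 1 * F.card ≤
      2 * (8 * 2 ^ (1 + b)) * (2 * A) * E.card := by
      gcongr; linarith
    linarith
  have h7 : (0 : ℝ) ≤ 2 ^ (b + 6) * A := by positivity
  calc _ ≤ 2 ^ (b + 6) * A * E.card + 2 ^ (b + 6) * A *
      (∑ k ∈ Finset.range K, ((tipPoints E n k (6 * 2 ^ β) q (4 * M) m g j).card : ℝ) +
        (b + 3) * E.card) := by gcongr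
    _ = _ := by ring

/-- Directions that robustly persist as alive but not as flat are rare on average. -/
lemma sum_card_tipPoints_le (E : Finset R2) (n K m g : ℕ) {τ q B : ℕ} {M e : ℝ}
    (hM : 1 ≤ M) (hq : 2 ≤ q) (hB : τ + q + 3 ≤ B) (he0 : 0 < e)
    (he : 96 * e * (3 * M) ^ 3 ≤ (M / (q * B)) ^ 2) :
    ∑ j ∈ Finset.range n, ∑ k ∈ Finset.range K, ((tipPoints E n k τ q M m g j).card : ℝ) ≤
      n * ((1 + 2 ^ g) ^ m * ((2 * B + 3) * M / e)) * E.card := by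
  classical
  have h1 : ∀ k ∈ Finset.range K, ∑ j ∈ Finset.range n, ((tipPoints E n k τ q M m g j).card : ℝ) ≤
      (1 + 2 ^ g) ^ m * ∑ j ∈ Finset.range n,
        ((E.filter fun z => j ∈ aliveDirs E n k M z \ flatDirs E n k τ q M z).card : ℝ) := by
    intro k _
    have swap : ∀ S : R2 → Finset ℕ, (∀ z, S z ⊆ Finset.range n) →
        ∑ j ∈ Finset.range n, ((E.filter fun z => j ∈ S z).card : ℝ) = ∑ z ∈ E, ((S z).card : ℝ) := by
      intro S hS
      simp only [Finset.card_filter, Nat.cast_sum]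
      rw [Finset.sum_comm]
      refine Finset.sum_congr rfl fun z _ => ?_
      rw [← Nat.cast_sum, ← Finset.card_filter]
      congr 2
      ext j
      rw [Finset.mem_filter]
      exact ⟨fun h => h.2, fun h => ⟨hS z h, h⟩⟩
    have hr : ∀ z, aliveDirs E n k M z \ flatDirs E n k τ q M z ⊆ Finset.range n := fun z =>
      Finset.sdiff_subset.trans (aliveDirs_subset_range _ _ _ _ _)
    have hr' : ∀ z, (thick (2 * (1 / 2 ^ g)) n)^[m] (aliveDirs E n k M z) \
        (thick (1 / 2 ^ g) n)^[m] (flatDirs E n k τ q M z) ⊆ Finset.range n := fun z =>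
      Finset.sdiff_subset.trans ((iterate_thick_subset _ _ _ _).trans
        (aliveDirs_subset_range _ _ _ _ _))
    rw [swap _ hr, Finset.mul_sum]
    simp only [tipPoints]
    have e1 := swap _ hr'
    refine le_trans (le_of_eq (by convert e1)) (Finset.sum_le_sum fun z _ => ?_)
    have := card_iterate_thick_sdiff_le (n := n) (c := 1 / 2 ^ g) (by positivity)
      (aliveDirs E n k M z) (flatDirs E n k τ q M z) m
    rwa [one_div_one_div] at this
  rw [Finset.sum_comm]
  refine (Finset.sum_le_sum h1).trans ?_
  rw [← Finset.mul_sum, Finset.sum_comm]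
  have h2 : ∀ j ∈ Finset.range n, ∑ k ∈ Finset.range K,
      ((E.filter fun z => j ∈ aliveDirs E n k M z \ flatDirs E n k τ q M z).card : ℝ) ≤
      (2 * B + 3) * M / e * E.card := by
    intro j _
    have h3 := sum_card_nonflat_le E (prj n j) K (B + 1) (by linarith : 0 ≤ M) he0
    have h4 : (2 * ((B + 1 : ℕ) : ℝ) + 1) = 2 * B + 3 := by push_cast; ring
    rw [h4] at h3
    refine le_trans (Finset.sum_le_sum fun k _ => Nat.cast_le.2 (Finset.card_le_card ?_)) h3
    intro z hz
    rw [Finset.mem_filter] at hz ⊢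
    rw [Finset.mem_sdiff, mem_flatDirs] at hz
    obtain ⟨hzE, hal, hnf⟩ := hz
    have hal' := (mem_aliveDirs.1 hal).2
    refine ⟨hzE, hal' k le_rfl, ?_⟩
    by_contra! hle
    exact hnf ⟨hal, flatThin_of_cellDeficit hM hq hB he0.le he (hal' (k + 1) (by omega))
      (by exact_mod_cast hle)⟩
  have h5 := Finset.sum_le_card_nsmul _ _ _ h2
  rw [Finset.card_range, nsmul_eq_mul] at h5
  calc _ ≤ (1 + 2 ^ g : ℝ) ^ m * (n * ((2 * B + 3) * M / e * E.card)) := by gcongr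
    _ = _ := by ring

/-- If there are many persistent points on average, a short path visits many points. -/
lemma TipParams.exists_short_path {A M : ℝ} {m g γ β b q : ℕ} {W : ℝ}
    (p : TipParams A (4 * M) m g γ β b q W) {D : ℝ} {E : Finset R2} (hE : RegularNet A D E)
    (hD : 0 < D) (hcard : (E.card : ℝ) ≤ A * D) {n : ℕ} (hn : 2 * D ≤ n) {B : ℕ} {e c Λ : ℝ}
    (hB : 6 * 2 ^ β + q + 3 ≤ B) (he0 : 0 < e)
    (he : 96 * e * (3 * (4 * M)) ^ 3 ≤ (4 * M / (q * B)) ^ 2) (hc : 0 < c)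
    (hF : c * (n * D) ≤ ∑ j ∈ Finset.range n, ((persistentPoints E n M m g j).card : ℝ))
    (hΛ : 2 ^ (b + 6) * A * (b + 4 + (1 + 2 ^ g) ^ m * ((2 * B + 3) * (4 * M) / e)) * A + 1 ≤ Λ) :
    ∃ l : List R2, (∀ y ∈ l, y ∈ E) ∧ pathLen l ≤ D ∧
      ∃ F : Finset R2, (∀ y ∈ F, y ∈ l) ∧ c * D / (2 * Λ) < F.card := by
  classical
  have hA := hE.hA
  have hn0 : (0 : ℝ) < n := by linarith
  obtain ⟨K, hK1, hDK, hKD⟩ : ∃ K : ℕ, 1 ≤ K ∧ D ≤ 2 ^ (K + b) ∧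
      ∀ k < K, 1 ≤ k → (2 : ℝ) ^ (k + b) ≤ D := by
    have hex : ∃ K : ℕ, 1 ≤ K ∧ D ≤ 2 ^ (K + b) := by
      obtain ⟨N, hN⟩ := pow_unbounded_of_one_lt D (one_lt_two)
      exact ⟨N + 1, by omega, hN.le.trans (pow_le_pow_right₀ (by norm_num) (by omega))⟩
    refine ⟨Nat.find hex, (Nat.find_spec hex).1, (Nat.find_spec hex).2, fun k hk hk1 => ?_⟩
    have := Nat.find_min hex hk
    push Not at this
    exact (this hk1).le
  obtain ⟨t, ht⟩ : ∃ t : ℕ → ℝ, ∀ j, t j = ∑ k ∈ Finset.range K,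
      ((tipPoints E n k (6 * 2 ^ β) q (4 * M) m g j).card : ℝ) := ⟨_, fun _ => rfl⟩
  have hsum : ∑ j ∈ Finset.range n, t j ≤
      n * ((1 + 2 ^ g) ^ m * ((2 * B + 3) * (4 * M) / e)) * E.card := by
    simp only [ht]
    exact sum_card_tipPoints_le E n K m g p.hM (by have := p.hq; omega) hB he0 he
  set X := (1 + 2 ^ g : ℝ) ^ m * ((2 * B + 3) * (4 * M) / e) with hX
  have hX0 : 0 ≤ X := by have := p.hM; positivity
  have hΛ0 : 0 < Λ := by
    refine lt_of_lt_of_le ?_ hΛ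
    positivity
  obtain ⟨j, hj, hjF⟩ : ∃ j ∈ Finset.range n,
      c * (2 ^ (b + 6) * A * ((b + 4) * E.card + t j) + D) ≤
        Λ * (persistentPoints E n M m g j).card := by
    by_contra! hcon
    have hne : (Finset.range n).Nonempty := by
      rw [Finset.nonempty_range_iff]; rintro rfl; simp at hn0
    have h1 := Finset.sum_lt_sum_of_nonempty hne hcon
    rw [← Finset.mul_sum, ← Finset.mul_sum, Finset.sum_add_distrib, ← Finset.mul_sum,
      Finset.sum_add_distrib] at h1
    simp only [Finset.sum_const, Finset.card_range, nsmul_eq_mul] at h1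
    have h2 : (2 : ℝ) ^ (b + 6) * A * (n * ((b + 4) * E.card) + ∑ j ∈ Finset.range n, t j) + n * D ≤
        Λ * (n * D) := by
      calc _ ≤ (2 : ℝ) ^ (b + 6) * A * (n * ((b + 4) * E.card) + n * X * E.card) + n * D := by gcongr
        _ = n * (2 ^ (b + 6) * A * (b + 4 + X)) * E.card + n * D := by ring
        _ ≤ n * (2 ^ (b + 6) * A * (b + 4 + X)) * (A * D) + n * D := by gcongr
        _ = (2 ^ (b + 6) * A * (b + 4 + X) * A + 1) * (n * D) := by ring
        _ ≤ _ := by gcongr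
    have h3 := mul_le_mul_of_nonneg_left h2 hc.le
    have h4 := mul_le_mul_of_nonneg_left hF hΛ0.le
    linarith
  obtain ⟨l, hl, hlen⟩ := p.exists_path hE (j := j) hn K hK1 hKD hDK
  rw [← ht] at hlen
  set F := persistentPoints E n M m g j with hFdef
  by_contra! hcon
  have h1 := card_filter_mem_list_le hD F (c * D / (2 * Λ)) (by positivity) l (fun p hp hpD => by
    refine hcon p (fun y hy => ?_) hpD _ fun y hy => (Finset.mem_filter.1 hy).2
    have h2 := (hl y).1 (hp.subset hy)
    rw [hFdef, persistentPoints, Finset.mem_filter] at h2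
    exact h2.1)
  rw [Finset.filter_true_of_mem fun y hy => (hl y).2 hy] at h1
  have h2 : c * (pathLen l + D) ≤ Λ * F.card := le_trans (by gcongr) hjF
  have h3 : c * D / (2 * Λ) * (pathLen l / D + 1) = c * (pathLen l + D) / Λ / 2 := by
    field_simp
  rw [h3] at h1
  have h4 : c * (pathLen l + D) / Λ ≤ F.card := by
    rw [div_le_iff₀ hΛ0]; linarith
  have h5 : 0 < c * (pathLen l + D) / Λ := by
    have := pathLen_nonneg l
    positivity
  linarith

/-- The points with a high multiplicity at some scale have small projection. -/
lemma volume_biUnion_notMem_aliveDirs_le (E : Finset R2) {n j : ℕ} (hj : j < n) {M : ℝ}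
    (hM : 0 < M) :
    (volume (⋃ z ∈ {z | z ∈ E ∧ j ∉ aliveDirs E n 1 M z}, closedBall (prj n j z) 3)).toReal ≤
      30 / M * E.card := by
  classical
  set T : Set R2 := {z | z ∈ E ∧ j ∉ aliveDirs E n 1 M z} with hT
  have hTfin : T.Finite := E.finite_toSet.subset fun z hz => hz.1
  have hbad : ∀ z ∈ T, ∃ k : ℕ, M * 2 ^ k < (tubeCount E n j z (2 ^ k) : ℝ) := by
    intro z hz
    have h := hz.2
    rw [mem_aliveDirs] at h
    push Not at h
    obtain ⟨k, -, hk⟩ := h hj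
    exact ⟨k, hk⟩
  choose! κ hκ using hbad
  obtain ⟨R, hR⟩ := (hTfin.image fun z => 3 * (2 : ℝ) ^ κ z).bddAbove
  obtain ⟨u, huT, hud, hu⟩ := Vitali.exists_disjoint_subfamily_covering_enlargement_closedBall T
    (prj n j) (fun z => 3 * 2 ^ κ z) R (fun z hz => hR (mem_image_of_mem _ hz)) 5 (by norm_num)
  have hufin : u.Finite := hTfin.subset huT
  have hsub : (⋃ z ∈ T, closedBall (prj n j z) 3) ⊆
      ⋃ z ∈ hufin.toFinset, closedBall (prj n j z) (5 * (3 * 2 ^ κ z)) := by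
    intro t ht
    obtain ⟨z, hz, htz⟩ := mem_iUnion₂.1 ht
    obtain ⟨w, hw, hzw⟩ := hu z hz
    refine mem_iUnion₂.2 ⟨w, by simpa using hw, hzw (closedBall_subset_closedBall ?_ htz)⟩
    have : (1 : ℝ) ≤ 2 ^ κ z := one_le_pow₀ (by norm_num)
    linarith
  have h1 : volume (⋃ z ∈ T, closedBall (prj n j z) 3) ≤
      ∑ z ∈ hufin.toFinset, ENNReal.ofReal (30 * 2 ^ κ z) := by
    refine (measure_mono hsub).trans ((measure_biUnion_finset_le _ _).trans ?_)
    refine Finset.sum_le_sum fun z _ => ?_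
    rw [Real.volume_closedBall]
    exact ENNReal.ofReal_le_ofReal (by linarith)
  rw [← ENNReal.ofReal_sum_of_nonneg (fun z _ => by positivity)] at h1
  refine (ENNReal.toReal_mono ENNReal.ofReal_ne_top h1).trans ?_
  rw [ENNReal.toReal_ofReal (Finset.sum_nonneg fun z _ => by positivity)]
  have h2 : ∑ z ∈ hufin.toFinset, (tubeCount E n j z (2 ^ κ z) : ℝ) ≤ E.card := by
    rw [← Nat.cast_sum]
    refine Nat.cast_le.2 ?_
    simp only [tubeCount]
    rw [← Finset.card_biUnion]
    · exact Finset.card_le_card (Finset.biUnion_subset.2 fun z _ => Finset.filter_subset _ _)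
    · intro z hz w hw hzw
      refine Finset.disjoint_left.2 fun y hy hy' => ?_
      rw [Finset.mem_filter] at hy hy'
      have hdis := hud (by simpa using hz) (by simpa using hw) hzw
      have hdis' : ∀ a, a ∈ closedBall (prj n j z) (3 * 2 ^ κ z) →
          a ∉ closedBall (prj n j w) (3 * 2 ^ κ w) := fun a ha =>
        Set.disjoint_left.1 hdis ha
      refine hdis' (prj n j y) ?_ ?_
      · simp only [mem_closedBall, Real.dist_eq]
        have : (0 : ℝ) < 2 ^ κ z := by positivity
        linarith [hy.2]
      · simp only [mem_closedBall, Real.dist_eq]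
        have : (0 : ℝ) < 2 ^ κ w := by positivity
        linarith [hy'.2]
  have h3 : ∑ z ∈ hufin.toFinset, 30 * (2 : ℝ) ^ κ z ≤
      ∑ z ∈ hufin.toFinset, 30 / M * (tubeCount E n j z (2 ^ κ z) : ℝ) := by
    refine Finset.sum_le_sum fun z hz => ?_
    have h4 := hκ z (huT (by simpa using hz))
    rw [div_mul_eq_mul_div, le_div_iff₀ hM]
    linarith
  refine h3.trans ?_
  rw [← Finset.mul_sum]
  gcongr

/-- Large projections produce many persistent points. -/
lemma le_sum_card_persistentPoints {E : Finset R2} {n m g : ℕ} {A D M κ : ℝ} (hκ : 0 < κ)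
    (hA : 1 ≤ A) (hD : 0 < D) (hcard : (E.card : ℝ) ≤ A * D) (hM : 60 * A ≤ κ * M)
    (hg : 96 * m * A ≤ κ * 2 ^ g)
    (hproj : κ * (n * D) ≤
      ∑ j ∈ Finset.range n, (volume (⋃ z ∈ E, closedBall (prj n j z) 3)).toReal) :
    κ / 24 * (n * D) ≤ ∑ j ∈ Finset.range n, ((persistentPoints E n M m g j).card : ℝ) := by
  classical
  have hM0 : 0 < M := by
    by_contra! h
    nlinarith
  have h1 : ∀ j ∈ Finset.range n, (volume (⋃ z ∈ E, closedBall (prj n j z) 3)).toReal ≤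
      κ / 2 * D + 6 * ((E.filter fun z => j ∈ aliveDirs E n 1 M z).card : ℝ) := by
    intro j hj
    have h2 := volume_biUnion_notMem_aliveDirs_le E (Finset.mem_range.1 hj) hM0
    have h3 : (⋃ z ∈ E, closedBall (prj n j z) 3) ⊆
        (⋃ z ∈ {z | z ∈ E ∧ j ∉ aliveDirs E n 1 M z}, closedBall (prj n j z) 3) ∪
        ⋃ z ∈ E.filter fun z => j ∈ aliveDirs E n 1 M z, closedBall (prj n j z) 3 := by
      intro t ht
      obtain ⟨z, hz, htz⟩ := mem_iUnion₂.1 ht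
      by_cases h : j ∈ aliveDirs E n 1 M z
      · exact Or.inr (mem_iUnion₂.2 ⟨z, Finset.mem_filter.2 ⟨hz, h⟩, htz⟩)
      · exact Or.inl (mem_iUnion₂.2 ⟨z, ⟨hz, h⟩, htz⟩)
    have hfin1 : volume (⋃ z ∈ {z | z ∈ E ∧ j ∉ aliveDirs E n 1 M z}, closedBall (prj n j z) 3) ≠ ⊤ := by
      have hf : {z | z ∈ E ∧ j ∉ aliveDirs E n 1 M z}.Finite :=
        E.finite_toSet.subset fun z hz => hz.1
      exact ((measure_biUnion_lt_top hf fun z _ =>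
        measure_closedBall_lt_top)).ne
    have h4 : volume (⋃ z ∈ E.filter fun z => j ∈ aliveDirs E n 1 M z, closedBall (prj n j z) 3) ≤
        ENNReal.ofReal (6 * ((E.filter fun z => j ∈ aliveDirs E n 1 M z).card : ℝ)) := by
      refine (measure_biUnion_finset_le _ _).trans (le_of_eq ?_)
      simp only [Real.volume_closedBall, Finset.sum_const, nsmul_eq_mul]
      rw [mul_comm (6 : ℝ), ENNReal.ofReal_mul (Nat.cast_nonneg _), ENNReal.ofReal_natCast,
        show (2 * 3 : ℝ) = 6 by norm_num]
    have h5 := ENNReal.toReal_mono (ENNReal.add_ne_top.2 ⟨hfin1, ENNReal.ofReal_ne_top⟩)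
      (((measure_mono h3).trans (measure_union_le _ _)).trans (add_le_add_right h4 _))
    rw [ENNReal.toReal_add hfin1 ENNReal.ofReal_ne_top, ENNReal.toReal_ofReal (by positivity)] at h5
    have h6 : 30 / M * (E.card : ℝ) ≤ κ / 2 * D := by
      rw [div_mul_eq_mul_div, div_le_iff₀ hM0]
      nlinarith
    linarith
  have h7 := Finset.sum_le_sum h1
  rw [Finset.sum_add_distrib] at h7
  simp only [Finset.sum_const, Finset.card_range, nsmul_eq_mul] at h7
  rw [← Finset.mul_sum] at h7
  have swap : ∀ S : R2 → Finset ℕ, (∀ z, S z ⊆ Finset.range n) →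
      ∑ j ∈ Finset.range n, ((E.filter fun z => j ∈ S z).card : ℝ) = ∑ z ∈ E, ((S z).card : ℝ) := by
    intro S hS
    simp only [Finset.card_filter, Nat.cast_sum]
    rw [Finset.sum_comm]
    refine Finset.sum_congr rfl fun z _ => ?_
    rw [← Nat.cast_sum, ← Finset.card_filter]
    congr 2
    ext j
    rw [Finset.mem_filter]
    exact ⟨fun h => h.2, fun h => ⟨hS z h, h⟩⟩
  have h8 : ∑ z ∈ E, ((aliveDirs E n 1 M z).card : ℝ) ≤
      ∑ z ∈ E, ((((thick (2 * (1 / 2 ^ g)) n)^[m] (aliveDirs E n 1 M z)).card : ℝ) +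
        m * (2 * (2 * (1 / 2 ^ g)) * n)) := Finset.sum_le_sum fun z _ =>
    card_le_card_iterate_thick_add (by positivity) (aliveDirs_subset_range _ _ _ _ _) m
  rw [Finset.sum_add_distrib, ← swap _ fun z => aliveDirs_subset_range _ _ _ _ _, ← swap _ fun z =>
    (iterate_thick_subset _ _ _ _).trans (aliveDirs_subset_range _ _ _ _ _)] at h8
  simp only [Finset.sum_const, nsmul_eq_mul] at h8
  have h9 : (E.card : ℝ) * (m * (2 * (2 * (1 / 2 ^ g)) * n)) ≤ κ / 24 * (n * D) := by
    have h10 : 4 * m * A / 2 ^ g ≤ κ / 24 := by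
      rw [div_le_iff₀ (by positivity)]; linarith
    calc _ ≤ A * D * (m * (2 * (2 * (1 / 2 ^ g)) * n)) := by gcongr
      _ = 4 * m * A / 2 ^ g * (n * D) := by ring
      _ ≤ _ := by gcongr
  have h11 : ∑ j ∈ Finset.range n, ((persistentPoints E n M m g j).card : ℝ) =
      ∑ j ∈ Finset.range n, ((E.filter fun z =>
        j ∈ (thick (2 * (1 / 2 ^ g)) n)^[m] (aliveDirs E n 1 M z)).card : ℝ) := by
    refine Finset.sum_congr rfl fun j _ => ?_
    simp only [persistentPoints]
  rw [h11]
  linarith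

lemma tower_bounds {N T : ℕ} (hN : 8 ≤ N) (hT : T = 2 ^ (4 * N ^ 2)) :
    100 * N ^ 2 ≤ T ∧ (2 * N + 10) * 2 ^ N ≤ T ∧
      N * (2 * 2 ^ ((N + 1) * N) + 3) + N + 2 ≤ T := by
  have h0 : N + 1 ≤ 2 ^ N := Nat.lt_two_pow_self
  refine ⟨?_, ?_, ?_⟩
  · have h1 : 2 * N ^ 2 ≤ 2 ^ (2 * N ^ 2) := Nat.lt_two_pow_self.le
    have h2 : T = 2 ^ (2 * N ^ 2) * 2 ^ (2 * N ^ 2) := by rw [hT, ← pow_add]; ring_nf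
    rw [h2]
    have h3 := Nat.mul_le_mul h1 h1
    nlinarith [Nat.mul_le_mul hN hN]
  · calc (2 * N + 10) * 2 ^ N ≤ 2 ^ 4 * 2 ^ N * 2 ^ N := by gcongr; omega
      _ = 2 ^ (4 + N + N) := by rw [pow_add, pow_add]
      _ ≤ 2 ^ (4 * N ^ 2) := by gcongr; · norm_num
                                · nlinarith
      _ = T := hT.symm
  · have h1 : 1 ≤ 2 ^ ((N + 1) * N) := Nat.one_le_two_pow
    calc N * (2 * 2 ^ ((N + 1) * N) + 3) + N + 2
        ≤ 8 * N * 2 ^ ((N + 1) * N) := by nlinarith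
      _ ≤ 2 ^ 3 * 2 ^ N * 2 ^ ((N + 1) * N) := by gcongr <;> omega
      _ = 2 ^ (3 + N + (N + 1) * N) := by rw [pow_add, pow_add]
      _ ≤ 2 ^ (4 * N ^ 2) := by gcongr; · norm_num
                                · nlinarith
      _ = T := hT.symm

/-- An admissible choice of the parameters. -/
lemma exists_tipParams {A M : ℝ} {N T : ℕ} (hN : 8 ≤ N) (hT : T = 2 ^ (4 * N ^ 2)) (hA : 1 ≤ A)
    (hM : 1 ≤ M) (hAM : 32 * (A * M) < N) :
    TipParams A (4 * M) N (2 * N + 7) T (T ^ 2) (2 * T ^ 2) (2 ^ T) (2 ^ (4 + 2 * T)) := by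
  obtain ⟨hT1, hT2, hT3⟩ := tower_bounds hN hT
  have hNr : (N : ℝ) ≤ 2 ^ N := by exact_mod_cast (Nat.lt_two_pow_self (n := N)).le
  have hT800 : 800 ≤ T := by nlinarith
  have hTN : 100 * N ≤ T := by nlinarith
  have hTT : 100 * N * T ≤ T * T := Nat.mul_le_mul_right T hTN
  have hTT' : 800 * T ≤ T * T := Nat.mul_le_mul_right T hT800
  have e1 : ∀ k : ℕ, (2 * (2 : ℝ) ^ (4 + 2 * T)) ^ k = 2 ^ ((5 + 2 * T) * k) := by
    intro k
    rw [← pow_succ', ← pow_mul]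
    congr 2; omega
  refine ⟨by omega, by linarith, ?_, ?_, by linarith, ?_, ?_, ?_, by linarith, ?_, ?_⟩
  · calc 4 = 2 ^ 2 := rfl
      _ ≤ 2 ^ T := Nat.pow_le_pow_right (by norm_num) (by omega)
  · calc (12 : ℝ) ≤ 2 ^ 4 := by norm_num
      _ ≤ _ := pow_le_pow_right₀ (by norm_num) (by omega)
  · push_cast
    refine le_of_eq ?_
    rw [pow_add, two_mul, pow_add]; norm_num; ring
  · rw [e1]
    push_cast
    calc 8 * (N : ℝ) * 2 ^ T * 2 ^ T * 2 ^ ((5 + 2 * T) * (N + 1))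
        ≤ 2 ^ 3 * 2 ^ N * 2 ^ T * 2 ^ T * 2 ^ ((5 + 2 * T) * (N + 1)) := by gcongr; norm_num
      _ = 2 ^ (3 + N + T + T + (5 + 2 * T) * (N + 1)) := by simp only [← pow_add]
      _ ≤ 2 ^ T ^ 2 := pow_le_pow_right₀ (by norm_num) (by nlinarith)
  · rw [e1]
    push_cast
    calc 2 * (N : ℝ) * 2 ^ ((N + 1) * N) * (4 * 2 ^ T * 2 ^ ((5 + 2 * T) * N) * 2 ^ T)
        ≤ 2 ^ 1 * 2 ^ N * 2 ^ ((N + 1) * N) * (2 ^ 2 * 2 ^ T * 2 ^ ((5 + 2 * T) * N) * 2 ^ T) := by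
          gcongr <;> norm_num
      _ = 2 ^ (1 + N + (N + 1) * N + (2 + T + (5 + 2 * T) * N + T)) := by simp only [← pow_add]
      _ ≤ 2 ^ T ^ 2 := pow_le_pow_right₀ (by norm_num) (by nlinarith)
  · rw [e1]
    calc 2 * ((2 : ℝ) ^ (4 + 2 * T) * (2 ^ T ^ 2 * 2 ^ ((5 + 2 * T) * N)))
        = 2 ^ (1 + (4 + 2 * T + (T ^ 2 + (5 + 2 * T) * N))) := by simp only [pow_add, pow_one]
      _ ≤ 2 ^ (2 * T ^ 2) := pow_le_pow_right₀ (by norm_num) (by nlinarith)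
  · rw [lt_div_iff₀ (by positivity)]
    push_cast
    have h1 : 72 * (A * M) < 2 ^ (N + 2) := by rw [pow_add]; linarith
    calc (2 : ℝ) ^ (N * (2 * 2 ^ ((N + 1) * N) + 3)) * (9 * (4 * M)) * (2 * A)
        = 2 ^ (N * (2 * 2 ^ ((N + 1) * N) + 3)) * (72 * (A * M)) := by ring
      _ < 2 ^ (N * (2 * 2 ^ ((N + 1) * N) + 3)) * 2 ^ (N + 2) := by gcongr
      _ = 2 ^ (N * (2 * 2 ^ ((N + 1) * N) + 3) + (N + 2)) := by rw [← pow_add]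
      _ ≤ 2 ^ T := pow_le_pow_right₀ (by norm_num) (by omega)

lemma path_constant_le {A M B e : ℝ} {N T : ℕ} (hA : 0 ≤ A) (hA2 : A ≤ 2 ^ N) (hM0 : 0 < M)
    (hM2 : M ≤ 2 ^ N) (hB0 : 0 < B) (hB' : B ≤ 2 ^ (T ^ 2 + 4)) (hTN : 100 * N ≤ T)
    (hT800 : 800 ≤ T) (he : e = 1 / (10368 * M * (2 ^ T) ^ 2 * B ^ 2)) :
    2 ^ (2 * T ^ 2 + 6) * A * (((2 * T ^ 2 : ℕ) : ℝ) + 4 +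
      (1 + 2 ^ (2 * N + 7)) ^ N * ((2 * B + 3) * (4 * M) / e)) * A + 1 ≤
      2 ^ (7 * T ^ 2 + 8 + 2 * N) := by
  have hTT : 100 * N * T ≤ T * T := Nat.mul_le_mul_right T hTN
  have hTT' : 800 * T ≤ T * T := Nat.mul_le_mul_right T hT800
  have he0 : 0 < e := by rw [he]; positivity
  have hX : (1 + 2 ^ (2 * N + 7) : ℝ) ^ N * ((2 * B + 3) * (4 * M) / e) ≤ 2 ^ (5 * T ^ 2) := by
    have h1 : (1 + 2 ^ (2 * N + 7) : ℝ) ≤ 2 ^ (2 * N + 8) := by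
      have : (1 : ℝ) ≤ 2 ^ (2 * N + 7) := one_le_pow₀ (by norm_num)
      rw [pow_succ _ (2 * N + 7)]; linarith
    have h2 : (2 * B + 3 : ℝ) ≤ 2 ^ (T ^ 2 + 7) := by
      have h2 : (1 : ℝ) ≤ 2 ^ T ^ 2 := one_le_pow₀ (by norm_num)
      rw [pow_add] at hB' ⊢
      linarith
    have h3 : (2 * B + 3 : ℝ) * (4 * M) / e = 41472 * (2 * B + 3) * M * M * (2 ^ T) ^ 2 * B ^ 2 := by
      rw [he]; field_simp; ring
    rw [h3]
    calc (1 + 2 ^ (2 * N + 7) : ℝ) ^ N *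
          (41472 * (2 * B + 3) * M * M * (2 ^ T) ^ 2 * (B : ℝ) ^ 2)
        ≤ (2 ^ (2 * N + 8)) ^ N * (2 ^ 16 * 2 ^ (T ^ 2 + 7) * 2 ^ N * 2 ^ N * (2 ^ T) ^ 2 *
          (2 ^ (T ^ 2 + 4)) ^ 2) := by gcongr; norm_num
      _ = 2 ^ ((2 * N + 8) * N + (16 + (T ^ 2 + 7) + N + N + T * 2 + (T ^ 2 + 4) * 2)) := by
        simp only [← pow_add, ← pow_mul]
      _ ≤ 2 ^ (5 * T ^ 2) := pow_le_pow_right₀ (by norm_num) (by nlinarith)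
  have hb : (((2 * T ^ 2 : ℕ) : ℝ) + 4) ≤ 2 ^ (5 * T ^ 2) := by
    have : 2 * T ^ 2 + 4 ≤ 5 * T ^ 2 := by nlinarith
    have h2 : 2 * T ^ 2 + 4 ≤ 2 ^ (5 * T ^ 2) := this.trans Nat.lt_two_pow_self.le
    calc (((2 * T ^ 2 : ℕ) : ℝ) + 4) = ((2 * T ^ 2 + 4 : ℕ) : ℝ) := by push_cast; ring
      _ ≤ ((2 ^ (5 * T ^ 2) : ℕ) : ℝ) := Nat.cast_le.2 h2
      _ = 2 ^ (5 * T ^ 2) := by push_cast; rfl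
  have h1 : (1 : ℝ) ≤ 2 ^ (7 * T ^ 2 + 7 + 2 * N) := one_le_pow₀ (by norm_num)
  calc _ ≤ (2 : ℝ) ^ (2 * T ^ 2 + 6) * 2 ^ N * (2 ^ (5 * T ^ 2) + 2 ^ (5 * T ^ 2)) * 2 ^ N +
        2 ^ (7 * T ^ 2 + 7 + 2 * N) := by
        have : 0 ≤ (1 + 2 ^ (2 * N + 7) : ℝ) ^ N * ((2 * B + 3) * (4 * M) / e) := by positivity
        gcongr
    _ = 2 ^ (7 * T ^ 2 + 8 + 2 * N) := by
        have e5 : (2 : ℝ) ^ (5 * T ^ 2) + 2 ^ (5 * T ^ 2) = 2 ^ (5 * T ^ 2 + 1) := by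
          rw [pow_succ]; ring
        rw [e5]
        simp only [← pow_add]
        have e6 : 2 * T ^ 2 + 6 + N + (5 * T ^ 2 + 1) + N = 7 * T ^ 2 + 7 + 2 * N := by ring
        rw [e6, ← mul_two, ← pow_succ]
        congr 1; ring

lemma path_card_le {D κ Λ : ℝ} {N T : ℕ} (hD : 0 < D) (hκ : 0 < κ) (hκN : 1 ≤ κ * 2 ^ N)
    (hΛ0 : 0 < Λ) (hΛ1 : Λ ≤ 2 ^ (7 * T ^ 2 + 8 + 2 * N)) (hTN : 100 * N ≤ T) (hT800 : 800 ≤ T) :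
    D / 2 ^ (8 * T ^ 2) ≤ κ / 24 * D / (2 * Λ) := by
  have hTT : 100 * N * T ≤ T * T := Nat.mul_le_mul_right T hTN
  have hTT' : 800 * T ≤ T * T := Nat.mul_le_mul_right T hT800
  rw [div_le_div_iff₀ (by positivity) (by positivity)]
  calc D * (2 * Λ) ≤ D * (2 * 2 ^ (7 * T ^ 2 + 8 + 2 * N)) * (κ * 2 ^ N) := by
        have : D * (2 * Λ) ≤ D * (2 * 2 ^ (7 * T ^ 2 + 8 + 2 * N)) := by gcongr
        refine this.trans (le_mul_of_one_le_right (by positivity) hκN)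
    _ = κ * D * 2 ^ (7 * T ^ 2 + 9 + 3 * N) := by
        have : 7 * T ^ 2 + 9 + 3 * N = (7 * T ^ 2 + 8 + 2 * N) + 1 + N := by ring
        rw [this, pow_add, pow_add]; ring
    _ ≤ κ * D * (2 ^ (8 * T ^ 2) / 24) := by
        gcongr
        rw [le_div_iff₀ (by norm_num)]
        calc (2 : ℝ) ^ (7 * T ^ 2 + 9 + 3 * N) * 24 ≤ 2 ^ (7 * T ^ 2 + 9 + 3 * N) * 2 ^ 5 := by
              gcongr; norm_num
          _ = 2 ^ (7 * T ^ 2 + 9 + 3 * N + 5) := by rw [← pow_add]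
          _ ≤ _ := pow_le_pow_right₀ (by norm_num) (by nlinarith)
    _ = κ / 24 * D * 2 ^ (8 * T ^ 2) := by ring

/-- A finite regular set with large projections has many points on a short path. -/
theorem RegularNet.exists_short_path {A D κ : ℝ} {E : Finset R2} (hE : RegularNet A D E)
    (hD : 0 < D) (hcard : (E.card : ℝ) ≤ A * D) (hκ : 0 < κ) (hκ1 : κ ≤ 1) {N : ℕ}
    (hN : 2000 * A ^ 2 < κ * N) {n : ℕ} (hn : 2 * D ≤ n)
    (hproj : κ * (n * D) ≤
      ∑ j ∈ Finset.range n, (volume (⋃ z ∈ E, closedBall (prj n j z) 3)).toReal) :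
    ∃ l : List R2, (∀ y ∈ l, y ∈ E) ∧ pathLen l ≤ D ∧
      ∃ F : Finset R2, (∀ y ∈ F, y ∈ l) ∧ D / 2 ^ (8 * (2 ^ (4 * N ^ 2)) ^ 2) < (F.card : ℝ) := by
  have hA := hE.hA
  obtain ⟨T, hT⟩ : ∃ T, T = 2 ^ (4 * N ^ 2) := ⟨_, rfl⟩
  rw [← hT]
  have hAA : A ≤ A ^ 2 := by nlinarith
  have hN0 : (0 : ℝ) ≤ N := Nat.cast_nonneg N
  have hN' : 2000 * A ^ 2 < N := by nlinarith
  have hN8 : 8 ≤ N := by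
    have : (8 : ℝ) ≤ N := by nlinarith
    exact_mod_cast this
  obtain ⟨hT1, hT2, hT3⟩ := tower_bounds hN8 hT
  have hT800 : 800 ≤ T := by nlinarith
  have hTN : 100 * N ≤ T := by nlinarith
  have hTT : 100 * N * T ≤ T * T := Nat.mul_le_mul_right T hTN
  have hTT' : 800 * T ≤ T * T := Nat.mul_le_mul_right T hT800
  have hNr : (N : ℝ) ≤ 2 ^ N := by exact_mod_cast (Nat.lt_two_pow_self (n := N)).le
  obtain ⟨M, hMdef⟩ : ∃ M, M = 60 * A / κ := ⟨_, rfl⟩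
  have hκM : κ * M = 60 * A := by rw [hMdef]; field_simp
  have hM1 : 1 ≤ M := by nlinarith
  have hAM : 32 * (A * M) < N := by
    have : κ * (32 * (A * M)) < κ * N := by
      calc κ * (32 * (A * M)) = 32 * A * (κ * M) := by ring
        _ = 1920 * A ^ 2 := by rw [hκM]; ring
        _ < κ * N := by nlinarith
    exact lt_of_mul_lt_mul_left this hκ.le
  have hp := exists_tipParams hN8 hT hA hM1 hAM
  have hANκ : A ≤ κ * N := by nlinarith
  have hF := le_sum_card_persistentPoints (m := N) (g := 2 * N + 7) (M := M) hκ hA hD hcard hκM.ge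
    (by
      calc 96 * (N : ℝ) * A ≤ 2 ^ 7 * 2 ^ N * (κ * 2 ^ N) := by
            have : A ≤ κ * 2 ^ N := hANκ.trans (by gcongr)
            gcongr; norm_num
        _ = κ * 2 ^ (2 * N + 7) := by ring)
    hproj
  obtain ⟨B, hB⟩ : ∃ B : ℕ, B = 6 * 2 ^ T ^ 2 + 2 ^ T + 3 := ⟨_, rfl⟩
  have hTle : T ≤ T ^ 2 := by nlinarith
  have hB' : (B : ℝ) ≤ 2 ^ (T ^ 2 + 4) := by
    have h1 : (2 : ℝ) ^ T ≤ 2 ^ T ^ 2 := pow_le_pow_right₀ (by norm_num) hTle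
    have h2 : (1 : ℝ) ≤ 2 ^ T ^ 2 := one_le_pow₀ (by norm_num)
    rw [hB, pow_add]; push_cast
    linarith
  have hB0 : (0 : ℝ) < B := by rw [hB]; positivity
  have hM0 : 0 < M := by linarith
  obtain ⟨e, he⟩ : ∃ e : ℝ, e = 1 / (10368 * M * (2 ^ T) ^ 2 * B ^ 2) := ⟨_, rfl⟩
  have he0 : 0 < e := by rw [he]; positivity
  have hMN : M ≤ N := by nlinarith
  have hAN : A ≤ N := by nlinarith
  have hΛ1 := path_constant_le (A := A) (by linarith) (hAN.trans hNr) hM0 (hMN.trans hNr) hB0 hB'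
    hTN hT800 he
  obtain ⟨l, hl, hlD, F, hFl, hF'⟩ := hp.exists_short_path hE hD hcard hn (B := B) (e := e)
    (c := κ / 24) hB.ge he0
    (by
      rw [he]
      push_cast
      refine le_of_eq ?_
      field_simp
      ring)
    (by positivity) hF le_rfl
  refine ⟨l, hl, hlD, F, hFl, lt_of_le_of_lt ?_ hF'⟩
  have hκN : 1 ≤ κ * 2 ^ N := by
    have : κ * N ≤ κ * 2 ^ N := by gcongr
    nlinarith
  exact path_card_le hD hκ hκN (by positivity) hΛ1 hTN hT800

lemma IsCompact.exists_separated_net {S : Set R2} (hS : IsCompact S) {r η : ℝ} (hr : 0 ≤ r)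
    (hη : 0 < η) : ∃ P : Finset R2, (∀ p ∈ P, p ∈ S) ∧
      (∀ x ∈ P, ∀ y ∈ P, x ≠ y → r < ‖x - y‖) ∧ ∀ y ∈ S, ∃ p ∈ P, ‖y - p‖ < r + η := by
  obtain ⟨t, htS, htf, htc⟩ := hS.finite_cover_balls hη
  obtain ⟨P, φ, hPt, hsep, hφ⟩ := exists_net htf.toFinset hr
  refine ⟨P, fun p hp => htS (htf.mem_toFinset.1 (hPt hp)), hsep, fun y hy => ?_⟩
  obtain ⟨x, hx, hyx⟩ := mem_iUnion₂.1 (htc hy)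
  obtain ⟨h1, h2⟩ := hφ x (htf.mem_toFinset.2 hx)
  refine ⟨φ x, h1, ?_⟩
  rw [mem_ball, dist_eq_norm] at hyx
  have := norm_sub_le_norm_sub_add_norm_sub y x (φ x)
  linarith

lemma ediam_eq_ofReal_diam {S : Set R2} (hS : IsCompact S) : ediam S = ENNReal.ofReal (diam S) := by
  rw [diam, ENNReal.ofReal_toReal hS.isBounded.ediam_ne_top]

lemma AhlforsRegular.le_measure {A : ℝ} {E : Set R2} (hE : AhlforsRegular A E) (hc : IsCompact E)
    {x : R2} (hx : x ∈ E) {r : ℝ} (hr : 0 < r) (hrd : r < diam E) :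
    ENNReal.ofReal (A⁻¹ * r) ≤ μH[1] (E ∩ ball x r) := by
  refine (hE.2 x hx r hr ?_).1
  change _ < ediam E
  rw [ediam_eq_ofReal_diam hc]
  exact (ENNReal.ofReal_lt_ofReal_iff (hr.trans hrd)).2 hrd

lemma AhlforsRegular.measure_le_of_lt {A : ℝ} {E : Set R2} (hE : AhlforsRegular A E)
    (hc : IsCompact E) {x : R2} (hx : x ∈ E) {r : ℝ} (hr : 0 < r) (hrd : r < diam E) :
    μH[1] (E ∩ ball x r) ≤ ENNReal.ofReal (A * r) := by
  refine (hE.2 x hx r hr ?_).2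
  change _ < ediam E
  rw [ediam_eq_ofReal_diam hc]
  exact (ENNReal.ofReal_lt_ofReal_iff (hr.trans hrd)).2 hrd

lemma AhlforsRegular.measure_le {A : ℝ} (hA : 1 ≤ A) {E : Set R2} (hE : AhlforsRegular A E)
    (hc : IsCompact E) (hd : 0 < diam E) : μH[1] E ≤ ENNReal.ofReal (25 * A * diam E) := by
  obtain ⟨d, hdd⟩ : ∃ d, d = diam E := ⟨_, rfl⟩
  rw [← hdd] at hd ⊢
  obtain ⟨P, hPE, hsep, hcov⟩ := hc.exists_separated_net (r := d / 2) (η := d / 4)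
    (by positivity) (by positivity)
  rcases P.eq_empty_or_nonempty with rfl | ⟨p₀, hp₀⟩
  · have : E = ∅ := eq_empty_of_forall_notMem fun y hy => by simpa using hcov y hy
    simp [this]
  have hcard : P.card ≤ 25 := by
    classical
    have hinj : Function.Injective fun p : R2 => (2 / d) • (p - p₀) := by
      intro p q h
      simpa [sub_left_inj, hd.ne'] using h
    have := Besicovitch.card_le_of_separated (P.image fun p => (2 / d) • (p - p₀))
      (fun c hc' => by
        obtain ⟨p, hp, rfl⟩ := Finset.mem_image.1 hc'
        rw [norm_smul, Real.norm_of_nonneg (by positivity)]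
        have : ‖p - p₀‖ ≤ d := by
          rw [← dist_eq_norm, hdd]; exact dist_le_diam_of_mem hc.isBounded (hPE p hp) (hPE _ hp₀)
        calc 2 / d * ‖p - p₀‖ ≤ 2 / d * d := by gcongr
          _ = 2 := by field_simp)
      (fun c hc' c' hc'' hne => by
        obtain ⟨p, hp, rfl⟩ := Finset.mem_image.1 hc'
        obtain ⟨q, hq, rfl⟩ := Finset.mem_image.1 hc''
        have hpq : p ≠ q := fun h => hne (by rw [h])
        have h1 := hsep p hp q hq hpq
        rw [← smul_sub, norm_smul, Real.norm_of_nonneg (by positivity), sub_sub_sub_cancel_right]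
        calc (1 : ℝ) = 2 / d * (d / 2) := by field_simp
          _ ≤ 2 / d * ‖p - q‖ := by gcongr)
    rw [Finset.card_image_of_injective _ hinj] at this
    simpa using this
  have hsub : E ⊆ ⋃ p ∈ P, E ∩ ball p (3 * d / 4) := by
    intro y hy
    obtain ⟨p, hp, hyp⟩ := hcov y hy
    refine mem_iUnion₂.2 ⟨p, hp, hy, ?_⟩
    rw [mem_ball, dist_eq_norm]; linarith
  calc μH[1] E ≤ ∑ p ∈ P, μH[1] (E ∩ ball p (3 * d / 4)) :=
        (measure_mono hsub).trans (measure_biUnion_finset_le _ _)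
    _ ≤ ∑ _p ∈ P, ENNReal.ofReal (A * d) := by
        refine Finset.sum_le_sum fun p hp => ?_
        refine (hE.measure_le_of_lt hc (hPE p hp) (by positivity) (by linarith)).trans ?_
        gcongr; linarith
    _ = (P.card : ℝ≥0∞) * ENNReal.ofReal (A * d) := by simp
    _ ≤ ((25 : ℕ) : ℝ≥0∞) * ENNReal.ofReal (A * d) := by gcongr
    _ = ENNReal.ofReal (25 * A * d) := by
        rw [← ENNReal.ofReal_natCast, ← ENNReal.ofReal_mul (by positivity)]
        congr 1; push_cast; ring

lemma AhlforsRegular.measure_inter_ball_le {A : ℝ} (hA : 1 ≤ A) {E : Set R2}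
    (hE : AhlforsRegular A E) (hc : IsCompact E) (hd : 0 < diam E) {x : R2} (hx : x ∈ E) {r : ℝ}
    (hr : 0 < r) : μH[1] (E ∩ ball x r) ≤ ENNReal.ofReal (25 * A * r) := by
  rcases lt_or_ge r (diam E) with h | h
  · refine (hE.measure_le_of_lt hc hx hr h).trans ?_
    gcongr; linarith
  · refine (measure_mono inter_subset_left).trans ((hE.measure_le hA hc hd).trans ?_)
    gcongr

/-- On a regular set, the Hausdorff measure is comparable to the Hausdorff content. -/
lemma AhlforsRegular.measure_le_hContent {A : ℝ} (hA : 1 ≤ A) {E : Set R2}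
    (hE : AhlforsRegular A E) (hc : IsCompact E) (hd : 0 < diam E) {T : Set R2} (hT : T ⊆ E) :
    μH[1] T ≤ ENNReal.ofReal (50 * A) * hContent T := by
  have key : ∀ U : Set R2, μH[1] (E ∩ U) ≤ ENNReal.ofReal (50 * A) * ediam U := by
    intro U
    rcases (E ∩ U).eq_empty_or_nonempty with h | ⟨x, hx⟩
    · simp [h]
    rcases eq_or_ne (ediam U) ⊤ with h | h
    · rw [h, ENNReal.mul_top (by simp; linarith)]; exact le_top
    rcases eq_or_ne (ediam U) 0 with h0 | h0
    · have : (E ∩ U).Subsingleton := (ediam_eq_zero_iff.1 h0).anti inter_subset_right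
      have := Measure.nullSingletonClass_hausdorff (X := R2) (d := 1) (by norm_num)
      rw [Set.Subsingleton.measure_zero ‹(E ∩ U).Subsingleton›]
      exact zero_le
    obtain ⟨e, he⟩ : ∃ e, e = (ediam U).toReal := ⟨_, rfl⟩
    have he0 : 0 < e := he ▸ ENNReal.toReal_pos h0 h
    have hUe : ediam U = ENNReal.ofReal e := by rw [he, ENNReal.ofReal_toReal h]
    calc μH[1] (E ∩ U) ≤ μH[1] (E ∩ ball x (2 * e)) := by
          refine measure_mono fun y hy => ⟨hy.1, ?_⟩
          have : edist y x ≤ ENNReal.ofReal e := hUe ▸ edist_le_ediam_of_mem hy.2 hx.2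
          rw [edist_dist, ENNReal.ofReal_le_ofReal_iff he0.le] at this
          rw [mem_ball]; linarith
      _ ≤ ENNReal.ofReal (25 * A * (2 * e)) :=
          hE.measure_inter_ball_le hA hc hd hx.1 (by positivity)
      _ = ENNReal.ofReal (50 * A) * ediam U := by
          rw [hUe, ← ENNReal.ofReal_mul (by positivity)]; congr 1; ring
  have h50 : ENNReal.ofReal (50 * A) ≠ 0 := by simp; linarith
  rw [hContent]
  simp only [ENNReal.mul_iInf_of_ne h50 ENNReal.ofReal_ne_top]
  refine le_iInf₂ fun t ht => ?_
  calc μH[1] T ≤ μH[1] (⋃ n, E ∩ t n) := by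
        refine measure_mono fun y hy => ?_
        obtain ⟨n, hn⟩ := mem_iUnion.1 (ht hy)
        exact mem_iUnion.2 ⟨n, hT hy, hn⟩
    _ ≤ ∑' n, μH[1] (E ∩ t n) := measure_iUnion_le _
    _ ≤ ∑' n, ENNReal.ofReal (50 * A) * ediam (t n) := ENNReal.tsum_le_tsum fun n => key _
    _ = _ := ENNReal.tsum_mul_left

/-- The measure of a regular set near a separated family of its points. -/
lemma AhlforsRegular.card_mul_le_measure {A : ℝ} {E : Set R2} (hE : AhlforsRegular A E)
    (hc : IsCompact E) {r : ℝ} (hr : 0 < r) (hrd : r < diam E) {P : Finset R2}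
    (hP : ∀ p ∈ P, p ∈ E) (hsep : ∀ x ∈ P, ∀ y ∈ P, x ≠ y → 2 * r < ‖x - y‖) :
    ENNReal.ofReal (P.card * (A⁻¹ * r)) ≤ μH[1] (⋃ p ∈ P, E ∩ ball p r) := by
  rw [measure_biUnion_finset]
  · calc ENNReal.ofReal (P.card * (A⁻¹ * r)) = ∑ _p ∈ P, ENNReal.ofReal (A⁻¹ * r) := by
          rw [ENNReal.ofReal_mul (by positivity)]; simp
      _ ≤ _ := Finset.sum_le_sum fun p hp => hE.le_measure hc (hP p hp) hr hrd
  · intro x hx y hy hxy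
    refine Set.disjoint_left.2 fun z hz hz' => ?_
    have h1 := hsep x hx y hy hxy
    have h2 := dist_triangle_left x y z
    have h3 := hz.2
    have h4 := hz'.2
    rw [mem_ball] at h3 h4
    rw [← dist_eq_norm] at h1
    linarith
  · exact fun p _ => hE.1.measurableSet.inter measurableSet_ball

lemma AhlforsRegular.exists_regularNet {A : ℝ} (hA : 1 ≤ A) {E : Set R2} (hE : AhlforsRegular A E)
    (hc : IsCompact E) {δ : ℝ} (hδ : 0 < δ) (hδd : δ < diam E) : ∃ P : Finset R2,
      (∀ p ∈ P, p ∈ E) ∧ (∀ x ∈ P, ∀ y ∈ P, x ≠ y → δ / 2 < ‖x - y‖) ∧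
      (∀ y ∈ E, ∃ p ∈ P, ‖y - p‖ ≤ δ) ∧
      RegularNet (100 * A ^ 2) (diam E / δ) (P.image fun p => δ⁻¹ • p) ∧
      (P.card : ℝ) ≤ 100 * A ^ 2 * (diam E / δ) := by
  have hd : 0 < diam E := hδ.trans hδd
  have hA0 : 0 < A := by linarith
  obtain ⟨P, hPE, hsep, hcov⟩ := hc.exists_separated_net (r := δ / 2) (η := δ / 2)
    (by positivity) (by positivity)
  have hcov' : ∀ y ∈ E, ∃ p ∈ P, ‖y - p‖ ≤ δ := fun y hy => by
    obtain ⟨p, hp, h⟩ := hcov y hy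
    exact ⟨p, hp, by linarith⟩
  have hinj : Function.Injective fun p : R2 => δ⁻¹ • p := by
    intro p q h
    simpa [hδ.ne'] using h
  have hnorm : ∀ p q : R2, ‖δ⁻¹ • p - δ⁻¹ • q‖ = ‖p - q‖ / δ := fun p q => by
    rw [← smul_sub, norm_smul, Real.norm_of_nonneg (by positivity)]; ring
  refine ⟨P, hPE, hsep, hcov', ⟨by nlinarith, ?_, ?_⟩, ?_⟩
  · simp only [Finset.mem_image]
    rintro _ ⟨p, hp, rfl⟩ _ ⟨q, hq, rfl⟩
    rw [hnorm, ← dist_eq_norm]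
    gcongr
    exact dist_le_diam_of_mem hc.isBounded (hPE p hp) (hPE q hq)
  · simp only [Finset.mem_image]
    rintro _ ⟨z, hz, rfl⟩ r hr hrD
    obtain ⟨G, hG⟩ : ∃ G, G = P.filter fun p => ‖p - z‖ ≤ r * δ := ⟨_, rfl⟩
    have hcardG : ((P.image fun p => δ⁻¹ • p).filter fun y => ‖y - δ⁻¹ • z‖ ≤ r).card = G.card := by
      rw [← Finset.card_image_of_injective G hinj]
      congr 1
      ext y
      simp only [hG, Finset.mem_filter, Finset.mem_image]
      constructor
      · rintro ⟨⟨p, hp, rfl⟩, h⟩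
        rw [hnorm, div_le_iff₀ hδ] at h
        exact ⟨p, ⟨hp, h⟩, rfl⟩
      · rintro ⟨p, ⟨hp, h⟩, rfl⟩
        exact ⟨⟨p, hp, rfl⟩, by rwa [hnorm, div_le_iff₀ hδ]⟩
    rw [hcardG, div_le_iff₀ (by positivity)]
    have hrδ : r * δ ≤ diam E := by rwa [le_div_iff₀ hδ] at hrD
    rcases le_or_gt r 2 with hr2 | hr2
    · have h1 : 1 ≤ G.card := Finset.card_pos.2 ⟨z, by
        rw [hG, Finset.mem_filter]; exact ⟨hz, by simp; positivity⟩⟩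
      have h2 : (1 : ℝ) ≤ G.card := by exact_mod_cast h1
      nlinarith
    have hsub : E ∩ ball z (r * δ / 2) ⊆ ⋃ p ∈ G, E ∩ ball p (2 * δ) := by
      rintro y ⟨hy, hyz⟩
      obtain ⟨p, hp, hyp⟩ := hcov' y hy
      rw [mem_ball, dist_eq_norm] at hyz
      refine mem_iUnion₂.2 ⟨p, ?_, hy, by rw [mem_ball, dist_eq_norm]; linarith⟩
      rw [hG, Finset.mem_filter]
      refine ⟨hp, ?_⟩
      have h1 := norm_sub_le_norm_sub_add_norm_sub p y z
      rw [norm_sub_rev p y] at h1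
      nlinarith
    have h1 : ENNReal.ofReal (A⁻¹ * (r * δ / 2)) ≤ ENNReal.ofReal (G.card * (25 * A * (2 * δ))) := by
      calc _ ≤ μH[1] (E ∩ ball z (r * δ / 2)) :=
            hE.le_measure hc (hPE z hz) (by positivity) (by linarith)
        _ ≤ ∑ p ∈ G, μH[1] (E ∩ ball p (2 * δ)) :=
            (measure_mono hsub).trans (measure_biUnion_finset_le _ _)
        _ ≤ ∑ _p ∈ G, ENNReal.ofReal (25 * A * (2 * δ)) := Finset.sum_le_sum fun p hp =>
            hE.measure_inter_ball_le hA hc hd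
              (hPE p (by rw [hG] at hp; exact (Finset.mem_filter.1 hp).1)) (by positivity)
        _ = _ := by
            rw [Finset.sum_const, nsmul_eq_mul, ENNReal.ofReal_mul (Nat.cast_nonneg G.card),
              ENNReal.ofReal_natCast]
    rw [ENNReal.ofReal_le_ofReal_iff (by positivity)] at h1
    have h2 : A⁻¹ * (r * δ / 2) = r * δ / (2 * A) := by field_simp
    rw [h2, div_le_iff₀ (by positivity)] at h1
    have h3 : r * δ ≤ (G.card * (100 * A ^ 2)) * δ := by linarith
    exact le_of_mul_le_mul_right h3 hδ
  · have h1 := (hE.card_mul_le_measure hc (r := δ / 4) (by positivity) (by linarith) hPE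
      (fun x hx y hy hxy => by linarith [hsep x hx y hy hxy])).trans
      ((measure_mono (iUnion₂_subset fun p _ => inter_subset_left)).trans (hE.measure_le hA hc hd))
    rw [ENNReal.ofReal_le_ofReal_iff (by positivity)] at h1
    have h2 : (P.card : ℝ) * (A⁻¹ * (δ / 4)) = P.card * δ / (4 * A) := by field_simp
    rw [h2, div_le_iff₀ (by positivity)] at h1
    have h3 : 100 * A ^ 2 * (diam E / δ) = (100 * A ^ 2 * diam E) / δ := by ring
    rw [h3, le_div_iff₀ hδ]
    linarith

lemma Fav_cthickening_le {E : Set R2} (hc : IsCompact E) {δ : ℝ} (hδ : 0 ≤ δ) (hδd : δ ≤ diam E) :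
    Fav (cthickening δ E) ≤ ENNReal.ofReal (4 * diam E) := by
  rcases E.eq_empty_or_nonempty with rfl | ⟨x, hx⟩
  · simp [Fav]
  have hsub : ∀ θ, proj θ '' cthickening δ E ⊆
      Icc (proj θ x - 2 * diam E) (proj θ x + 2 * diam E) := by
    rintro θ _ ⟨y, hy, rfl⟩
    rw [hc.cthickening_eq_biUnion_closedBall hδ] at hy
    obtain ⟨z, hz, hyz⟩ := mem_iUnion₂.1 hy
    rw [mem_closedBall] at hyz
    have h1 := dist_le_diam_of_mem hc.isBounded hz hx
    have h2 := dist_triangle y z x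
    have h3 := abs_proj_le θ (y - x)
    rw [proj_sub, ← dist_eq_norm, abs_le] at h3
    constructor <;> linarith [h3.1, h3.2]
  calc Fav (cthickening δ E) ≤ ∫⁻ _θ in Icc (0 : ℝ) 1, ENNReal.ofReal (4 * diam E) := by
        refine lintegral_mono fun θ => ?_
        rw [hausdorffMeasure_real]
        refine (measure_mono (hsub θ)).trans ?_
        rw [Real.volume_Icc]
        gcongr; linarith
    _ = _ := by simp

lemma abs_proj_sub_proj_le (θ θ' : ℝ) (x : R2) :
    |proj θ x - proj θ' x| ≤ 4 * Real.pi * |θ - θ'| * ‖x‖ := by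
  have h0 : |x 0| ≤ ‖x‖ := by
    have := norm_sq_R2 x
    exact abs_le_of_sq_le_sq (by nlinarith [sq_nonneg (x 1)]) (norm_nonneg x)
  have h1 : |x 1| ≤ ‖x‖ := by
    have := norm_sq_R2 x
    exact abs_le_of_sq_le_sq (by nlinarith [sq_nonneg (x 0)]) (norm_nonneg x)
  have hpi : |2 * Real.pi * θ - 2 * Real.pi * θ'| = 2 * Real.pi * |θ - θ'| := by
    rw [← mul_sub, abs_mul, abs_of_pos (by positivity)]
  have hcos := Real.abs_cos_sub_cos_le (2 * Real.pi * θ) (2 * Real.pi * θ')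
  have hsin := Real.abs_sin_sub_sin_le (2 * Real.pi * θ) (2 * Real.pi * θ')
  rw [hpi] at hcos hsin
  have e : proj θ x - proj θ' x =
      x 0 * (Real.cos (2 * Real.pi * θ) - Real.cos (2 * Real.pi * θ')) +
      x 1 * (Real.sin (2 * Real.pi * θ) - Real.sin (2 * Real.pi * θ')) := by
    simp only [proj]; ring
  rw [e]
  refine (abs_add_le _ _).trans ?_
  rw [abs_mul, abs_mul]
  calc _ ≤ ‖x‖ * (2 * Real.pi * |θ - θ'|) + ‖x‖ * (2 * Real.pi * |θ - θ'|) := by gcongr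
    _ = _ := by ring

open scoped Pointwise in
/-- The Favard length of a neighbourhood is controlled by discretised projections of a net. -/
lemma exists_Fav_cthickening_le_sum {E : Set R2} (hc : IsCompact E) {δ : ℝ} (hδ : 0 < δ)
    {P : Finset R2} (hP : ∀ y ∈ E, ∃ p ∈ P, ‖y - p‖ ≤ δ) (n₀ : ℕ) : ∃ n : ℕ, n₀ ≤ n ∧ 0 < n ∧
      Fav (cthickening δ E) ≤ ENNReal.ofReal (δ / n * ∑ j ∈ Finset.range n,
        (volume (⋃ z ∈ P.image fun p => δ⁻¹ • p, closedBall (prj n j z) 3)).toReal) := by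
  obtain ⟨R, hR⟩ : ∃ R, ∀ p ∈ P, ‖p‖ ≤ R := ⟨∑ p ∈ P, ‖p‖, fun p hp =>
    Finset.single_le_sum (f := fun p : R2 => ‖p‖) (fun _ _ => norm_nonneg _) hp⟩
  obtain ⟨n, hn⟩ := exists_nat_ge (max (n₀ : ℝ) (max 1 (4 * Real.pi * R / δ)))
  have hn0 : n₀ ≤ n := by exact_mod_cast (le_max_left _ _).trans hn
  have hn1 : (1 : ℝ) ≤ n := (le_max_left _ _).trans ((le_max_right _ _).trans hn)
  have hn2 : 4 * Real.pi * R / δ ≤ n := (le_max_right _ _).trans ((le_max_right _ _).trans hn)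
  have hnpos : (0 : ℝ) < n := by linarith
  refine ⟨n, hn0, by exact_mod_cast hnpos, ?_⟩
  obtain ⟨S, hS⟩ : ∃ S : ℕ → Set ℝ, ∀ j, S j = ⋃ z ∈ P.image fun p => δ⁻¹ • p,
    closedBall (prj n j z) 3 := ⟨_, fun _ => rfl⟩
  simp only [← hS]
  have hSfin : ∀ j, volume (S j) ≠ ⊤ := fun j => by
    rw [hS]
    refine ne_of_lt ((measure_biUnion_finset_le _ _).trans_lt ?_)
    exact ENNReal.sum_lt_top.2 fun z _ => measure_closedBall_lt_top
  have hsub : ∀ j : ℕ, ∀ θ ∈ Icc ((j : ℝ) / n) ((j + 1) / n),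
      proj θ '' cthickening δ E ⊆ δ • S j := by
    rintro j θ ⟨hθ1, hθ2⟩ _ ⟨y, hy, rfl⟩
    rw [hc.cthickening_eq_biUnion_closedBall hδ.le] at hy
    obtain ⟨z, hz, hyz⟩ := mem_iUnion₂.1 hy
    obtain ⟨p, hp, hzp⟩ := hP z hz
    rw [mem_closedBall, dist_eq_norm] at hyz
    rw [mem_smul_set_iff_inv_smul_mem₀ hδ.ne', hS]
    refine mem_iUnion₂.2 ⟨δ⁻¹ • p, Finset.mem_image_of_mem _ hp, ?_⟩
    have h1 : |proj θ y - proj θ p| ≤ 2 * δ := by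
      rw [← proj_sub]
      refine (abs_proj_le _ _).trans ?_
      have := norm_sub_le_norm_sub_add_norm_sub y z p
      linarith
    have h2 : |proj θ p - proj ((j : ℝ) / n) p| ≤ δ := by
      refine (abs_proj_sub_proj_le _ _ _).trans ?_
      have h3 : |θ - j / n| ≤ 1 / n := by
        rw [abs_of_nonneg (by linarith)]
        have : ((j : ℝ) + 1) / n = j / n + 1 / n := by ring
        linarith
      rw [div_le_iff₀ hδ] at hn2
      calc 4 * Real.pi * |θ - j / n| * ‖p‖ ≤ 4 * Real.pi * (1 / n) * R := by
            have := Real.pi_pos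
            gcongr
            exact hR p hp
        _ = 4 * Real.pi * R / n := by ring
        _ ≤ δ := by rw [div_le_iff₀ hnpos]; linarith
    have h4 : prj n j (δ⁻¹ • p) = δ⁻¹ * proj ((j : ℝ) / n) p := by
      simp [prj, proj]; ring
    rw [mem_closedBall, Real.dist_eq, h4, smul_eq_mul, ← mul_sub, abs_mul, abs_of_pos (by positivity)]
    have h5 := abs_sub_le (proj θ y) (proj θ p) (proj ((j : ℝ) / n) p)
    calc δ⁻¹ * |proj θ y - proj ((j : ℝ) / n) p| ≤ δ⁻¹ * (3 * δ) := by gcongr; linarith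
      _ = 3 := by field_simp
  have hcover : Icc (0 : ℝ) 1 ⊆ ⋃ j ∈ Finset.range n, Icc ((j : ℝ) / n) ((j + 1) / n) := by
    rintro θ ⟨h0, h1⟩
    rcases eq_or_lt_of_le h1 with rfl | h1
    · refine mem_iUnion₂.2 ⟨n - 1, Finset.mem_range.2 (Nat.sub_lt (by exact_mod_cast hnpos) one_pos), ?_⟩
      rw [Nat.cast_sub (by exact_mod_cast hn1), Nat.cast_one, sub_add_cancel, div_self hnpos.ne']
      exact ⟨by rw [div_le_one hnpos]; linarith, le_rfl⟩
    · refine mem_iUnion₂.2 ⟨⌊θ * n⌋₊, Finset.mem_range.2 ?_, ?_, ?_⟩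
      · rw [Nat.floor_lt (by positivity)]; nlinarith
      · rw [div_le_iff₀ hnpos]; exact Nat.floor_le (by positivity)
      · rw [le_div_iff₀ hnpos]; exact (Nat.lt_floor_add_one _).le
  have hunion : ∀ s : Finset ℕ, ∀ f : ℝ → ℝ≥0∞,
      ∫⁻ θ in ⋃ j ∈ s, Icc ((j : ℝ) / n) ((j + 1) / n), f θ ≤
        ∑ j ∈ s, ∫⁻ θ in Icc ((j : ℝ) / n) ((j + 1) / n), f θ := by
    intro s f
    induction s using Finset.induction_on with
    | empty => simp
    | insert a s ha ih =>
      rw [Finset.sum_insert ha, Finset.set_biUnion_insert]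
      exact (lintegral_union_le _ _ _).trans (by gcongr)
  calc Fav (cthickening δ E)
      ≤ ∑ j ∈ Finset.range n, ∫⁻ θ in Icc ((j : ℝ) / n) ((j + 1) / n),
          μH[1] (proj θ '' cthickening δ E) :=
        (lintegral_mono_set hcover).trans (hunion _ _)
    _ ≤ ∑ j ∈ Finset.range n, ∫⁻ _θ in Icc ((j : ℝ) / n) ((j + 1) / n),
          ENNReal.ofReal δ * volume (S j) := by
        refine Finset.sum_le_sum fun j _ => setLIntegral_mono' measurableSet_Icc fun θ hθ => ?_
        rw [hausdorffMeasure_real]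
        refine (measure_mono (hsub j θ hθ)).trans ?_
        rw [Measure.addHaar_smul]
        simp [abs_of_pos hδ]
    _ = ∑ j ∈ Finset.range n, ENNReal.ofReal (δ / n * (volume (S j)).toReal) := by
        refine Finset.sum_congr rfl fun j _ => ?_
        rw [setLIntegral_const, Real.volume_Icc, ← ENNReal.ofReal_toReal (hSfin j),
          ← ENNReal.ofReal_mul hδ.le, ← ENNReal.ofReal_mul (by positivity),
          ENNReal.toReal_ofReal ENNReal.toReal_nonneg]
        congr 1; field_simp; ring
    _ = _ := by
        rw [Finset.mul_sum, ENNReal.ofReal_sum_of_nonneg fun j _ => by positivity]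

lemma exists_path_through_list (l : List R2) (y : R2) : ∃ (z : R2) (γ : Path y z),
    (∀ w ∈ y :: l, w ∈ range γ) ∧ μH[1] (range γ) ≤ ENNReal.ofReal (pathLen (y :: l)) := by
  have hna := Measure.nullSingletonClass_hausdorff (X := R2) (d := 1) (by norm_num)
  induction l generalizing y with
  | nil => exact ⟨y, Path.refl y, by simp, by simp⟩
  | cons w l ih =>
    obtain ⟨z, γ, h1, h2⟩ := ih w
    refine ⟨z, (Path.segment y w).trans γ, ?_, ?_⟩
    · intro x hx
      rw [Path.trans_range]
      rcases List.mem_cons.1 hx with rfl | hx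
      · exact Or.inl (Path.source_mem_range _)
      · exact Or.inr (h1 x hx)
    · rw [Path.trans_range, Path.range_segment, pathLen_cons_cons,
        ENNReal.ofReal_add dist_nonneg (pathLen_nonneg _), ← edist_dist, ← hausdorffMeasure_segment]
      exact (measure_union_le _ _).trans (by gcongr)

/-- A path of length at most `d` extends to a curve of length exactly `d`. -/
lemma exists_curve_of_path {y z : R2} (γ : Path y z) {d : ℝ} (hd : 0 ≤ d)
    (hγ : μH[1] (range γ) ≤ ENNReal.ofReal d) : ∃ c : ℝ → R2, ContinuousOn c (Icc 0 1) ∧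
      μH[1] (c '' Icc 0 1) = ENNReal.ofReal d ∧ range γ ⊆ c '' Icc 0 1 := by
  have hna := Measure.nullSingletonClass_hausdorff (X := R2) (d := 1) (by norm_num)
  obtain ⟨v, hv⟩ : ∃ v : R2, ‖v‖ = 1 := ⟨EuclideanSpace.single 0 1, by simp⟩
  obtain ⟨S, hS⟩ : ∃ S : ℝ → Set R2, ∀ t, S t = range γ ∪ segment ℝ z (z + t • v) :=
    ⟨_, fun _ => rfl⟩
  have hsub : ∀ s t : ℝ, 0 ≤ s → s ≤ t →
      segment ℝ z (z + s • v) ⊆ segment ℝ z (z + t • v) := by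
    intro s t hs hst
    refine (convex_segment _ _).segment_subset (left_mem_segment _ _ _) ?_
    rcases eq_or_lt_of_le (hs.trans hst) with h | h
    · have : s = t := by linarith
      rw [this]; exact right_mem_segment _ _ _
    · refine ⟨1 - s / t, s / t, ?_, by positivity, by ring, ?_⟩
      · rw [sub_nonneg, div_le_one h]; exact hst
      · rw [smul_add, smul_smul, div_mul_cancel₀ _ h.ne', sub_smul, one_smul]; abel
  have hseg : ∀ s t : ℝ, s ≤ t →
      μH[1] (segment ℝ (z + s • v) (z + t • v)) = ENNReal.ofReal (t - s) := by
    intro s t hst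
    rw [hausdorffMeasure_segment, edist_dist, dist_eq_norm, add_sub_add_left_eq_sub, ← sub_smul,
      norm_smul, hv, mul_one, Real.norm_eq_abs, abs_sub_comm, abs_of_nonneg (by linarith)]
  have hseg0 : ∀ t : ℝ, 0 ≤ t → μH[1] (segment ℝ z (z + t • v)) = ENNReal.ofReal t := by
    intro t ht
    simpa using hseg 0 t ht
  have hfin : ∀ t, 0 ≤ t → μH[1] (S t) ≠ ⊤ := by
    intro t ht
    rw [hS]
    refine ne_of_lt ((measure_union_le _ _).trans_lt ?_)
    rw [hseg0 t ht]
    exact ENNReal.add_lt_top.2 ⟨hγ.trans_lt ENNReal.ofReal_lt_top, ENNReal.ofReal_lt_top⟩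
  have hmono : ∀ s t : ℝ, 0 ≤ s → s ≤ t → (μH[1] (S s)).toReal ≤ (μH[1] (S t)).toReal := by
    intro s t hs hst
    refine ENNReal.toReal_mono (hfin t (hs.trans hst)) (measure_mono ?_)
    rw [hS, hS]
    exact union_subset_union_right _ (hsub s t hs hst)
  have hlip : ∀ s t : ℝ, 0 ≤ s → s ≤ t →
      (μH[1] (S t)).toReal ≤ (μH[1] (S s)).toReal + (t - s) := by
    intro s t hs hst
    rw [← ENNReal.toReal_ofReal (sub_nonneg.2 hst), ← ENNReal.toReal_add (hfin s hs)
      ENNReal.ofReal_ne_top]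
    refine ENNReal.toReal_mono (by simp [hfin s hs]) ?_
    rw [← hseg s t hst]
    refine (measure_mono ?_).trans (measure_union_le _ _)
    rw [hS, hS, union_assoc]
    refine union_subset_union_right _ ?_
    intro x hx
    rw [segment_eq_image'] at hx
    obtain ⟨a, ⟨ha0, ha1⟩, rfl⟩ := hx
    simp only [add_sub_cancel_left, smul_smul]
    rcases le_total (a * t) s with h | h
    · exact Or.inl (hsub (a * t) s (by have := hs.trans hst; positivity) h (right_mem_segment _ _ _))
    · refine Or.inr ?_
      rcases eq_or_lt_of_le hst with rfl | hst'
      · have : a * s = s := le_antisymm (by nlinarith) h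
        rw [this]; exact left_mem_segment _ _ _
      · rw [segment_eq_image']
        refine ⟨(a * t - s) / (t - s), ⟨div_nonneg (by linarith) (by linarith), ?_⟩, ?_⟩
        · rw [div_le_one (by linarith)]; nlinarith
        · simp only [add_sub_add_left_eq_sub]
          rw [← sub_smul, smul_smul, div_mul_cancel₀ _ (by linarith), add_assoc, ← add_smul]
          congr 2; ring
  have hcont : ContinuousOn (fun t => (μH[1] (S t)).toReal) (Icc 0 d) := by
    have : LipschitzOnWith 1 (fun t => (μH[1] (S t)).toReal) (Icc 0 d) := by
      refine LipschitzOnWith.of_dist_le_mul fun s hs t ht => ?_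
      rw [Real.dist_eq, Real.dist_eq, NNReal.coe_one, one_mul]
      rcases le_total s t with h | h
      · rw [abs_sub_comm, abs_sub_comm s, abs_of_nonneg (by linarith [hmono s t hs.1 h]),
          abs_of_nonneg (by linarith)]
        linarith [hlip s t hs.1 h]
      · rw [abs_of_nonneg (by linarith [hmono t s ht.1 h]), abs_of_nonneg (by linarith)]
        linarith [hlip t s ht.1 h]
    exact this.continuousOn
  have h0 : (μH[1] (S 0)).toReal ≤ d := by
    refine ENNReal.toReal_le_of_le_ofReal hd ?_
    rw [hS]
    refine (measure_union_le _ _).trans ?_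
    rw [hseg0 0 le_rfl]; simpa using hγ
  have h1 : d ≤ (μH[1] (S d)).toReal := by
    have h := ENNReal.toReal_mono (hfin d hd)
      (measure_mono (μ := μH[1]) (show segment ℝ z (z + d • v) ⊆ S d by
        rw [hS]; exact subset_union_right))
    rwa [hseg0 d hd, ENNReal.toReal_ofReal hd] at h
  obtain ⟨t, ht, htd⟩ := intermediate_value_Icc hd hcont ⟨h0, h1⟩
  refine ⟨(γ.trans (Path.segment z (z + t • v))).extend, (ContinuousMap.continuous _).continuousOn,
    ?_, ?_⟩
  · rw [Path.image_extend_of_subset _ Subset.rfl, Path.trans_range, Path.range_segment, ← hS,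
      ← htd, ENNReal.ofReal_toReal (hfin t ht.1)]
  · rw [Path.image_extend_of_subset _ Subset.rfl, Path.trans_range]
    exact subset_union_left

lemma hContent_le_diam {S : Set R2} {E : Set R2} (h : S ⊆ E) : hContent S ≤ ediam E := by
  refine (iInf₂_le (fun n : ℕ => if n = 0 then E else ∅) ?_).trans ?_
  · exact fun x hx => mem_iUnion.2 ⟨0, by simpa using h hx⟩
  · change ∑' n : ℕ, ediam (if n = 0 then E else ∅) ≤ _
    rw [tsum_eq_single 0 fun n hn => by simp [hn]]
    simp

lemma curveSup_le {E : Set R2} (hc : IsCompact E) (δ : ℝ) :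
    curveSup E δ ≤ ENNReal.ofReal (diam E) := by
  rw [← ediam_eq_ofReal_diam hc]
  exact iSup_le fun γ => iSup_le fun _ => iSup_le fun _ => hContent_le_diam inter_subset_right

/-- Points of a regular set on a short path contribute to `curveSup`. -/
lemma AhlforsRegular.card_le_curveSup {A : ℝ} (hA : 1 ≤ A) {E : Set R2} (hE : AhlforsRegular A E)
    (hc : IsCompact E) {δ η : ℝ} (hδ : 0 < δ) (hδd : δ < diam E) (hη : δ ≤ η) {l : List R2}
    (hl : pathLen l ≤ diam E) {P : Finset R2} (hP : ∀ p ∈ P, p ∈ E) (hPl : ∀ p ∈ P, p ∈ l)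
    (hsep : ∀ x ∈ P, ∀ y ∈ P, x ≠ y → δ / 2 < ‖x - y‖) :
    ENNReal.ofReal (P.card * δ / (200 * A ^ 2)) ≤ curveSup E η := by
  have hd : 0 < diam E := hδ.trans hδd
  have hA0 : 0 < A := by linarith
  rcases l with _ | ⟨y, l⟩
  · have : P = ∅ := Finset.eq_empty_of_forall_notMem fun p hp => by simpa using hPl p hp
    simp [this]
  obtain ⟨z, γ, h1, h2⟩ := exists_path_through_list l y
  obtain ⟨c, hcc, hcd, hγc⟩ := exists_curve_of_path γ hd.le
    (h2.trans (ENNReal.ofReal_le_ofReal hl))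
  have h3 : hContent (cthickening η (c '' Icc 0 1) ∩ E) ≤ curveSup E η :=
    le_iSup_of_le c (le_iSup_of_le hcc (le_iSup_of_le hcd le_rfl))
  refine le_trans ?_ h3
  have h4 := hE.measure_le_hContent hA hc hd
    (T := cthickening η (c '' Icc 0 1) ∩ E) inter_subset_right
  have h5 := hE.card_mul_le_measure hc (r := δ / 4) (by positivity) (by linarith) hP
    (fun x hx y hy hxy => by linarith [hsep x hx y hy hxy])
  have h6 : (⋃ p ∈ P, E ∩ ball p (δ / 4)) ⊆ cthickening η (c '' Icc 0 1) ∩ E := by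
    refine iUnion₂_subset fun p hp w hw => ⟨?_, hw.1⟩
    refine mem_cthickening_of_dist_le w p _ _ (hγc (h1 p (hPl p hp))) ?_
    have := mem_ball.1 hw.2
    linarith
  have h7 := (h5.trans (measure_mono h6)).trans h4
  have h50 : ENNReal.ofReal (50 * A) ≠ 0 := by simp; linarith
  rw [← ENNReal.mul_le_mul_iff_right h50 ENNReal.ofReal_ne_top]
  refine le_trans (le_of_eq ?_) h7
  rw [← ENNReal.ofReal_mul (by positivity)]
  congr 1; field_simp; ring

lemma pathLen_map_smul {a : ℝ} (ha : 0 ≤ a) (l : List R2) :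
    pathLen (l.map fun x => a • x) = a * pathLen l := by
  induction l with
  | nil => simp
  | cons x l ih =>
    cases l with
    | nil => simp
    | cons y l =>
      simp only [List.map_cons, pathLen_cons_cons] at ih ⊢
      rw [ih, mul_add, dist_smul₀, Real.norm_of_nonneg ha]

/-- Large Favard length of a neighbourhood forces a curve capturing much of the set. -/
lemma AhlforsRegular.diam_le_curveSup {A : ℝ} (hA : 1 ≤ A) {E : Set R2} (hE : AhlforsRegular A E)
    (hc : IsCompact E) {δ : ℝ} (hδ : 0 < δ) (hδd : δ < diam E) {κ : ℝ} (hκ : 0 < κ) (hκ1 : κ ≤ 1)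
    (hF : ENNReal.ofReal (κ * diam E) < Fav (cthickening δ E)) {N : ℕ}
    (hN : 2000 * (100 * A ^ 2) ^ 2 < κ * N) :
    ENNReal.ofReal (diam E / (200 * A ^ 2 * 2 ^ (8 * (2 ^ (4 * N ^ 2)) ^ 2))) ≤
      curveSup E (18 * δ) := by
  have hd : 0 < diam E := hδ.trans hδd
  have hA0 : 0 < A := by linarith
  obtain ⟨P, hPE, hsep, hcov, hreg, hcard⟩ := hE.exists_regularNet hA hc hδ hδd
  obtain ⟨n, hn, hn0, hFn⟩ := exists_Fav_cthickening_le_sum hc hδ hcov ⌈2 * (diam E / δ)⌉₊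
  have hn0' : (0 : ℝ) < n := by exact_mod_cast hn0
  have hinj : Function.Injective fun p : R2 => δ⁻¹ • p := by
    intro p q h
    simpa [hδ.ne'] using h
  have hproj : κ * (n * (diam E / δ)) ≤ ∑ j ∈ Finset.range n,
      (volume (⋃ z ∈ P.image fun p => δ⁻¹ • p, closedBall (prj n j z) 3)).toReal := by
    have h := (hF.trans_le hFn).le
    have h0 : 0 ≤ ∑ j ∈ Finset.range n,
        (volume (⋃ z ∈ P.image fun p => δ⁻¹ • p, closedBall (prj n j z) 3)).toReal :=
      Finset.sum_nonneg fun j _ => ENNReal.toReal_nonneg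
    rw [ENNReal.ofReal_le_ofReal_iff (by positivity)] at h
    have e : κ * (n * (diam E / δ)) = n / δ * (κ * diam E) := by ring
    rw [e]
    calc _ ≤ n / δ * (δ / n * _) := by gcongr
      _ = _ := by field_simp
  obtain ⟨l, hl, hlD, F, hFl, hFc⟩ := hreg.exists_short_path (by positivity)
    (by rwa [Finset.card_image_of_injective _ hinj]) hκ hκ1 hN ((Nat.le_ceil _).trans
      (by exact_mod_cast hn)) hproj
  have hδF : ∀ y ∈ F, δ • y ∈ P := by
    intro y hy
    obtain ⟨p, hp, rfl⟩ := Finset.mem_image.1 (hl y (hFl y hy))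
    rwa [smul_inv_smul₀ hδ.ne']
  have hinj' : Function.Injective fun p : R2 => δ • p := by
    intro p q h
    simpa [hδ.ne'] using h
  have hQP : ∀ p ∈ F.image fun y => δ • y, p ∈ P := by
    intro p hp
    obtain ⟨y, hy, rfl⟩ := Finset.mem_image.1 hp
    exact hδF y hy
  have key := hE.card_le_curveSup hA hc (η := 18 * δ) hδ hδd (by linarith)
    (l := l.map fun y => δ • y) (P := F.image fun y => δ • y)
    (by
      rw [pathLen_map_smul hδ.le]
      calc δ * pathLen l ≤ δ * (diam E / δ) := by gcongr
        _ = diam E := by field_simp)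
    (fun p hp => hPE p (hQP p hp))
    (fun p hp => by
      obtain ⟨y, hy, rfl⟩ := Finset.mem_image.1 hp
      exact List.mem_map_of_mem (hFl y hy))
    (fun x hx y hy hxy => hsep x (hQP x hx) y (hQP y hy) hxy)
  refine le_trans (ENNReal.ofReal_le_ofReal ?_) key
  rw [Finset.card_image_of_injective _ hinj']
  generalize (2 : ℝ) ^ (8 * (2 ^ (4 * N ^ 2)) ^ 2) = X at hFc ⊢
  calc diam E / (200 * A ^ 2 * X) = (diam E / δ / X) * (δ / (200 * A ^ 2)) := by field_simp
    _ ≤ F.card * (δ / (200 * A ^ 2)) := by gcongr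
    _ = _ := by ring

lemma curveSup_pos {A : ℝ} (hA : 1 ≤ A) {E : Set R2} (hE : AhlforsRegular A E)
    (hc : IsCompact E) {δ : ℝ} (hδ : 0 < δ) (hδd : δ < diam E) : 0 < curveSup E (18 * δ) := by
  have hd : 0 < diam E := hδ.trans hδd
  have hA0 : 0 < A := by linarith
  obtain ⟨x, hx⟩ : E.Nonempty := nonempty_iff_ne_empty.2 fun h => by simp [h] at hd
  have := hE.card_le_curveSup hA hc (η := 18 * δ) hδ hδd (by linarith) (l := [x]) (P := {x})
    (by simpa using hd.le) (by simpa using hx) (by simp) (by simp)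
  exact lt_of_lt_of_le (by simp; positivity) this

/-- The tower of exponentials beats the bound of the capturing lemma. -/
lemma tower_lt_exp {a L : ℝ} {N : ℕ} (ha : 1 ≤ a) (haL : a ≤ L) (hL : 1000 ≤ L)
    (hN : (N : ℝ) ≤ 2 * L) : Real.exp (Real.exp (Real.exp 1)) *
      (a * 2 ^ (8 * (2 ^ (4 * N ^ 2)) ^ 2)) < Real.exp (Real.exp (Real.exp L)) := by
  have htwo : (2 : ℝ) ≤ Real.exp 1 := by have := Real.add_one_le_exp 1; linarith
  have hpow : ∀ k : ℕ, (2 : ℝ) ^ k ≤ Real.exp k := fun k => by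
    calc (2 : ℝ) ^ k ≤ Real.exp 1 ^ k := by gcongr
      _ = Real.exp k := by rw [← Real.exp_nat_mul, mul_one]
  have h1 : Real.exp (Real.exp 1) ≤ 32 := by
    have h3 : Real.exp 1 < 3 := by have := Real.exp_one_lt_d9; linarith
    calc Real.exp (Real.exp 1) ≤ Real.exp 3 := Real.exp_le_exp.2 h3.le
      _ = Real.exp 1 ^ 3 := by rw [← Real.exp_nat_mul]; norm_num
      _ ≤ 3 ^ 3 := by gcongr
      _ ≤ 32 := by norm_num
  have h2 : a ≤ Real.exp L := by have := Real.add_one_le_exp L; linarith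
  have h3 : (2 : ℝ) ^ (8 * (2 ^ (4 * N ^ 2)) ^ 2) ≤ Real.exp (8 * Real.exp (32 * L ^ 2)) := by
    refine (hpow _).trans (Real.exp_le_exp.2 ?_)
    push_cast
    have h4 : ((2 : ℝ) ^ (4 * N ^ 2)) ^ 2 ≤ Real.exp (32 * L ^ 2) := by
      rw [← pow_mul]
      refine (hpow _).trans (Real.exp_le_exp.2 ?_)
      push_cast
      have : (N : ℝ) ^ 2 ≤ (2 * L) ^ 2 := by gcongr
      nlinarith
    linarith
  have h5 : 33 * L ^ 2 < Real.exp L := by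
    have := Real.quadratic_le_exp_of_nonneg (x := L / 3) (by linarith)
    have e : Real.exp L = Real.exp (L / 3) ^ 3 := by
      rw [← Real.exp_nat_mul]; congr 1; push_cast; ring
    have h6 : L ^ 2 / 18 ≤ Real.exp (L / 3) := by nlinarith
    rw [e]
    calc 33 * L ^ 2 < (L ^ 2 / 18) ^ 3 := by
          have : (1000 : ℝ) ^ 4 ≤ L ^ 4 := by gcongr
          nlinarith [sq_nonneg L, mul_pos (show (0:ℝ) < L by linarith) (show (0:ℝ) < L by linarith)]
      _ ≤ _ := by gcongr
  have h7 : 32 + L + 8 * Real.exp (32 * L ^ 2) < Real.exp (Real.exp L) := by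
    have h8 : Real.exp (33 * L ^ 2) < Real.exp (Real.exp L) := Real.exp_lt_exp.2 h5
    have e : Real.exp (33 * L ^ 2) = Real.exp (L ^ 2) * Real.exp (32 * L ^ 2) := by
      rw [← Real.exp_add]; congr 1; ring
    have h9 := Real.add_one_le_exp (L ^ 2)
    have h10 := Real.add_one_le_exp (32 * L ^ 2)
    have h11 : 9 * Real.exp (32 * L ^ 2) ≤ Real.exp (33 * L ^ 2) := by
      rw [e]; gcongr; nlinarith
    nlinarith
  calc _ ≤ Real.exp 32 * (Real.exp L * Real.exp (8 * Real.exp (32 * L ^ 2))) := by gcongr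
    _ = Real.exp (32 + L + 8 * Real.exp (32 * L ^ 2)) := by
        rw [← Real.exp_add, ← Real.exp_add, add_assoc]
    _ < _ := Real.exp_lt_exp.2 h7

/-- answer to the Peres–Solomyak question for Ahlfors regular sets. -/
theorem statement2 (A : ℝ) (hA : 1 ≤ A) :
    ∃ C : ℝ, 0 < C ∧ ∀ ε : ℝ, 0 < ε → ε < 1 → ∃ Cε : ℝ, 0 < Cε ∧
      ∀ E : Set R2, IsCompact E → AhlforsRegular A E →
        ∀ δ : ℝ, 0 < δ → δ < Metric.diam E →
          Fav (Metric.cthickening δ E) ≤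
            ENNReal.ofReal (C * Metric.diam E /
              (Real.log (Real.log (Real.log
                (Cε * Metric.diam E / (curveSup E (18 * δ)).toReal)))) ^ ((1:ℝ)/(3+ε))) := by
  have hA0 : 0 < A := by linarith
  obtain ⟨C, hC⟩ : ∃ C : ℝ, C = 8000 * (100 * A ^ 2) ^ 2 := ⟨_, rfl⟩
  have hC0 : 0 < C := by rw [hC]; positivity
  refine ⟨C, hC0, fun ε hε _ => ⟨Real.exp (Real.exp (Real.exp 1)), Real.exp_pos _, ?_⟩⟩
  intro E hc hE δ hδ hδd
  obtain ⟨d, hdd⟩ : ∃ d, d = diam E := ⟨_, rfl⟩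
  have hd : 0 < d := by rw [hdd]; exact hδ.trans hδd
  have hℓtop : curveSup E (18 * δ) ≠ ⊤ := ne_top_of_le_ne_top ENNReal.ofReal_ne_top (curveSup_le hc _)
  have hℓ0' := curveSup_pos hA hE hc hδ hδd
  obtain ⟨ℓ, hℓ⟩ : ∃ ℓ, ℓ = (curveSup E (18 * δ)).toReal := ⟨_, rfl⟩
  have hℓ0 : 0 < ℓ := by rw [hℓ]; exact ENNReal.toReal_pos hℓ0'.ne' hℓtop
  have hℓd : ℓ ≤ d := by
    rw [hℓ, hdd]; exact ENNReal.toReal_le_of_le_ofReal diam_nonneg (curveSup_le hc _)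
  rw [← hdd, ← hℓ]
  obtain ⟨Y, hY⟩ : ∃ Y, Y = Real.exp (Real.exp (Real.exp 1)) * d / ℓ := ⟨_, rfl⟩
  obtain ⟨L, hL⟩ : ∃ L, L = Real.log (Real.log (Real.log Y)) := ⟨_, rfl⟩
  rw [← hY, ← hL]
  have hY1 : Real.exp (Real.exp (Real.exp 1)) ≤ Y := by
    rw [hY, mul_div_assoc]
    exact le_mul_of_one_le_right (Real.exp_pos _).le ((one_le_div hℓ0).2 hℓd)
  have hY0 : 0 < Y := (Real.exp_pos _).trans_le hY1
  have hY2 : Real.exp (Real.exp 1) ≤ Real.log Y := (Real.le_log_iff_exp_le hY0).2 hY1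
  have hY20 : 0 < Real.log Y := (Real.exp_pos _).trans_le hY2
  have hY3 : Real.exp 1 ≤ Real.log (Real.log Y) := (Real.le_log_iff_exp_le hY20).2 hY2
  have hY30 : 0 < Real.log (Real.log Y) := (Real.exp_pos _).trans_le hY3
  have hL1 : 1 ≤ L := by rw [hL]; exact (Real.le_log_iff_exp_le hY30).2 hY3
  have hYL : Real.exp (Real.exp (Real.exp L)) = Y := by
    rw [hL, Real.exp_log hY30, Real.exp_log hY20, Real.exp_log hY0]
  obtain ⟨M, hM⟩ : ∃ M, M = L ^ ((1 : ℝ) / (3 + ε)) := ⟨_, rfl⟩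
  rw [← hM]
  have hM1 : 1 ≤ M := by rw [hM]; exact Real.one_le_rpow hL1 (by positivity)
  have hML : M ≤ L := by
    rw [hM]
    calc L ^ ((1 : ℝ) / (3 + ε)) ≤ L ^ (1 : ℝ) :=
          Real.rpow_le_rpow_of_exponent_le hL1 (by rw [div_le_one (by linarith)]; linarith)
      _ = L := Real.rpow_one L
  have hM0 : 0 < M := by linarith
  by_contra! hlt
  have htriv := Fav_cthickening_le hc hδ.le hδd.le
  rw [← hdd] at htriv
  have h4 : C / M < 4 := by
    have := (ENNReal.ofReal_lt_ofReal_iff (by positivity)).1 (hlt.trans_le htriv)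
    have e : C * d / M = C / M * d := by ring
    rw [e] at this
    exact lt_of_mul_lt_mul_right this hd.le
  have hCM : C < 4 * M := by rwa [div_lt_iff₀ hM0] at h4
  have hA4 : 1 ≤ A ^ 2 := one_le_pow₀ hA
  have hLbig : 2000 * (100 * A ^ 2) ^ 2 < L := by linarith
  have hLA : 200 * A ^ 2 ≤ L := by nlinarith
  have hL1000 : 1000 ≤ L := by nlinarith
  obtain ⟨N, hN1, hN2⟩ : ∃ N : ℕ, L < N ∧ (N : ℝ) ≤ 2 * L :=
    ⟨⌊L⌋₊ + 1, by push_cast; exact Nat.lt_floor_add_one L, by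
      push_cast; linarith [Nat.floor_le (show 0 ≤ L by linarith)]⟩
  have key := hE.diam_le_curveSup hA hc hδ hδd (κ := C / M / 4) (N := N) (by positivity)
    (by linarith)
    (by
      refine lt_of_le_of_lt (ENNReal.ofReal_le_ofReal ?_) hlt
      rw [← hdd, div_div, div_mul_eq_mul_div]
      gcongr
      linarith)
    (by
      have e : 2000 * (100 * A ^ 2) ^ 2 = C / M / 4 * M := by
        rw [hC]; field_simp; ring
      rw [e]
      gcongr
      linarith)
  have key2 : d / (200 * A ^ 2 * 2 ^ (8 * (2 ^ (4 * N ^ 2)) ^ 2)) ≤ ℓ := by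
    rw [← hdd] at key
    rw [hℓ]
    exact (ENNReal.ofReal_le_iff_le_toReal hℓtop).1 key
  have htower := tower_lt_exp (a := 200 * A ^ 2) (by linarith) hLA hL1000 hN2
  rw [hYL, hY, mul_div_assoc] at htower
  have h8 := lt_of_mul_lt_mul_left htower (Real.exp_pos _).le
  rw [lt_div_iff₀ hℓ0] at h8
  rw [div_le_iff₀ (by positivity), mul_comm] at key2
  exact absurd h8 (not_lt.2 key2)

end
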